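/- There is a constant C > 0 such that ∫_0^T |ζ(1/2 + it)|^{12} dt ≤ C T² (log T)^{17} for all T ≥ 2. -/

import Mathlib

open Real MeasureTheory

namespace HB12

/-- `e x = exp (i x)`. -/
noncomputable def e (x : ℝ) : ℂ := Complex.exp (Complex.I * x)

lemma norm_e (x : ℝ) : ‖e x‖ = 1 := Complex.norm_exp_I_mul_ofReal x
lemma e_add (x y : ℝ) : e (x + y) = e x * e y := by
  simp only [e]; rw [← Complex.exp_add]; push_cast; ring_nf
lemma e_zero : e 0 = 1 := by simp [e]
lemma e_ne (x : ℝ) : e x ≠ 0 := Complex.exp_ne_zero _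
lemma e_neg_mul (x : ℝ) : e (-x) * e x = 1 := by rw [← e_add]; simp [e_zero]
lemma conj_e (x : ℝ) : (starRingEnd ℂ) (e x) = e (-x) := by
  simp only [e]; rw [← Complex.exp_conj]; simp
lemma hasDerivAt_e (x : ℝ) : HasDerivAt e (Complex.I * e x) x := by
  have h : HasDerivAt (fun y : ℝ => Complex.I * (y : ℂ)) (Complex.I * 1) x :=
    (Complex.ofRealCLM.hasDerivAt (x := x)).const_mul Complex.I
  have := h.cexp
  simp only [mul_one] at this
  unfold e
  convert this using 1
  ring
lemma contDiff_e {n : WithTop ℕ∞} : ContDiff ℝ n e := by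
  unfold e
  exact (contDiff_const.mul Complex.ofRealCLM.contDiff).cexp
@[fun_prop] lemma continuous_e : Continuous e := (contDiff_e (n := 0)).continuous
lemma hasDerivAt_e_comp {f : ℝ → ℝ} {f' x : ℝ} (h : HasDerivAt f f' x) :
    HasDerivAt (fun y => e (f y)) (Complex.I * f' * e (f x)) x := by
  have := HasDerivAt.scomp x (hasDerivAt_e (f x)) h
  have h2 : Complex.I * f' * e (f x) = f' • (Complex.I * e (f x)) := by
    rw [Complex.real_smul]; ring
  rw [h2]; exact this
lemma norm_e_sub_le (x y : ℝ) : ‖e x - e y‖ ≤ |x - y| := by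
  have : e x - e y = e y * (Complex.exp (Complex.I * ((x - y : ℝ))) - 1) := by
    have h := e_add y (x - y)
    rw [add_sub_cancel] at h
    rw [h]; simp only [e]; ring
  rw [this, norm_mul, norm_e, one_mul]
  exact Real.norm_exp_I_mul_ofReal_sub_one_le
lemma norm_e_sub_one_ge {x : ℝ} (h0 : 0 ≤ x) (h3 : x ≤ 3) : x / 2 ≤ ‖e x - 1‖ := by
  rw [e, Complex.norm_exp_I_mul_ofReal_sub_one]
  have h1 := Real.mul_le_sin (x := x / 2) (by linarith) (by linarith [Real.pi_gt_three])
  have h2 : 1 / 2 ≤ 2 / π := by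
    rw [div_le_div_iff₀ (by norm_num) Real.pi_pos]; linarith [Real.pi_le_four]
  have : x / 4 ≤ Real.sin (x / 2) := by
    nlinarith
  rw [Real.norm_eq_abs]
  exact le_trans (by linarith) (le_abs_self _)

/-- Kusmin–Landau type estimate. -/
lemma kl (a θ : ℕ → ℝ) (A B : ℕ) (hAB : A ≤ B) (a0 δ0 V : ℝ) (hδ0 : 0 < δ0)
    (ha : ∀ n, A ≤ n → n ≤ B → |a n| ≤ a0)
    (hV : ∑ n ∈ Finset.Ico A B, |a (n + 1) - a n| ≤ V)
    (hδ : ∀ n, A ≤ n → n ≤ B → δ0 ≤ θ n - θ (n + 1))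
    (hδ3 : ∀ n, A ≤ n → n ≤ B → θ n - θ (n + 1) ≤ 3)
    (hmono : ∀ n, A ≤ n → n < B → θ (n + 1) - θ (n + 2) ≤ θ n - θ (n + 1)) :
    ‖∑ n ∈ Finset.Ico A B, (a n : ℂ) * e (θ n)‖ ≤ (8 * a0 + 2 * V) / δ0 := by
  set δ : ℕ → ℝ := fun n => θ n - θ (n + 1) with hδdef
  set c : ℕ → ℂ := fun n => (e (-δ n) - 1)⁻¹ with hc
  have ha0 : 0 ≤ a0 := le_trans (abs_nonneg _) (ha A le_rfl hAB)
  have hge : ∀ n, A ≤ n → n ≤ B → δ n / 2 ≤ ‖e (-δ n) - 1‖ := by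
    intro n h1 h2
    have h3 := norm_e_sub_one_ge (x := δ n) (le_trans hδ0.le (hδ n h1 h2)) (hδ3 n h1 h2)
    have : ‖e (-δ n) - 1‖ = ‖e (δ n) - 1‖ := by
      have h : e (-δ n) - 1 = - (e (-δ n) * (e (δ n) - 1)) := by
        rw [mul_sub, e_neg_mul]; ring
      rw [h, norm_neg, norm_mul, norm_e, one_mul]
    rw [this]; exact h3
  have hpos : ∀ n, A ≤ n → n ≤ B → 0 < δ n := fun n h1 h2 => lt_of_lt_of_le hδ0 (hδ n h1 h2)
  have hne : ∀ n, A ≤ n → n ≤ B → e (-δ n) - 1 ≠ 0 := by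
    intro n h1 h2 h
    have := hge n h1 h2
    rw [h, norm_zero] at this
    linarith [hpos n h1 h2]
  have hcn : ∀ n, A ≤ n → n ≤ B → ‖c n‖ ≤ 2 / δ n := by
    intro n h1 h2
    simp only [hc]
    rw [norm_inv, inv_le_comm₀ (lt_of_lt_of_le (by linarith [hpos n h1 h2]) (hge n h1 h2))
      (by have := hpos n h1 h2; positivity), inv_div]
    exact hge n h1 h2
  have hcn0 : ∀ n, A ≤ n → n ≤ B → ‖c n‖ ≤ 2 / δ0 := by
    intro n h1 h2
    refine (hcn n h1 h2).trans ?_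
    have := hδ n h1 h2
    gcongr
  have hcd : ∀ n, A ≤ n → n < B → ‖c (n + 1) - c n‖ ≤ 4 * (1 / δ (n + 1) - 1 / δ n) := by
    intro n h1 h2
    have e1 := hne n h1 h2.le
    have e2 := hne (n + 1) (by omega) h2
    have h : c (n + 1) - c n = c (n + 1) * (e (-δ n) - e (-δ (n + 1))) * c n := by
      simp only [hc]; field_simp; ring
    rw [h, norm_mul, norm_mul]
    have p1 := hpos n h1 h2.le
    have p2 := hpos (n + 1) (by omega) h2
    have hm : δ (n + 1) ≤ δ n := hmono n h1 h2
    have h3 : ‖e (-δ n) - e (-δ (n + 1))‖ ≤ δ n - δ (n + 1) := by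
      refine (norm_e_sub_le _ _).trans ?_
      rw [abs_sub_comm, abs_of_nonneg] <;> linarith
    calc _ ≤ (2 / δ (n + 1)) * (δ n - δ (n + 1)) * (2 / δ n) := by
          gcongr
          · exact hcn _ (by omega) h2
          · exact hcn _ h1 h2.le
      _ = 4 * (1 / δ (n + 1) - 1 / δ n) := by field_simp; ring
  have hz : ∀ n, A ≤ n → n ≤ B → (a n : ℂ) * e (θ n) = (a n * c n) * (e (θ (n + 1)) - e (θ n)) := by
    intro n h1 h2
    have h : e (θ (n + 1)) = e (-δ n) * e (θ n) := by rw [← e_add]; simp [hδdef]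
    rw [h]; simp only [hc]
    have := hne n h1 h2
    field_simp
  have hparts : ∀ M, A ≤ M → ∑ n ∈ Finset.Ico A M, (a n * c n) * (e (θ (n + 1)) - e (θ n)) =
      a M * c M * e (θ M) - a A * c A * e (θ A)
        - ∑ n ∈ Finset.Ico A M, (a (n + 1) * c (n + 1) - a n * c n) * e (θ (n + 1)) := by
    intro M hM
    induction M, hM using Nat.le_induction with
    | base => simp
    | succ M hM ih => rw [Finset.sum_Ico_succ_top hM, Finset.sum_Ico_succ_top hM, ih]; ring
  have htel : ∀ M, A ≤ M → ∑ n ∈ Finset.Ico A M, (1 / δ (n + 1) - 1 / δ n) = 1 / δ M - 1 / δ A := by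
    intro M hM
    induction M, hM using Nat.le_induction with
    | base => simp
    | succ M hM ih => rw [Finset.sum_Ico_succ_top hM, ih]; ring
  have hsum : ∑ n ∈ Finset.Ico A B, (a n : ℂ) * e (θ n) =
      a B * c B * e (θ B) - a A * c A * e (θ A)
        - ∑ n ∈ Finset.Ico A B, (a (n + 1) * c (n + 1) - a n * c n) * e (θ (n + 1)) := by
    rw [← hparts B hAB]
    refine Finset.sum_congr rfl fun n hn => ?_
    rw [Finset.mem_Ico] at hn
    exact hz n hn.1 hn.2.le
  have hb : ∀ n, A ≤ n → n ≤ B → ‖(a n : ℂ) * c n * e (θ n)‖ ≤ a0 * (2 / δ0) := by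
    intro n h1 h2
    rw [norm_mul, norm_mul, norm_e, mul_one, Complex.norm_real, Real.norm_eq_abs]
    exact mul_le_mul (ha n h1 h2) (hcn0 n h1 h2) (norm_nonneg _) ha0
  have hlast : ‖∑ n ∈ Finset.Ico A B, (a (n + 1) * c (n + 1) - a n * c n) * e (θ (n + 1))‖ ≤
      V * (2 / δ0) + a0 * (4 / δ0) := by
    calc _ ≤ ∑ n ∈ Finset.Ico A B, (|a (n + 1) - a n| * (2 / δ0) +
              a0 * (4 * (1 / δ (n + 1) - 1 / δ n))) := by
          refine norm_sum_le_of_le _ fun n hn => ?_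
          rw [Finset.mem_Ico] at hn
          rw [norm_mul, norm_e, mul_one]
          have : (a (n + 1) * c (n + 1) - a n * c n : ℂ) =
            ((a (n + 1) - a n : ℝ) : ℂ) * c (n + 1) + a n * (c (n + 1) - c n) := by push_cast; ring
          rw [this]
          refine (norm_add_le _ _).trans ?_
          rw [norm_mul, norm_mul, Complex.norm_real, Complex.norm_real, Real.norm_eq_abs, Real.norm_eq_abs]
          refine add_le_add ?_ ?_
          · exact mul_le_mul_of_nonneg_left (hcn0 _ (by omega) (by omega)) (abs_nonneg _)
          · exact mul_le_mul (ha n hn.1 hn.2.le) (hcd n hn.1 hn.2) (norm_nonneg _) ha0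
      _ = (∑ n ∈ Finset.Ico A B, |a (n + 1) - a n|) * (2 / δ0) + a0 * (4 * (1 / δ B - 1 / δ A)) := by
          rw [Finset.sum_add_distrib, ← Finset.sum_mul, ← Finset.mul_sum, ← Finset.mul_sum, htel B hAB]
      _ ≤ V * (2 / δ0) + a0 * (4 / δ0) := by
          have h1 := hpos A le_rfl hAB
          have h2 : 1 / δ B ≤ 1 / δ0 := one_div_le_one_div_of_le hδ0 (hδ B hAB le_rfl)
          have h3 : 4 * (1 / δ B - 1 / δ A) ≤ 4 / δ0 := by
            have : 0 < 1 / δ A := by positivity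
            calc _ ≤ 4 * (1 / δ0) := by linarith
              _ = _ := by ring
          gcongr
  rw [hsum]
  refine (norm_sub_le _ _).trans ?_
  have := norm_sub_le (a B * c B * e (θ B)) (a A * c A * e (θ A))
  have h1 := hb B hAB le_rfl
  have h2 := hb A le_rfl hAB
  have : (8 * a0 + 2 * V) / δ0 = a0 * (2 / δ0) + a0 * (2 / δ0) + (V * (2 / δ0) + a0 * (4 / δ0)) := by
    field_simp; ring
  linarith

end HB12

open Real MeasureTheory
namespace HB12
open Filter Topology

noncomputable def gz (n : ℕ) (s : ℂ) : ℂ :=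
  (s - 1) * (((n : ℝ) + 1 : ℝ) : ℂ) ^ (-s) -
    ((((n : ℝ) + 1 : ℝ) : ℂ) ^ (1 - s) - (((n : ℝ) + 2 : ℝ) : ℂ) ^ (1 - s))

lemma cpow_sub_le {a x : ℝ} (ha : 0 < a) (hx : a ≤ x) {s : ℂ} (hs : 0 < s.re) :
    ‖(x : ℂ) ^ (-s) - (a : ℂ) ^ (-s)‖ ≤ ‖s‖ * a ^ (-s.re - 1) * (x - a) := by
  have hs0 : s ≠ 0 := by rintro rfl; simp at hs
  refine norm_image_sub_le_of_norm_deriv_le_segment' (a := a) (b := x)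
    (f := fun y : ℝ => (y : ℂ) ^ (-s)) (f' := fun y : ℝ => -s * (y : ℂ) ^ (-s - 1)) ?_ ?_ x ⟨hx, le_rfl⟩
  · intro y hy
    exact (hasDerivAt_ofReal_cpow_const (by linarith [hy.1]) (neg_ne_zero.mpr hs0)).hasDerivWithinAt
  · intro y hy
    rw [norm_mul, norm_neg, Complex.norm_cpow_eq_rpow_re_of_pos (by linarith [hy.1])]
    simp only [Complex.sub_re, Complex.neg_re, Complex.one_re]
    gcongr 1
    exact Real.rpow_le_rpow_of_nonpos ha hy.1 (by linarith)

lemma gz_le (n : ℕ) {s : ℂ} (hs : 0 < s.re) :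
    ‖gz n s‖ ≤ ‖s - 1‖ * ‖s‖ * ((n : ℝ) + 1) ^ (-s.re - 1) := by
  by_cases h1 : s = 1
  · simp [gz, h1]
  set a : ℝ := (n : ℝ) + 1 with ha
  have hap : 0 < a := by positivity
  have key := norm_image_sub_le_of_norm_deriv_le_segment' (a := a) (b := a + 1)
    (f := fun y : ℝ => (s - 1) * (a : ℂ) ^ (-s) * (y : ℂ) + (y : ℂ) ^ (1 - s))
    (f' := fun y : ℝ => (s - 1) * (a : ℂ) ^ (-s) * 1 + (1 - s) * (y : ℂ) ^ (1 - s - 1))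
    (C := ‖s - 1‖ * ‖s‖ * a ^ (-s.re - 1)) ?_ ?_ (a + 1) ⟨by linarith, le_rfl⟩
  · have e2 : gz n s = (s - 1) * (a : ℂ) ^ (-s) * ((a + 1 : ℝ) : ℂ) + ((a + 1 : ℝ) : ℂ) ^ (1 - s) -
        ((s - 1) * (a : ℂ) ^ (-s) * (a : ℂ) + (a : ℂ) ^ (1 - s)) := by
      have : a + 1 = (n : ℝ) + 2 := by rw [ha]; ring
      rw [gz, ← this, ← ha]; push_cast; ring
    rw [e2]
    simpa using key
  · intro y hy
    have := (hasDerivAt_ofReal_cpow_const (x := y) (by linarith [hy.1]) (r := 1 - s)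
      (by rw [sub_ne_zero]; exact fun h => h1 h.symm))
    exact (((Complex.ofRealCLM.hasDerivAt (x := y)).const_mul _).add this).hasDerivWithinAt
  · intro y hy
    have e1 : (s - 1) * (a : ℂ) ^ (-s) * 1 + (1 - s) * (y : ℂ) ^ (1 - s - 1) =
        (s - 1) * - ((y : ℂ) ^ (-s) - (a : ℂ) ^ (-s)) := by
      rw [show 1 - s - 1 = -s by ring]; ring
    rw [e1, norm_mul, norm_neg, mul_assoc]
    gcongr 1
    refine (cpow_sub_le hap hy.1 hs).trans ?_
    refine mul_le_of_le_one_right (by positivity) (by linarith [hy.2])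

lemma gz_sum (M : ℕ) (s : ℂ) : ∑ n ∈ Finset.range M, gz n s =
    (s - 1) * ∑ n ∈ Finset.range M, (((n : ℝ) + 1 : ℝ) : ℂ) ^ (-s) - 1 + (((M : ℝ) + 1 : ℝ) : ℂ) ^ (1 - s) := by
  induction M with
  | zero => simp
  | succ M ih =>
    rw [Finset.sum_range_succ, ih, Finset.sum_range_succ, gz]
    have : (((M + 1 : ℕ) : ℝ) + 1 : ℝ) = (M : ℝ) + 2 := by push_cast; ring
    rw [this]; ring

lemma summable_aux {c : ℝ} (hc : 1 < c) : Summable fun n : ℕ => ((n : ℝ) + 1) ^ (-c) := by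
  have := (summable_nat_add_iff 1).mpr (Real.summable_nat_rpow (p := -c) |>.mpr (by linarith))
  simpa using this

lemma gz_hasSum_one {s : ℂ} (hs : 1 < s.re) : ∑' n, gz n s = riemannZeta₁ s - 1 := by
  have h1 : s ≠ 1 := by rintro rfl; simp at hs
  have hsm : Summable fun n => gz n s := by
    refine Summable.of_norm_bounded ((summable_aux (c := s.re + 1) (by linarith)).mul_left (‖s - 1‖ * ‖s‖)) fun n => ?_
    convert gz_le n (s := s) (by linarith) using 3
    ring
  have hz : Summable fun n : ℕ => (((n : ℝ) + 1 : ℝ) : ℂ) ^ (-s) := by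
    refine Summable.of_norm_bounded (summable_aux hs) fun n => ?_
    rw [Complex.norm_cpow_eq_rpow_re_of_pos (by positivity)]; simp
  have t1 := hsm.hasSum.tendsto_sum_nat
  have t2 : Tendsto (fun M : ℕ => ∑ n ∈ Finset.range M, gz n s) atTop
      (𝓝 ((s - 1) * (∑' n : ℕ, (((n : ℝ) + 1 : ℝ) : ℂ) ^ (-s)) - 1 + 0)) := by
    simp_rw [gz_sum]
    refine ((hz.hasSum.tendsto_sum_nat.const_mul _).sub_const 1).add ?_
    rw [tendsto_zero_iff_norm_tendsto_zero]
    have : ∀ M : ℕ, ‖(((M : ℝ) + 1 : ℝ) : ℂ) ^ (1 - s)‖ = ((M : ℝ) + 1) ^ (-(s.re - 1)) := by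
      intro M
      rw [Complex.norm_cpow_eq_rpow_re_of_pos (by positivity)]; simp
    simp_rw [this]
    exact (tendsto_rpow_neg_atTop (by linarith)).comp
      (tendsto_atTop_add_const_right _ _ tendsto_natCast_atTop_atTop)
  have := tendsto_nhds_unique t1 t2
  rw [this, add_zero]
  have hzeta : riemannZeta s = ∑' n : ℕ, (((n : ℝ) + 1 : ℝ) : ℂ) ^ (-s) := by
    rw [zeta_eq_tsum_one_div_nat_add_one_cpow hs]
    congr 1; ext n; rw [Complex.cpow_neg, one_div]; push_cast; rfl
  rw [← hzeta, riemannZeta_eq_inv_sub_mul h1]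
  have : s - 1 ≠ 0 := sub_ne_zero.mpr h1
  field_simp

lemma gz_tsum {s : ℂ} (hs : 1 / 4 < s.re) : ∑' n, gz n s = riemannZeta₁ s - 1 := by
  set R : ℝ := ‖s‖ + 3 with hR
  set U : Set ℂ := {z | 1 / 4 < z.re} ∩ Metric.ball 0 R with hU
  have hUo : IsOpen U := (isOpen_lt continuous_const Complex.continuous_re).inter Metric.isOpen_ball
  have hUc : IsPreconnected U :=
    ((convex_halfSpace_re_gt (1 / 4)).inter (convex_ball 0 R)).isPreconnected
  have d1 : DifferentiableOn ℂ (fun z => ∑' n, gz n z) U := by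
    refine Complex.differentiableOn_tsum_of_summable_norm
      ((summable_aux (c := 5 / 4) (by norm_num)).mul_left ((R + 1) * R)) (fun n => ?_) hUo ?_
    · intro z _
      apply DifferentiableAt.differentiableWithinAt
      unfold gz
      have h1 : ((((n : ℝ) + 1 : ℝ)) : ℂ) ≠ 0 := by
        rw [Complex.ofReal_ne_zero]; positivity
      have h2 : ((((n : ℝ) + 2 : ℝ)) : ℂ) ≠ 0 := by
        rw [Complex.ofReal_ne_zero]; positivity
      refine ((differentiableAt_id.sub_const 1).mul ?_).sub (DifferentiableAt.sub ?_ ?_)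
      · exact DifferentiableAt.const_cpow differentiableAt_id.neg (Or.inl h1)
      · exact DifferentiableAt.const_cpow (differentiableAt_id.const_sub 1) (Or.inl h1)
      · exact DifferentiableAt.const_cpow (differentiableAt_id.const_sub 1) (Or.inl h2)
    · intro n z hz
      have hz1 : 1 / 4 < z.re := hz.1
      have hz2 : ‖z‖ < R := by simpa using hz.2
      refine (gz_le n (by linarith)).trans ?_
      have h3 : ‖z - 1‖ ≤ R + 1 := by
        refine (norm_sub_le _ _).trans ?_
        simp; linarith
      gcongr
      · linarith
      · linarith
  have d2 : DifferentiableOn ℂ (fun z => riemannZeta₁ z - 1) U :=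
    (differentiable_riemannZeta₁.sub_const 1).differentiableOn
  have h2U : (2 : ℂ) ∈ U := by
    refine ⟨?_, ?_⟩
    · show (1 / 4 : ℝ) < (2 : ℂ).re
      norm_num
    · simp [hR]; linarith [norm_nonneg s]
  have hsU : s ∈ U := by
    refine ⟨hs, ?_⟩
    simp [hR]
  have := (d1.analyticOnNhd hUo).eqOn_of_preconnected_of_eventuallyEq (d2.analyticOnNhd hUo) hUc h2U ?_ hsU
  · exact this
  · have : {z : ℂ | 1 < z.re} ∈ 𝓝 (2 : ℂ) :=
      (isOpen_lt continuous_const Complex.continuous_re).mem_nhds (by simp)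
    filter_upwards [this] with z hz
    exact gz_hasSum_one hz

lemma tail_rpow (M : ℕ) (hM : 1 ≤ M) : ∑' n : ℕ, (((n + M : ℕ) : ℝ) + 1) ^ (-(3 / 2) : ℝ) ≤ 2 * (M : ℝ) ^ (-(1 / 2) : ℝ) := by
  have hb : ∀ m : ℕ, 1 ≤ m → ((m : ℝ) + 1) ^ (-(3 / 2) : ℝ) ≤ 2 * (m : ℝ) ^ (-(1 / 2) : ℝ) - 2 * ((m : ℝ) + 1) ^ (-(1 / 2) : ℝ) := by
    intro m hm
    have hm' : (0 : ℝ) < m := by exact_mod_cast hm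
    set x := √(m : ℝ) with hx
    set y := √((m : ℝ) + 1) with hy
    have hx0 : 0 < x := Real.sqrt_pos.mpr hm'
    have hxy : x ≤ y := Real.sqrt_le_sqrt (by linarith)
    have hy0 : 0 < y := by linarith
    have hx2 : x ^ 2 = m := Real.sq_sqrt hm'.le
    have hy2 : y ^ 2 = m + 1 := Real.sq_sqrt (by linarith)
    have e1 : (m : ℝ) ^ (-(1 / 2) : ℝ) = 1 / x := by
      rw [Real.rpow_neg hm'.le, ← Real.sqrt_eq_rpow, one_div]
    have e2 : ((m : ℝ) + 1) ^ (-(1 / 2) : ℝ) = 1 / y := by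
      rw [Real.rpow_neg (by linarith), ← Real.sqrt_eq_rpow, one_div]
    have e3 : ((m : ℝ) + 1) ^ (-(3 / 2) : ℝ) = 1 / y ^ 3 := by
      rw [show (-(3 / 2) : ℝ) = -(1 / 2) * (3 : ℕ) by norm_num, Real.rpow_mul (by linarith), e2, Real.rpow_natCast]
      rw [div_pow, one_pow]
    rw [e1, e2, e3, div_le_iff₀ (by positivity)]
    have : (2 * (1 / x) - 2 * (1 / y)) * y ^ 3 = 2 * y ^ 2 * (y - x) / x := by field_simp
    rw [this, le_div_iff₀ hx0]
    have h4 : (y - x) * (y + x) = 1 := by nlinarith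
    have h5 : 1 ≤ (y - x) * (2 * y) := by nlinarith
    nlinarith
  have hsum : ∀ K : ℕ, ∑ n ∈ Finset.range K, (((n + M : ℕ) : ℝ) + 1) ^ (-(3 / 2) : ℝ) ≤
      2 * (M : ℝ) ^ (-(1 / 2) : ℝ) - 2 * ((K + M : ℕ) : ℝ) ^ (-(1 / 2) : ℝ) := by
    intro K
    induction K with
    | zero => simp
    | succ K ih =>
      rw [Finset.sum_range_succ]
      have := hb (K + M) (by omega)
      have e : (((K + 1 + M : ℕ)) : ℝ) = ((K + M : ℕ) : ℝ) + 1 := by push_cast; ring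
      rw [e]; linarith
  refine Real.tsum_le_of_sum_range_le (fun n => by positivity) fun K => (hsum K).trans ?_
  have : 0 ≤ ((K + M : ℕ) : ℝ) ^ (-(1 / 2) : ℝ) := by positivity
  linarith

/-- Crude approximation of zeta. -/
lemma zeta_approx1 (M : ℕ) (hM : 1 ≤ M) {s : ℂ} (hs : s.re = 1 / 2) :
    ‖riemannZeta s - ∑ n ∈ Finset.range M, (((n : ℝ) + 1 : ℝ) : ℂ) ^ (-s)‖ ≤
      ((M : ℝ) + 1) ^ (1 / 2 : ℝ) / ‖s - 1‖ + 2 * ‖s‖ * (M : ℝ) ^ (-(1 / 2) : ℝ) := by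
  have h1 : s ≠ 1 := by rintro rfl; norm_num at hs
  have hs1 : 0 < ‖s - 1‖ := norm_pos_iff.mpr (sub_ne_zero.mpr h1)
  have hb : ∀ n, ‖gz n s‖ ≤ ‖s - 1‖ * ‖s‖ * ((n : ℝ) + 1) ^ (-(3 / 2) : ℝ) := by
    intro n
    have := gz_le n (s := s) (by rw [hs]; norm_num)
    rw [hs] at this
    convert this using 3; norm_num
  have hsm0 := (summable_aux (c := 3 / 2) (by norm_num))
  have hsm : Summable fun n => gz n s :=
    Summable.of_norm_bounded (hsm0.mul_left (‖s - 1‖ * ‖s‖)) hb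
  have hsplit := hsm.sum_add_tsum_nat_add M
  rw [gz_tsum (by rw [hs]; norm_num), gz_sum] at hsplit
  have htail : ‖∑' n, gz (n + M) s‖ ≤ ‖s - 1‖ * ‖s‖ * (2 * (M : ℝ) ^ (-(1 / 2) : ℝ)) := by
    have hs2 : Summable fun n : ℕ => (((n + M : ℕ) : ℝ) + 1) ^ (-(3 / 2) : ℝ) :=
      (summable_nat_add_iff (f := fun n : ℕ => ((n : ℝ) + 1) ^ (-(3 / 2) : ℝ)) M).mpr hsm0
    refine (tsum_of_norm_bounded (hs2.mul_left (‖s - 1‖ * ‖s‖)).hasSum (fun n => hb (n + M))).trans ?_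
    rw [tsum_mul_left]
    exact mul_le_mul_of_nonneg_left (tail_rpow M hM) (by positivity)
  have e1 : riemannZeta s - ∑ n ∈ Finset.range M, (((n : ℝ) + 1 : ℝ) : ℂ) ^ (-s) =
      (s - 1)⁻¹ * ((((M : ℝ) + 1 : ℝ) : ℂ) ^ (1 - s) + ∑' n, gz (n + M) s) := by
    rw [riemannZeta_eq_inv_sub_mul h1]
    have h2 : s - 1 ≠ 0 := sub_ne_zero.mpr h1
    field_simp
    linear_combination -hsplit
  rw [e1, norm_mul, norm_inv]
  have h3 : ‖(((M : ℝ) + 1 : ℝ) : ℂ) ^ (1 - s)‖ = ((M : ℝ) + 1) ^ (1 / 2 : ℝ) := by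
    rw [Complex.norm_cpow_eq_rpow_re_of_pos (by positivity)]
    congr 1; simp [hs]; norm_num
  calc _ ≤ ‖s - 1‖⁻¹ * (((M : ℝ) + 1) ^ (1 / 2 : ℝ) + ‖s - 1‖ * ‖s‖ * (2 * (M : ℝ) ^ (-(1 / 2) : ℝ))) := by
        gcongr
        exact (norm_add_le _ _).trans (add_le_add h3.le htail)
    _ = _ := by field_simp
end HB12

open Real MeasureTheory
namespace HB12
open Filter Topology

/-- The Dirichlet polynomial. -/
noncomputable def DD (N : ℕ) (t : ℝ) : ℂ :=
  ∑ n ∈ Finset.Ico 1 (N + 1), ((1 / √(n : ℝ) : ℝ) : ℂ) * e (-(t * Real.log n))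

lemma log_step {n : ℕ} (hn : 1 ≤ n) :
    Real.log ((n + 1 : ℕ) : ℝ) - Real.log (n : ℝ) = Real.log (1 + 1 / (n : ℝ)) := by
  have : (0 : ℝ) < n := by exact_mod_cast hn
  rw [← Real.log_div (by positivity) (by positivity)]
  congr 1; push_cast; field_simp

lemma log_one_add_ge {x : ℝ} (hx : 0 ≤ x) : x / (1 + x) ≤ Real.log (1 + x) := by
  have := Real.one_sub_inv_le_log_of_pos (x := 1 + x) (by linarith)
  convert this using 1; field_simp; ring

lemma log_one_add_le {x : ℝ} (hx : 0 ≤ x) : Real.log (1 + x) ≤ x := by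
  have := Real.log_le_sub_one_of_pos (x := 1 + x) (by linarith)
  linarith

lemma block_bound (t : ℝ) (X : ℕ) (hX : 1 ≤ X) (ht : 0 < t) (htX : t ≤ 2 * X) :
    ‖∑ n ∈ Finset.Ico X (2 * X), ((1 / √(n : ℝ) : ℝ) : ℂ) * e (-(t * Real.log n))‖ ≤ 30 * √X / t := by
  have hX0 : (0 : ℝ) < X := by exact_mod_cast hX
  have hst : ∀ n : ℕ, X ≤ n → -(t * Real.log n) - -(t * Real.log ((n + 1 : ℕ) : ℝ)) = t * Real.log (1 + 1 / (n : ℝ)) := by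
    intro n hn
    rw [← log_step (hX.trans hn)]; ring
  have key := kl (fun n => 1 / √(n : ℝ)) (fun n => -(t * Real.log n)) X (2 * X) (by omega) (1 / √X) (t / (3 * X)) (1 / √X)
    (by positivity) ?_ ?_ ?_ ?_ ?_
  · refine key.trans (le_of_eq ?_)
    have := Real.sq_sqrt hX0.le
    field_simp
    linear_combination (-30) * this
  · intro n h1 h2
    rw [abs_of_nonneg (by positivity)]
    gcongr
  · have hb : ∀ n ∈ Finset.Ico X (2 * X), |1 / √((n + 1 : ℕ) : ℝ) - 1 / √(n : ℝ)| = 1 / √(n : ℝ) - 1 / √((n + 1 : ℕ) : ℝ) := by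
      intro n hn
      rw [Finset.mem_Ico] at hn
      have : (0 : ℝ) < n := by exact_mod_cast (by omega : 0 < n)
      rw [abs_sub_comm, abs_of_nonneg]
      rw [sub_nonneg]; gcongr; simp
    rw [Finset.sum_congr rfl hb]
    have : ∀ M, X ≤ M → ∑ n ∈ Finset.Ico X M, (1 / √(n : ℝ) - 1 / √((n + 1 : ℕ) : ℝ)) = 1 / √(X : ℝ) - 1 / √(M : ℝ) := by
      intro M hM
      induction M, hM using Nat.le_induction with
      | base => simp
      | succ M hM ih => rw [Finset.sum_Ico_succ_top hM, ih]; ring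
    rw [this _ (by omega)]
    have : 0 ≤ 1 / √((2 * X : ℕ) : ℝ) := by positivity
    linarith
  · intro n h1 h2
    rw [hst n h1]
    have hn : (X : ℝ) ≤ n := by exact_mod_cast h1
    have hn2 : (n : ℝ) ≤ 2 * X := by exact_mod_cast h2
    have hX1 : (1 : ℝ) ≤ X := by exact_mod_cast hX
    have h3 := log_one_add_ge (x := 1 / (n : ℝ)) (by positivity)
    have h4 : 1 / (n : ℝ) / (1 + 1 / n) = 1 / (n + 1) := by
      have : (0 : ℝ) < n := by linarith
      field_simp
    rw [h4] at h3
    calc t / (3 * X) = t * (1 / (3 * X)) := by ring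
      _ ≤ t * (1 / (n + 1)) := by gcongr; linarith
      _ ≤ _ := by gcongr
  · intro n h1 h2
    rw [hst n h1]
    have hn : (X : ℝ) ≤ n := by exact_mod_cast h1
    have h3 := log_one_add_le (x := 1 / (n : ℝ)) (by positivity)
    calc t * Real.log (1 + 1 / n) ≤ t * (1 / n) := by gcongr
      _ ≤ (2 * X) * (1 / X) := by gcongr
      _ = 2 := by field_simp
      _ ≤ 3 := by norm_num
  · intro n h1 h2
    rw [hst n h1, show n + 2 = n + 1 + 1 from rfl, hst (n + 1) (by omega)]
    have : (0 : ℝ) < n := by exact_mod_cast (by omega : 0 < n)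
    gcongr
    simp

lemma blocks_bound (t : ℝ) (X : ℕ) (hX : 1 ≤ X) (ht : 0 < t) (htX : t ≤ 2 * X) (K : ℕ) :
    ‖∑ n ∈ Finset.Ico X (2 ^ K * X), ((1 / √(n : ℝ) : ℝ) : ℂ) * e (-(t * Real.log n))‖ ≤
      120 * √((2 ^ K * X : ℕ) : ℝ) / t := by
  induction K with
  | zero => simp; positivity
  | succ K ih =>
    have h2 : 1 ≤ 2 ^ K := Nat.one_le_two_pow
    have h3 : X ≤ 2 ^ K * X := by nlinarith
    rw [show 2 ^ (K + 1) * X = 2 * (2 ^ K * X) by ring,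
      ← Finset.sum_Ico_consecutive _ (n := 2 ^ K * X) h3 (by omega)]
    have hb := block_bound t (2 ^ K * X) (by nlinarith) ht
      (htX.trans (by gcongr))
    refine (norm_add_le _ _).trans ((add_le_add ih hb).trans ?_)
    set y : ℝ := √((2 ^ K * X : ℕ) : ℝ) with hy
    have e1 : √((2 * (2 ^ K * X) : ℕ) : ℝ) = √2 * y := by
      rw [hy, ← Real.sqrt_mul (by norm_num)]; congr 1; push_cast; ring
    rw [e1, ← add_div]
    have : (5 / 4 : ℝ) ≤ √2 := by
      rw [Real.le_sqrt (by norm_num) (by norm_num)]; norm_num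
    gcongr
    have hy0 : 0 ≤ y := Real.sqrt_nonneg _
    nlinarith

lemma cpow_eq_e {n : ℕ} (hn : 1 ≤ n) (t : ℝ) :
    (((n : ℝ)) : ℂ) ^ (-(1 / 2 + Complex.I * (t : ℂ))) = ((1 / √(n : ℝ) : ℝ) : ℂ) * e (-(t * Real.log n)) := by
  have h0 : (0 : ℝ) < n := by exact_mod_cast hn
  have hne : ((n : ℝ) : ℂ) ≠ 0 := by exact_mod_cast h0.ne'
  rw [neg_add, Complex.cpow_add _ _ hne]
  congr 1
  · rw [show (-(1 / 2) : ℂ) = ((-(1 / 2) : ℝ) : ℂ) by push_cast; rfl, ← Complex.ofReal_cpow h0.le,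
      Real.rpow_neg h0.le, ← Real.sqrt_eq_rpow, one_div]
  · rw [e, Complex.cpow_def_of_ne_zero hne, ← Complex.ofReal_log h0.le]
    congr 1; push_cast; ring

lemma zeta_approx (T t : ℝ) (hT : 2 ≤ T) (h1 : T ≤ t) (h2 : t ≤ 2 * T) :
    ‖riemannZeta (1 / 2 + Complex.I * (t : ℂ)) - DD ⌈T⌉₊ t‖ ≤ 500 := by
  set N := ⌈T⌉₊ + 1 with hN
  have hNT : T ≤ N := by
    have := Nat.le_ceil T
    rw [hN]; push_cast; linarith
  have hNT2 : (N : ℝ) ≤ T + 2 := by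
    have := (Nat.ceil_lt_add_one (by linarith : 0 ≤ T)).le
    rw [hN]; push_cast; linarith
  set K := Nat.clog 2 N with hK
  have k1 : N ≤ 2 ^ K := Nat.le_pow_clog (by norm_num) N
  have hN2 : 1 < N := by
    have : (2 : ℝ) ≤ N := by linarith
    have : 2 ≤ N := by exact_mod_cast this
    omega
  have k2 : 2 ^ K ≤ 2 * N := by
    have := Nat.pow_pred_clog_lt_self (b := 2) (by norm_num) hN2
    have hKp : 0 < K := Nat.clog_pos (by norm_num) hN2
    obtain ⟨k, hk⟩ : ∃ k, K = k + 1 := ⟨K - 1, by omega⟩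
    rw [← hK, hk] at this
    simp at this
    rw [hk, pow_succ]; omega
  set M := 2 ^ K * N - 1 with hM
  have hM1 : M + 1 = 2 ^ K * N := by
    have : 1 ≤ 2 ^ K * N := by nlinarith
    omega
  have hMN : N ≤ M := by
    have : N * N ≤ 2 ^ K * N := by gcongr
    nlinarith
  have ht : 0 < t := by linarith
  have hz := zeta_approx1 M (by omega) (s := 1 / 2 + Complex.I * (t : ℂ)) (by simp)
  have e1 : ∑ n ∈ Finset.range M, (((n : ℝ) + 1 : ℝ) : ℂ) ^ (-(1 / 2 + Complex.I * (t : ℂ))) =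
      ∑ n ∈ Finset.Ico 1 (2 ^ K * N), ((1 / √(n : ℝ) : ℝ) : ℂ) * e (-(t * Real.log n)) := by
    rw [← hM1, Finset.sum_Ico_eq_sum_range]
    refine Finset.sum_congr rfl fun n _ => ?_
    rw [← cpow_eq_e (by omega)]
    congr 1; push_cast; ring
  have e2 : ∑ n ∈ Finset.Ico 1 (2 ^ K * N), ((1 / √(n : ℝ) : ℝ) : ℂ) * e (-(t * Real.log n)) =
      DD ⌈T⌉₊ t + ∑ n ∈ Finset.Ico N (2 ^ K * N), ((1 / √(n : ℝ) : ℝ) : ℂ) * e (-(t * Real.log n)) := by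
    rw [DD, Finset.sum_Ico_consecutive _ (by omega) (by omega)]
  have hb := blocks_bound t N hN2.le ht (by linarith) K
  rw [e1, e2] at hz
  have hQ : ((2 ^ K * N : ℕ) : ℝ) ≤ (2 * N) ^ 2 := by
    have : 2 ^ K * N ≤ (2 * N) ^ 2 := by nlinarith
    exact_mod_cast this
  have hQ2 : √((2 ^ K * N : ℕ) : ℝ) ≤ 2 * N := Real.sqrt_le_iff.mpr ⟨by positivity, hQ⟩
  have hQM : ((M : ℝ) + 1) ^ (1 / 2 : ℝ) ≤ 2 * N := by
    rw [← Real.sqrt_eq_rpow]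
    have : (M : ℝ) + 1 = ((2 ^ K * N : ℕ) : ℝ) := by rw [← hM1]; push_cast; ring
    rw [this]; exact hQ2
  have hNt : (N : ℝ) ≤ 2 * t := by linarith
  have hs1 : t ≤ ‖(1 / 2 + Complex.I * (t : ℂ)) - 1‖ := by
    have := Complex.abs_im_le_norm ((1 / 2 + Complex.I * (t : ℂ)) - 1)
    simp at this
    exact (le_abs_self t).trans (by simpa using this)
  have hs : ‖(1 / 2 + Complex.I * (t : ℂ))‖ ≤ 3 * N := by
    refine (norm_add_le _ _).trans ?_
    rw [norm_mul, Complex.norm_I, Complex.norm_real, Real.norm_eq_abs, abs_of_pos ht]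
    have : ‖(1 / 2 : ℂ)‖ = 1 / 2 := by simp
    rw [this]; linarith
  have hMM : (M : ℝ) ^ (-(1 / 2) : ℝ) ≤ 2 / N := by
    have hN0 : (0 : ℝ) < N := by positivity
    have : ((N : ℝ) / 2) ^ 2 ≤ M := by
      have h5 : N * N ≤ M + 1 := by rw [hM1]; gcongr
      have h6 : (N : ℝ) * N ≤ M + 1 := by exact_mod_cast h5
      have : (2 : ℝ) ≤ N := by linarith
      nlinarith
    have h7 : (N : ℝ) / 2 ≤ √M := Real.le_sqrt_of_sq_le this
    rw [Real.rpow_neg (by positivity), ← Real.sqrt_eq_rpow, show (2 : ℝ) / N = (N / 2 : ℝ)⁻¹ by rw [inv_div]]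
    gcongr
  have t1 : ((M : ℝ) + 1) ^ (1 / 2 : ℝ) / ‖(1 / 2 + Complex.I * (t : ℂ)) - 1‖ ≤ 4 := by
    rw [div_le_iff₀ (by linarith)]; linarith
  have t2 : 2 * ‖(1 / 2 + Complex.I * (t : ℂ))‖ * (M : ℝ) ^ (-(1 / 2) : ℝ) ≤ 12 := by
    calc _ ≤ 2 * (3 * N) * (2 / N : ℝ) := by gcongr
      _ = 12 := by
        have hN0 : (0 : ℝ) < N := by positivity
        field_simp; norm_num
  have t3 : 120 * √((2 ^ K * N : ℕ) : ℝ) / t ≤ 480 := by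
    rw [div_le_iff₀ ht]; linarith
  have e3 : riemannZeta (1 / 2 + Complex.I * (t : ℂ)) - DD ⌈T⌉₊ t =
    (riemannZeta (1 / 2 + Complex.I * (t : ℂ)) - (DD ⌈T⌉₊ t + ∑ n ∈ Finset.Ico N (2 ^ K * N), ((1 / √(n : ℝ) : ℝ) : ℂ) * e (-(t * Real.log n)))) + ∑ n ∈ Finset.Ico N (2 ^ K * N), ((1 / √(n : ℝ) : ℝ) : ℂ) * e (-(t * Real.log n)) := by ring
  rw [e3]
  refine (norm_add_le _ _).trans ?_
  linarith
end HB12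

open Real MeasureTheory
namespace HB12
open Filter Topology Set

lemma ibp_e {p q : ℝ} (hpq : p ≤ q) {m m' ψ ψ' : ℝ → ℝ}
    (hm : ∀ u ∈ Icc p q, HasDerivAt m (m' u) u) (hψ : ∀ u ∈ Icc p q, HasDerivAt ψ (ψ' u) u)
    (hm'c : ContinuousOn m' (Icc p q)) (hψ'c : ContinuousOn ψ' (Icc p q))
    (hp : m p = 0) (hq : m q = 0) :
    ‖∫ u in p..q, ((m u * ψ' u : ℝ) : ℂ) * e (ψ u)‖ ≤ ∫ u in p..q, |m' u| := by
  have hu : uIcc p q = Icc p q := uIcc_of_le hpq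
  have hmc : ContinuousOn m (Icc p q) := fun u h => (hm u h).continuousAt.continuousWithinAt
  have hψc : ContinuousOn ψ (Icc p q) := fun u h => (hψ u h).continuousAt.continuousWithinAt
  have hec : ContinuousOn (fun u => e (ψ u)) (Icc p q) := continuous_e.comp_continuousOn hψc
  have i1 : IntervalIntegrable (fun u => ((m' u : ℝ) : ℂ) * e (ψ u)) volume p q := by
    apply ContinuousOn.intervalIntegrable; rw [hu]
    exact (Complex.continuous_ofReal.comp_continuousOn hm'c).mul hec
  have i2 : IntervalIntegrable (fun u => Complex.I * (((m u * ψ' u : ℝ) : ℂ) * e (ψ u))) volume p q := by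
    apply ContinuousOn.intervalIntegrable; rw [hu]
    exact continuousOn_const.mul ((Complex.continuous_ofReal.comp_continuousOn (hmc.mul hψ'c)).mul hec)
  have hd : ∀ u ∈ uIcc p q, HasDerivAt (fun u => (m u : ℂ) * e (ψ u))
      (((m' u : ℝ) : ℂ) * e (ψ u) + Complex.I * (((m u * ψ' u : ℝ) : ℂ) * e (ψ u))) u := by
    intro u hu'
    rw [hu] at hu'
    have := ((hm u hu').ofReal_comp).mul (hasDerivAt_e_comp (hψ u hu'))
    refine this.congr_deriv ?_
    push_cast; ring
  have h := intervalIntegral.integral_eq_sub_of_hasDerivAt hd (i1.add i2)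
  rw [hp, hq, intervalIntegral.integral_add i1 i2, intervalIntegral.integral_const_mul] at h
  have h2 : ∫ u in p..q, ((m u * ψ' u : ℝ) : ℂ) * e (ψ u) =
      Complex.I * ∫ u in p..q, ((m' u : ℝ) : ℂ) * e (ψ u) := by
    have hI := Complex.I_mul_I
    simp only [Complex.ofReal_zero, zero_mul, sub_zero] at h
    linear_combination (-Complex.I) * h + (∫ u in p..q, ((m u * ψ' u : ℝ) : ℂ) * e (ψ u)) * hI
  rw [h2, norm_mul, Complex.norm_I, one_mul]
  refine (intervalIntegral.norm_integral_le_integral_norm hpq).trans (le_of_eq ?_)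
  refine intervalIntegral.integral_congr fun u _ => ?_
  simp [norm_e]

lemma vdcA {p q : ℝ} (hpq : p ≤ q) {B B' χ χ' w ψ : ℝ → ℝ} {B0 B1 η : ℝ}
    (hB : ∀ u ∈ Icc p q, HasDerivAt B (B' u) u) (hχ : ∀ u ∈ Icc p q, HasDerivAt χ (χ' u) u)
    (hψ : ∀ u ∈ Icc p q, HasDerivAt ψ (χ u * w u) u)
    (hB'c : ContinuousOn B' (Icc p q)) (hχ'c : ContinuousOn χ' (Icc p q))
    (hwc : ContinuousOn w (Icc p q)) (hp : B p = 0) (hq : B q = 0)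
    (hB0 : ∀ u ∈ Icc p q, |B u| ≤ B0) (hB1 : ∀ u ∈ Icc p q, |B' u| ≤ B1)
    (hη : 0 < η) (hχη : ∀ u ∈ Icc p q, η ≤ |χ u|) (hχ' : ∀ u ∈ Icc p q, χ' u ≤ 0) :
    ‖∫ u in p..q, ((B u * w u : ℝ) : ℂ) * e (ψ u)‖ ≤ (B1 * (q - p) + 2 * B0) / η := by
  have hu : uIcc p q = Icc p q := uIcc_of_le hpq
  have hBc : ContinuousOn B (Icc p q) := fun u h => (hB u h).continuousAt.continuousWithinAt
  have hχc : ContinuousOn χ (Icc p q) := fun u h => (hχ u h).continuousAt.continuousWithinAt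
  have hne : ∀ u ∈ Icc p q, χ u ≠ 0 := fun u h h0 => by
    have := hχη u h; rw [h0, abs_zero] at this; linarith
  have hB00 : 0 ≤ B0 := (abs_nonneg _).trans (hB0 p ⟨le_rfl, hpq⟩)
  have hB10 : 0 ≤ B1 := (abs_nonneg _).trans (hB1 p ⟨le_rfl, hpq⟩)
  have key := ibp_e hpq (m := fun u => B u / χ u) (m' := fun u => (B' u * χ u - B u * χ' u) / χ u ^ 2)
    (ψ := ψ) (ψ' := fun u => χ u * w u) (fun u h => (hB u h).div (hχ u h) (hne u h)) hψ
    (((hB'c.mul hχc).sub (hBc.mul hχ'c)).div (hχc.pow 2) (fun u h => pow_ne_zero 2 (hne u h)))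
    (hχc.mul hwc) (by simp [hp]) (by simp [hq])
  have e1 : ∫ u in p..q, ((B u * w u : ℝ) : ℂ) * e (ψ u) =
      ∫ u in p..q, ((B u / χ u * (χ u * w u) : ℝ) : ℂ) * e (ψ u) := by
    refine intervalIntegral.integral_congr fun u h => ?_
    rw [hu] at h
    have := hne u h
    congr 2; field_simp
  rw [e1]
  refine key.trans ?_
  have hd : ∀ u ∈ uIcc p q, HasDerivAt (fun u => (χ u)⁻¹) (-χ' u / χ u ^ 2) u := fun u h => by
    rw [hu] at h; exact (hχ u h).inv (hne u h)
  have i1 : ContinuousOn (fun u => -χ' u / χ u ^ 2) (uIcc p q) := by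
    rw [hu]; exact hχ'c.neg.div (hχc.pow 2) (fun u h => pow_ne_zero 2 (hne u h))
  have h1 := intervalIntegral.integral_eq_sub_of_hasDerivAt hd i1.intervalIntegrable
  calc ∫ u in p..q, |(B' u * χ u - B u * χ' u) / χ u ^ 2| ≤
        ∫ u in p..q, (B1 / η + B0 * (-χ' u / χ u ^ 2)) := by
        refine intervalIntegral.integral_mono_on hpq ?_ ?_ ?_
        · apply ContinuousOn.intervalIntegrable; rw [hu]
          exact (((hB'c.mul hχc).sub (hBc.mul hχ'c)).div (hχc.pow 2) (fun u h => pow_ne_zero 2 (hne u h))).abs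
        · exact (continuousOn_const.add (continuousOn_const.mul i1)).intervalIntegrable
        · intro u h
          have hn := hne u h
          have e2 : (B' u * χ u - B u * χ' u) / χ u ^ 2 = B' u / χ u + B u * (-χ' u / χ u ^ 2) := by
            field_simp; ring
          rw [e2]
          refine (abs_add_le _ _).trans (add_le_add ?_ ?_)
          · rw [abs_div]; exact div_le_div₀ hB10 (hB1 u h) hη (hχη u h)
          · have h3 : 0 ≤ -χ' u / χ u ^ 2 := div_nonneg (by linarith [hχ' u h]) (by positivity)
            rw [abs_mul, abs_of_nonneg h3]
            exact mul_le_mul_of_nonneg_right (hB0 u h) h3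
    _ = (q - p) * (B1 / η) + B0 * ((χ q)⁻¹ - (χ p)⁻¹) := by
        rw [intervalIntegral.integral_add (by simp) (i1.intervalIntegrable.const_mul B0),
          intervalIntegral.integral_const_mul, h1, intervalIntegral.integral_const, smul_eq_mul]
    _ ≤ (q - p) * (B1 / η) + B0 * (1 / η + 1 / η) := by
        have hb : ∀ u ∈ Icc p q, |(χ u)⁻¹| ≤ 1 / η := fun u h => by
          rw [abs_inv, one_div]; exact inv_anti₀ hη (hχη u h)
        have h4 := abs_le.mp (hb q ⟨hpq, le_rfl⟩)
        have h5 := abs_le.mp (hb p ⟨le_rfl, hpq⟩)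
        gcongr
        linarith
    _ = _ := by field_simp; ring

lemma vdcB {p q : ℝ} (hpq : p ≤ q) {B B' χ χ' w ψ : ℝ → ℝ} {B0 B1 η g0 l : ℝ}
    (hB : ∀ u ∈ Icc p q, HasDerivAt B (B' u) u) (hχ : ∀ u ∈ Icc p q, HasDerivAt χ (χ' u) u)
    (hψ : ∀ u ∈ Icc p q, HasDerivAt ψ (χ u * w u) u)
    (hB'c : ContinuousOn B' (Icc p q)) (hχ'c : ContinuousOn χ' (Icc p q))
    (hwc : ContinuousOn w (Icc p q)) (hp : B p = 0) (hq : B q = 0)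
    (hB0 : ∀ u ∈ Icc p q, |B u| ≤ B0) (hB1 : ∀ u ∈ Icc p q, |B' u| ≤ B1)
    (hg : ∀ u ∈ Icc p q, |B u * w u| ≤ g0)
    (hη : 0 < η) (hl : 0 < l) (hχ' : ∀ u ∈ Icc p q, χ' u ≤ -l) :
    ‖∫ u in p..q, ((B u * w u : ℝ) : ℂ) * e (ψ u)‖ ≤ (B1 * (q - p) + 4 * B0) / η + 4 * g0 * η / l := by
  have hu : uIcc p q = Icc p q := uIcc_of_le hpq
  have hBc : ContinuousOn B (Icc p q) := fun u h => (hB u h).continuousAt.continuousWithinAt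
  have hχc : ContinuousOn χ (Icc p q) := fun u h => (hχ u h).continuousAt.continuousWithinAt
  have hψc : ContinuousOn ψ (Icc p q) := fun u h => (hψ u h).continuousAt.continuousWithinAt
  have hec : ContinuousOn (fun u => e (ψ u)) (Icc p q) := continuous_e.comp_continuousOn hψc
  have hpos : ∀ u, 0 < χ u ^ 2 + η ^ 2 := fun u => by positivity
  have hB00 : 0 ≤ B0 := (abs_nonneg _).trans (hB0 p ⟨le_rfl, hpq⟩)
  have hB10 : 0 ≤ B1 := (abs_nonneg _).trans (hB1 p ⟨le_rfl, hpq⟩)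
  have hg00 : 0 ≤ g0 := (abs_nonneg _).trans (hg p ⟨le_rfl, hpq⟩)
  have hqc : ContinuousOn (fun u => χ u ^ 2 + η ^ 2) (Icc p q) := (hχc.pow 2).add continuousOn_const
  -- arctan integral
  have hd : ∀ u ∈ uIcc p q, HasDerivAt (fun u => -Real.arctan (χ u / η) / η) (-χ' u / (χ u ^ 2 + η ^ 2)) u := by
    intro u h
    rw [hu] at h
    have := (((hχ u h).div_const η).arctan.neg).div_const η
    refine this.congr_deriv ?_
    have := hpos u
    field_simp
    ring
  have i1 : ContinuousOn (fun u => -χ' u / (χ u ^ 2 + η ^ 2)) (Icc p q) :=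
    hχ'c.neg.div hqc (fun u _ => (hpos u).ne')
  have i1' : IntervalIntegrable (fun u => -χ' u / (χ u ^ 2 + η ^ 2)) volume p q := by
    apply ContinuousOn.intervalIntegrable; rw [hu]; exact i1
  have harc : ∫ u in p..q, -χ' u / (χ u ^ 2 + η ^ 2) ≤ 4 / η := by
    rw [intervalIntegral.integral_eq_sub_of_hasDerivAt hd i1', ← sub_div]
    have := Real.arctan_lt_pi_div_two (χ p / η)
    have := Real.neg_pi_div_two_lt_arctan (χ q / η)
    have := Real.pi_le_four
    gcongr
    linarith
  set m : ℝ → ℝ := fun u => B u * (χ u / (χ u ^ 2 + η ^ 2)) with hm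
  set m' : ℝ → ℝ := fun u => B' u * (χ u / (χ u ^ 2 + η ^ 2)) +
    B u * ((χ' u * (χ u ^ 2 + η ^ 2) - χ u * (2 * χ u * χ' u)) / (χ u ^ 2 + η ^ 2) ^ 2) with hm'
  have hm'c : ContinuousOn m' (Icc p q) :=
    (hB'c.mul (hχc.div hqc (fun u _ => (hpos u).ne'))).add (hBc.mul
      (((hχ'c.mul hqc).sub (hχc.mul ((continuousOn_const.mul hχc).mul hχ'c))).div (hqc.pow 2)
        (fun u _ => pow_ne_zero 2 (hpos u).ne')))
  have key := ibp_e hpq (m := m) (m' := m') (ψ := ψ) (ψ' := fun u => χ u * w u) ?_ hψ hm'c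
    (hχc.mul hwc) (by simp [hm, hp]) (by simp [hm, hq])
  swap
  · intro u h
    have h1 : HasDerivAt (fun u => χ u ^ 2 + η ^ 2) (2 * χ u * χ' u) u := by
      have := ((hχ u h).pow 2).add_const (η ^ 2)
      refine this.congr_deriv ?_
      simp
    exact (hB u h).mul ((hχ u h).div h1 (hpos u).ne')
  have hm'b : ∫ u in p..q, |m' u| ≤ (B1 * (q - p) + 4 * B0) / η := by
    calc ∫ u in p..q, |m' u| ≤ ∫ u in p..q, (B1 / η + B0 * (-χ' u / (χ u ^ 2 + η ^ 2))) := by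
          refine intervalIntegral.integral_mono_on hpq ?_ ?_ ?_
          · apply ContinuousOn.intervalIntegrable; rw [hu]; exact hm'c.abs
          · exact (by simp : IntervalIntegrable (fun _ => B1 / η) volume p q).add (i1'.const_mul B0)
          · intro u h
            refine (abs_add_le _ _).trans (add_le_add ?_ ?_)
            · rw [abs_mul]
              have : |χ u / (χ u ^ 2 + η ^ 2)| ≤ 1 / η := by
                rw [abs_div, abs_of_pos (hpos u), div_le_div_iff₀ (hpos u) hη, ← sq_abs (χ u)]
                nlinarith [sq_nonneg (|χ u| - η), abs_nonneg (χ u)]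
              calc _ ≤ B1 * (1 / η) := mul_le_mul (hB1 u h) this (abs_nonneg _) hB10
                _ = _ := by ring
            · rw [abs_mul]
              have h3 : |(χ' u * (χ u ^ 2 + η ^ 2) - χ u * (2 * χ u * χ' u)) / (χ u ^ 2 + η ^ 2) ^ 2| ≤
                  -χ' u / (χ u ^ 2 + η ^ 2) := by
                have hx : 0 ≤ -χ' u := by linarith [hχ' u h]
                have e3 : (χ' u * (χ u ^ 2 + η ^ 2) - χ u * (2 * χ u * χ' u)) = (-χ' u) * (χ u ^ 2 - η ^ 2) := by ring
                rw [e3, abs_div, abs_mul, abs_of_nonneg hx, abs_of_pos (pow_pos (hpos u) 2),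
                  div_le_div_iff₀ (pow_pos (hpos u) 2) (hpos u)]
                have : |χ u ^ 2 - η ^ 2| ≤ χ u ^ 2 + η ^ 2 := by
                  rw [abs_le]; constructor <;> nlinarith [sq_nonneg (χ u), sq_nonneg η]
                have := mul_le_mul_of_nonneg_left this hx
                nlinarith [hpos u]
              exact mul_le_mul (hB0 u h) h3 (abs_nonneg _) hB00
      _ = (q - p) * (B1 / η) + B0 * ∫ u in p..q, -χ' u / (χ u ^ 2 + η ^ 2) := by
          rw [intervalIntegral.integral_add (by simp) (i1'.const_mul B0),
            intervalIntegral.integral_const_mul, intervalIntegral.integral_const, smul_eq_mul]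
      _ ≤ (q - p) * (B1 / η) + B0 * (4 / η) := by gcongr
      _ = _ := by field_simp
  have hwc' : ContinuousOn (fun u => B u * w u) (Icc p q) := hBc.mul hwc
  set r : ℝ → ℝ := fun u => B u * w u * (η ^ 2 / (χ u ^ 2 + η ^ 2)) with hr
  have hrc : ContinuousOn r (Icc p q) := hwc'.mul (continuousOn_const.div hqc (fun u _ => (hpos u).ne'))
  have e1 : ∫ u in p..q, ((B u * w u : ℝ) : ℂ) * e (ψ u) =
      (∫ u in p..q, ((m u * (χ u * w u) : ℝ) : ℂ) * e (ψ u)) + ∫ u in p..q, ((r u : ℝ) : ℂ) * e (ψ u) := by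
    have hmc : ContinuousOn m (Icc p q) := hBc.mul (hχc.div hqc (fun u _ => (hpos u).ne'))
    rw [← intervalIntegral.integral_add]
    · refine intervalIntegral.integral_congr fun u h => ?_
      have := (hpos u).ne'
      simp only [hm, hr]
      rw [← add_mul, ← Complex.ofReal_add]
      congr 2; field_simp
    · apply ContinuousOn.intervalIntegrable; rw [hu]
      exact (Complex.continuous_ofReal.comp_continuousOn (hmc.mul (hχc.mul hwc))).mul hec
    · apply ContinuousOn.intervalIntegrable; rw [hu]
      exact (Complex.continuous_ofReal.comp_continuousOn hrc).mul hec
  have hrb : ‖∫ u in p..q, ((r u : ℝ) : ℂ) * e (ψ u)‖ ≤ 4 * g0 * η / l := by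
    refine (intervalIntegral.norm_integral_le_integral_norm hpq).trans ?_
    calc _ ≤ ∫ u in p..q, (g0 * η ^ 2 / l) * (-χ' u / (χ u ^ 2 + η ^ 2)) := by
          refine intervalIntegral.integral_mono_on hpq ?_ (i1'.const_mul _) ?_
          · apply ContinuousOn.intervalIntegrable; rw [hu]
            exact ((Complex.continuous_ofReal.comp_continuousOn hrc).mul hec).norm
          · intro u h
            rw [norm_mul, norm_e, mul_one, Complex.norm_real, Real.norm_eq_abs, hr, abs_mul,
              abs_of_nonneg (by positivity : 0 ≤ η ^ 2 / (χ u ^ 2 + η ^ 2))]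
            have h1 : 1 ≤ -χ' u / l := by rw [le_div_iff₀ hl]; linarith [hχ' u h]
            calc |B u * w u| * (η ^ 2 / (χ u ^ 2 + η ^ 2)) ≤ g0 * (η ^ 2 / (χ u ^ 2 + η ^ 2)) * 1 := by
                  rw [mul_one]; gcongr; exact hg u h
              _ ≤ g0 * (η ^ 2 / (χ u ^ 2 + η ^ 2)) * (-χ' u / l) := by gcongr
              _ = _ := by ring
      _ = (g0 * η ^ 2 / l) * ∫ u in p..q, (-χ' u / (χ u ^ 2 + η ^ 2)) := intervalIntegral.integral_const_mul _ _
      _ ≤ (g0 * η ^ 2 / l) * (4 / η) := by gcongr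
      _ = _ := by field_simp
  rw [e1]
  exact (norm_add_le _ _).trans (add_le_add (key.trans hm'b) hrb)
end HB12

open Real MeasureTheory
namespace HB12
open Filter Topology Set

noncomputable def th (t u : ℝ) : ℝ := t * Real.log (1 + 1 / u)

lemma hasDerivAt_th (t : ℝ) {u : ℝ} (hu : 0 < u) : HasDerivAt (th t) (-t / (u * (u + 1))) u := by
  have h1 : HasDerivAt (fun u : ℝ => 1 + 1 / u) (-(u ^ 2)⁻¹) u := by
    simpa [one_div] using (hasDerivAt_inv hu.ne').const_add 1
  have := (h1.log (by positivity)).const_mul t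
  refine this.congr_deriv ?_
  field_simp

structure Amp (U M : ℝ) (a a' : ℝ → ℝ) : Prop where
  hd : ∀ u, HasDerivAt a (a' u) u
  hc : Continuous a'
  supp : ∀ u, u ≤ U ∨ 4 * U ≤ u → a u = 0
  b0 : ∀ u, |a u| ≤ M / U
  b1 : ∀ u, |a' u| ≤ M / U ^ 2

noncomputable def corr (a : ℝ → ℝ) (r s j : ℝ) : ℂ :=
  ∫ u : ℝ, ((a (u + j) * a u : ℝ) : ℂ) * e (th r (u + j) - th s u)

lemma corr_interval {U M : ℝ} {a a' : ℝ → ℝ} (ha : Amp U M a a') (r s : ℝ) {j : ℝ} :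
    corr a r s j = ∫ u in U..(4 * U - j), ((a (u + j) * a u : ℝ) : ℂ) * e (th r (u + j) - th s u) := by
  rw [corr, intervalIntegral.integral_eq_integral_of_support_subset]
  intro u hu
  by_contra h
  apply hu
  rw [mem_Ioc, not_and_or, not_lt, not_le] at h
  rcases h with h | h
  · simp [ha.supp u (Or.inl h)]
  · simp [ha.supp (u + j) (Or.inr (by linarith))]

lemma corr_zero {U M : ℝ} {a a' : ℝ → ℝ} (ha : Amp U M a a') (r s : ℝ) {j : ℝ} (hj : 3 * U ≤ j) :
    corr a r s j = 0 := by
  rw [corr]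
  convert integral_zero ℝ ℂ with u
  by_cases h : u ≤ U
  · simp [ha.supp u (Or.inl h)]
  · simp [ha.supp (u + j) (Or.inr (by linarith))]

section
variable {U M : ℝ} {a a' : ℝ → ℝ}

lemma Amp.M_nonneg (ha : Amp U M a a') (hU : 1 ≤ U) : 0 ≤ M := by
  have := (abs_nonneg _).trans (ha.b0 0)
  by_contra h
  rw [not_le] at h
  have := div_neg_of_neg_of_pos h (by linarith : 0 < U)
  linarith

noncomputable def Bf (a : ℝ → ℝ) (j u : ℝ) : ℝ := (a (u + j) * a u) * (u * (u + 1))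
noncomputable def Bf' (a a' : ℝ → ℝ) (j u : ℝ) : ℝ :=
  (a' (u + j) * a u + a (u + j) * a' u) * (u * (u + 1)) + (a (u + j) * a u) * (2 * u + 1)
noncomputable def chf (r s j u : ℝ) : ℝ := s - r * ((u * (u + 1)) / ((u + j) * (u + j + 1)))
noncomputable def chf' (r j u : ℝ) : ℝ :=
  -(r * (j * ((u + 1) * (u + j + 1) + u * (u + j)) / ((u + j) * (u + j + 1)) ^ 2))
noncomputable def wf (u : ℝ) : ℝ := 1 / (u * (u + 1))

lemma Bf_deriv (ha : Amp U M a a') (j u : ℝ) : HasDerivAt (Bf a j) (Bf' a a' j u) u := by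
  have h1 : HasDerivAt (fun u => a (u + j)) (a' (u + j)) u := (ha.hd (u + j)).comp_add_const u j
  have h2 : HasDerivAt (fun u : ℝ => u * (u + 1)) (2 * u + 1) u := by
    have := (hasDerivAt_id u).mul ((hasDerivAt_id u).add_const (1 : ℝ))
    refine this.congr_deriv ?_
    simp; ring
  exact (h1.mul (ha.hd u)).mul h2

lemma Amp.cont (ha : Amp U M a a') : Continuous a :=
  continuous_iff_continuousAt.mpr fun u => (ha.hd u).continuousAt

lemma Bf_cont (ha : Amp U M a a') (j : ℝ) : Continuous (Bf' a a' j) := by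
  have h1 := ha.cont
  have h2 := ha.hc
  unfold Bf'
  fun_prop

lemma chf_deriv (r s : ℝ) {j u : ℝ} (hu : 0 < u) (hj : 0 ≤ j) : HasDerivAt (chf r s j) (chf' r j u) u := by
  have h2 : HasDerivAt (fun u : ℝ => u * (u + 1)) (2 * u + 1) u := by
    have := (hasDerivAt_id u).mul ((hasDerivAt_id u).add_const (1 : ℝ))
    refine this.congr_deriv ?_
    simp; ring
  have h3 : HasDerivAt (fun u : ℝ => (u + j) * (u + j + 1)) (2 * (u + j) + 1) u := by
    have := ((hasDerivAt_id u).add_const j).mul (((hasDerivAt_id u).add_const j).add_const (1 : ℝ))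
    refine this.congr_deriv ?_
    simp; ring
  have hne : (u + j) * (u + j + 1) ≠ 0 := by positivity
  have := ((h2.div h3 hne).const_mul r).const_sub s
  refine this.congr_deriv ?_
  unfold chf'
  congr 3; ring

lemma phase_deriv (r s : ℝ) {j u : ℝ} (hu : 0 < u) (hj : 0 ≤ j) :
    HasDerivAt (fun u => th r (u + j) - th s u) (chf r s j u * wf u) u := by
  have h1 : HasDerivAt (fun u => th r (u + j)) (-r / ((u + j) * (u + j + 1))) u :=
    (hasDerivAt_th r (by positivity : 0 < u + j)).comp_add_const u j
  refine (h1.sub (hasDerivAt_th s hu)).congr_deriv ?_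
  unfold chf wf
  field_simp
  ring

lemma chf'_cont (r : ℝ) {j p q : ℝ} (hp : 0 < p) (hj : 0 ≤ j) : ContinuousOn (chf' r j) (Icc p q) := by
  intro u hu
  have : (0 : ℝ) < u := lt_of_lt_of_le hp hu.1
  have hne : ((u + j) * (u + j + 1)) ^ 2 ≠ 0 := by positivity
  unfold chf'
  apply ContinuousAt.continuousWithinAt
  fun_prop (disch := assumption)

lemma wf_cont {p q : ℝ} (hp : 0 < p) : ContinuousOn wf (Icc p q) := by
  intro u hu
  have : (0 : ℝ) < u := lt_of_lt_of_le hp hu.1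
  have hne : (u * (u + 1)) ≠ 0 := by positivity
  unfold wf
  apply ContinuousAt.continuousWithinAt
  fun_prop (disch := assumption)

lemma Bf_mul (a : ℝ → ℝ) (j : ℝ) {u : ℝ} (hu : 0 < u) : Bf a j u * wf u = a (u + j) * a u := by
  unfold Bf wf; field_simp

lemma aa_le (ha : Amp U M a a') (hU : 1 ≤ U) (u v : ℝ) : |a u * a v| ≤ M ^ 2 / U ^ 2 := by
  rw [abs_mul]
  calc _ ≤ M / U * (M / U) := mul_le_mul (ha.b0 u) (ha.b0 v) (abs_nonneg _) (by have := ha.M_nonneg hU; positivity)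
    _ = _ := by ring

lemma Bf_le (ha : Amp U M a a') (hU : 1 ≤ U) (j : ℝ) {u : ℝ} (h1 : U ≤ u) (h2 : u ≤ 4 * U) :
    |Bf a j u| ≤ 20 * M ^ 2 := by
  unfold Bf
  have h3 : |u * (u + 1)| ≤ 20 * U ^ 2 := by
    rw [abs_of_nonneg (by nlinarith)]; nlinarith
  rw [abs_mul]
  calc _ ≤ M ^ 2 / U ^ 2 * (20 * U ^ 2) := mul_le_mul (aa_le ha hU _ _) h3 (abs_nonneg _) (by positivity)
    _ = _ := by field_simp

lemma Bf'_le (ha : Amp U M a a') (hU : 1 ≤ U) (j : ℝ) {u : ℝ} (h1 : U ≤ u) (h2 : u ≤ 4 * U) :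
    |Bf' a a' j u| ≤ 49 * M ^ 2 / U := by
  unfold Bf'
  have hM := ha.M_nonneg hU
  have h3 : |u * (u + 1)| ≤ 20 * U ^ 2 := by
    rw [abs_of_nonneg (by nlinarith)]; nlinarith
  have h4 : |2 * u + 1| ≤ 9 * U := by
    rw [abs_of_nonneg (by nlinarith)]; nlinarith
  have h5 : |a' (u + j) * a u + a (u + j) * a' u| ≤ M / U ^ 2 * (M / U) + M / U * (M / U ^ 2) := by
    refine (abs_add_le _ _).trans (add_le_add ?_ ?_) <;> rw [abs_mul]
    · exact mul_le_mul (ha.b1 _) (ha.b0 _) (abs_nonneg _) (by positivity)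
    · exact mul_le_mul (ha.b0 _) (ha.b1 _) (abs_nonneg _) (by positivity)
  refine (abs_add_le _ _).trans ?_
  rw [abs_mul, abs_mul (a (u + j) * a u)]
  calc _ ≤ (M / U ^ 2 * (M / U) + M / U * (M / U ^ 2)) * (20 * U ^ 2) + M ^ 2 / U ^ 2 * (9 * U) :=
        add_le_add (mul_le_mul h5 h3 (abs_nonneg _) (by positivity))
          (mul_le_mul (aa_le ha hU _ _) h4 (abs_nonneg _) (by positivity))
    _ = _ := by field_simp; ring

lemma corr_eq_Bf (ha : Amp U M a a') (hU : 1 ≤ U) (r s : ℝ) {j : ℝ} (hj3 : j ≤ 3 * U) :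
    corr a r s j = ∫ u in U..(4 * U - j), ((Bf a j u * wf u : ℝ) : ℂ) * e (th r (u + j) - th s u) := by
  rw [corr_interval ha]
  refine intervalIntegral.integral_congr fun u hu => ?_
  rw [uIcc_of_le (by linarith)] at hu
  have h : 0 < u := by linarith [hu.1]
  simp only [Bf_mul a j h]

lemma corrA (ha : Amp U M a a') (hU : 1 ≤ U) {r s j η : ℝ} (hr : 0 ≤ r) (hj : 0 ≤ j) (hj3 : j ≤ 3 * U) (hη : 0 < η)
    (hχ : ∀ u ∈ Icc U (4 * U - j), η ≤ |chf r s j u|) :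
    ‖corr a r s j‖ ≤ 200 * M ^ 2 / η := by
  rw [corr_eq_Bf ha hU r s hj3]
  have hU0 : 0 < U := by linarith
  refine (vdcA (by linarith) (B0 := 20 * M ^ 2) (B1 := 49 * M ^ 2 / U) (η := η) (fun u _ => Bf_deriv ha j u)
    (fun u hu => chf_deriv r s (by linarith [hu.1]) hj)
    (fun u hu => phase_deriv r s (by linarith [hu.1]) hj) (Bf_cont ha j).continuousOn
    (chf'_cont r hU0 hj) (wf_cont hU0) ?_ ?_ (fun u hu => Bf_le ha hU j hu.1 (by linarith [hu.2]))
    (fun u hu => Bf'_le ha hU j hu.1 (by linarith [hu.2])) hη hχ ?_).trans ?_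
  · simp [Bf, ha.supp U (Or.inl le_rfl)]
  · simp [Bf, ha.supp (4 * U) (Or.inr le_rfl)]
  · intro u hu
    have : 0 < u := by linarith [hu.1]
    unfold chf'
    rw [neg_nonpos]
    positivity
  · gcongr
    have h1 : 49 * M ^ 2 / U * (4 * U - j - U) ≤ 49 * M ^ 2 / U * (3 * U) := by gcongr; linarith
    have h2 : 49 * M ^ 2 / U * (3 * U) = 147 * M ^ 2 := by field_simp; ring
    nlinarith [sq_nonneg M]

lemma corrB (ha : Amp U M a a') (hU : 1 ≤ U) {T r s j : ℝ} (hT : 0 < T) (hr : T / 2 ≤ r) (hj : 0 < j) (hj3 : j ≤ 3 * U) :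
    ‖corr a r s j‖ ≤ 900 * M ^ 2 / √(T * j) := by
  rw [corr_eq_Bf ha hU r s hj3]
  have hU0 : 0 < U := by linarith
  have hη : 0 < √(T * j) := Real.sqrt_pos.mpr (by positivity)
  refine (vdcB (by linarith) (B0 := 20 * M ^ 2) (B1 := 49 * M ^ 2 / U) (η := √(T * j)) (g0 := M ^ 2 / U ^ 2)
    (l := T * j / (160 * U ^ 2)) (fun u _ => Bf_deriv ha j u)
    (fun u hu => chf_deriv r s (by linarith [hu.1]) hj.le)
    (fun u hu => phase_deriv r s (by linarith [hu.1]) hj.le) (Bf_cont ha j).continuousOn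
    (chf'_cont r hU0 hj.le) (wf_cont hU0) ?_ ?_ (fun u hu => Bf_le ha hU j hu.1 (by linarith [hu.2]))
    (fun u hu => Bf'_le ha hU j hu.1 (by linarith [hu.2])) ?_ hη (by positivity) ?_).trans ?_
  · simp [Bf, ha.supp U (Or.inl le_rfl)]
  · simp [Bf, ha.supp (4 * U) (Or.inr le_rfl)]
  · intro u hu
    rw [Bf_mul a j (by linarith [hu.1])]
    exact aa_le ha hU _ _
  · intro u hu
    have hu0 : 0 < u := by linarith [hu.1]
    unfold chf'
    rw [neg_le_neg_iff]
    have k1 : 1 / (80 * U ^ 2) ≤ ((u + 1) * (u + j + 1) + u * (u + j)) / ((u + j) * (u + j + 1)) ^ 2 := by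
      have hx : u + j ≤ 4 * U := by linarith [hu.2]
      calc 1 / (80 * U ^ 2) = U / ((4 * U) ^ 2 * (5 * U)) := by field_simp; norm_num
        _ ≤ (u + 1) / ((u + j) ^ 2 * (u + j + 1)) := by
            gcongr
            · linarith [hu.1]
            · linarith
        _ = ((u + 1) * (u + j + 1)) / ((u + j) * (u + j + 1)) ^ 2 := by field_simp
        _ ≤ _ := by
            gcongr
            have : 0 ≤ u * (u + j) := by positivity
            linarith
    calc T * j / (160 * U ^ 2) = (T / 2) * (j * (1 / (80 * U ^ 2))) := by field_simp; norm_num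
      _ ≤ r * (j * (((u + 1) * (u + j + 1) + u * (u + j)) / ((u + j) * (u + j + 1)) ^ 2)) := by
          have hr0 : 0 ≤ r := by linarith
          gcongr
      _ = _ := by ring
  · have h1 : 49 * M ^ 2 / U * (4 * U - j - U) ≤ 49 * M ^ 2 / U * (3 * U) := by gcongr; linarith
    have h2 : 49 * M ^ 2 / U * (3 * U) = 147 * M ^ 2 := by field_simp; ring
    have h3 : 4 * (M ^ 2 / U ^ 2) * √(T * j) / (T * j / (160 * U ^ 2)) = 640 * M ^ 2 / √(T * j) := by
      have := Real.sq_sqrt (by positivity : 0 ≤ T * j)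
      rw [div_div_eq_mul_div, div_eq_div_iff (by positivity) (by positivity)]
      field_simp
      linear_combination (640 * M ^ 2) * this
    rw [h3, ← add_div]
    gcongr
    nlinarith [sq_nonneg M]

lemma corrC (ha : Amp U M a a') (hU : 1 ≤ U) {T r s j : ℝ} (hT : 0 < T) (hr : T / 2 ≤ r) (hj : 0 < j) (hj3 : j ≤ 3 * U)
    (hrs : |r - s| ≤ T * j / (20 * U)) :
    ‖corr a r s j‖ ≤ 4000 * M ^ 2 * U / (T * j) := by
  have hU0 : 0 < U := by linarith
  refine (corrA ha hU (by linarith) hj.le hj3 (η := T * j / (20 * U)) (by positivity) ?_).trans (le_of_eq ?_)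
  · intro u hu
    have hu0 : 0 < u := by linarith [hu.1]
    refine le_trans ?_ (le_abs_self _)
    have e1 : chf r s j u = (s - r) + r * (j * (2 * u + j + 1) / ((u + j) * (u + j + 1))) := by
      unfold chf; field_simp; ring
    have k1 : j / (5 * U) ≤ j * (2 * u + j + 1) / ((u + j) * (u + j + 1)) := by
      calc j / (5 * U) ≤ j / (u + j + 1) := by gcongr; linarith [hu.2]
        _ = j * (u + j) / ((u + j) * (u + j + 1)) := by field_simp
        _ ≤ _ := by gcongr ?_ / _; exact mul_le_mul_of_nonneg_left (by linarith) hj.le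
    have hr0 : 0 ≤ r := by linarith
    have k2 : T / 2 * (j / (5 * U)) ≤ r * (j * (2 * u + j + 1) / ((u + j) * (u + j + 1))) := by gcongr
    have k3 : T / 2 * (j / (5 * U)) = 2 * (T * j / (20 * U)) := by field_simp; norm_num
    have k4 := (abs_le.mp hrs).2
    rw [e1]; linarith
  · field_simp; ring

lemma corr0 (ha : Amp U M a a') (hU : 1 ≤ U) {r s : ℝ} (hr : 0 ≤ r) (hrs : r ≠ s) :
    ‖corr a r s 0‖ ≤ 200 * M ^ 2 / |r - s| := by
  refine corrA ha hU hr le_rfl (by linarith) (abs_pos.mpr (sub_ne_zero.mpr hrs)) ?_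
  intro u hu
  have hu0 : 0 < u := by linarith [hu.1]
  have : chf r s 0 u = s - r := by unfold chf; field_simp; ring
  rw [this, abs_sub_comm]

/-- trivial bound -/
lemma corr_triv (ha : Amp U M a a') (hU : 1 ≤ U) (r s : ℝ) :
    ‖corr a r s 0‖ ≤ 3 * M ^ 2 / U := by
  rw [corr_interval ha]
  have := intervalIntegral.norm_integral_le_of_norm_le_const (a := U) (b := 4 * U - 0) (C := M ^ 2 / U ^ 2)
    (f := fun u => ((a (u + 0) * a u : ℝ) : ℂ) * e (th r (u + 0) - th s u)) ?_
  · refine this.trans (le_of_eq ?_)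
    rw [abs_of_nonneg (by linarith)]; field_simp; ring
  · intro u _
    rw [norm_mul, norm_e, mul_one, Complex.norm_real]
    exact aa_le ha hU _ _
end
end HB12

open Real MeasureTheory
namespace HB12
open Filter Topology Set

noncomputable def Fh (F : ℝ → ℂ) (k : ℝ) : ℂ := ∫ x : ℝ, F x * e (-(2 * π * k * x))

lemma e_int_mul (n : ℤ) : e (2 * π * n) = 1 := by
  rw [e]; rw [← Complex.exp_int_mul_two_pi_mul_I n]; congr 1; push_cast; ring


lemma integral_split {F : ℝ → ℂ} (hc : Continuous F) {K : ℕ}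
    (hF : ∀ u, u ≤ 0 ∨ (K:ℝ) ≤ u → F u = 0) {g : ℝ → ℂ} (hg : Continuous g) :
    ∫ x : ℝ, F x * g x = ∑ m ∈ Finset.range K, ∫ x in (0:ℝ)..1, F (x + m) * g (x + m) := by
  have h1 : ∫ x : ℝ, F x * g x = ∫ x in ((0:ℕ):ℝ)..(K:ℝ), F x * g x := by
    rw [intervalIntegral.integral_eq_integral_of_support_subset]
    intro u hu
    by_contra h
    apply hu
    rw [mem_Ioc, not_and_or, not_lt, not_le] at h
    rcases h with h | h
    · simp [hF u (Or.inl (by simpa using h))]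
    · simp [hF u (Or.inr h.le)]
  rw [h1, ← intervalIntegral.sum_integral_adjacent_intervals (a := fun k : ℕ => (k:ℝ))]
  · apply Finset.sum_congr rfl
    intro m _
    rw [intervalIntegral.integral_comp_add_right (fun x => F x * g x)]
    congr 1
    · simp
    · push_cast; ring
  · intro k _
    exact (hc.mul hg).intervalIntegrable _ _

lemma sum_symm (f : ℤ → ℝ) (hf : ∀ j, f (-j) = f j) (K : ℕ) :
    ∑ j ∈ Finset.Icc (-K:ℤ) K, f j = f 0 + 2 * ∑ j ∈ Finset.Ico 1 (K+1), f (j:ℕ) := by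
  induction K with
  | zero => simp
  | succ K ih =>
    have : Finset.Icc (-((K+1:ℕ):ℤ)) ((K+1:ℕ):ℤ) =
        insert (-((K+1:ℕ):ℤ)) (insert ((K+1:ℕ):ℤ) (Finset.Icc (-K:ℤ) K)) := by
      ext x; simp only [Finset.mem_Icc, Finset.mem_insert]; push_cast; omega
    rw [this, Finset.sum_insert, Finset.sum_insert, ih, hf, Finset.sum_Ico_succ_top (by omega : 1 ≤ K + 1)]
    · ring
    · simp
    · simp only [Finset.mem_Icc, Finset.mem_insert]; push_cast; omega

noncomputable def Ac (F : ℝ → ℂ) (j : ℤ) : ℂ := ∫ x : ℝ, F (x + j) * (starRingEnd ℂ) (F x)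

lemma Ac_neg (F : ℝ → ℂ) (j : ℤ) : ‖Ac F (-j)‖ = ‖Ac F j‖ := by
  have : Ac F (-j) = (starRingEnd ℂ) (Ac F j) := by
    rw [Ac, Ac, ← integral_conj, ← integral_add_right_eq_self _ (j:ℝ)]
    congr 1; ext x
    simp [mul_comm]
  rw [this, Complex.norm_conj]

lemma parseval {F : ℝ → ℂ} (hc : Continuous F) {K : ℕ}
    (hF : ∀ u, u ≤ 0 ∨ (K:ℝ) ≤ u → F u = 0) :
    Summable (fun k : ℤ => ‖Fh F k‖ ^ 2) ∧
    ∑' k : ℤ, ‖Fh F k‖ ^ 2 ≤ ‖Ac F 0‖ + 2 * ∑ j ∈ Finset.Ico 1 (K + 1), ‖Ac F ((j:ℕ):ℤ)‖ := by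
  set P : ℝ → ℂ := fun x => ∑ n ∈ Finset.range K, F (x + n) with hP
  have hPc : Continuous P := by fun_prop
  have hmem : MemLp P 2 (volume.restrict (Ioc (0:ℝ) 1)) := by
    have h1 : MemLp P 2 (volume.restrict (Icc (0:ℝ) 1)) := by
      obtain ⟨C, hC⟩ := isCompact_Icc.exists_bound_of_continuousOn (s := Icc (0:ℝ) 1) hPc.continuousOn
      refine MemLp.of_bound hPc.aestronglyMeasurable C ?_
      exact (ae_restrict_iff' measurableSet_Icc).2 (Eventually.of_forall fun x hx => hC x hx)
    exact h1.mono_measure (Measure.restrict_mono Ioc_subset_Icc_self le_rfl)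
  have hs := hasSum_sq_fourierCoeffOn (zero_lt_one' ℝ) hmem
  have hcoef : ∀ k : ℤ, fourierCoeffOn (zero_lt_one' ℝ) P k = Fh F k := by
    intro k
    rw [fourierCoeffOn_eq_integral, Fh, integral_split hc hF (by
      have := continuous_e; fun_prop)]
    rw [← intervalIntegral.integral_finsetSum]
    · simp only [sub_zero, div_one, one_smul]
      congr 1; ext x
      rw [hP, smul_eq_mul, mul_comm, Finset.sum_mul]
      apply Finset.sum_congr rfl
      intro m _
      congr 1
      rw [fourier_coe_apply]
      have : -(2 * π * k * (x + m)) = -(2*π*k*x) + 2 * π * ((-k * m : ℤ):ℝ) := by push_cast; ring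
      rw [this, e_add, e_int_mul, mul_one, e]
      congr 1; push_cast; ring
    · intro m _
      apply Continuous.intervalIntegrable
      have := continuous_e; fun_prop
  simp_rw [hcoef] at hs
  simp only [sub_zero, inv_one, one_smul] at hs
  refine ⟨hs.summable, ?_⟩
  rw [hs.tsum_eq]
  have hsym := sum_symm (fun j => ‖Ac F j‖) (Ac_neg F) K
  rw [← hsym]
  have hA : ((∫ x in (0:ℝ)..1, ‖P x‖ ^ 2 : ℝ) : ℂ) = ∑ j ∈ Finset.Icc (-K:ℤ) K, Ac F j := by
    have h1 : ∑ j ∈ Finset.Icc (-K:ℤ) K, Ac F j =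
        ∫ x : ℝ, (starRingEnd ℂ) (F x) * ∑ j ∈ Finset.Icc (-K:ℤ) K, F (x + j) := by
      simp_rw [Finset.mul_sum]
      rw [integral_finsetSum]
      · simp only [Ac, mul_comm]
      · intro j _
        apply Continuous.integrable_of_hasCompactSupport
        · have := Complex.continuous_conj; fun_prop
        · apply HasCompactSupport.intro (K := Icc (0:ℝ) K) isCompact_Icc
          intro x hx
          rw [mem_Icc, not_and_or, not_le, not_le] at hx
          rw [hF x (hx.imp le_of_lt le_of_lt)]; simp
    rw [h1, integral_split (F := fun x => (starRingEnd ℂ) (F x)) (K := K)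
      (by have := Complex.continuous_conj; fun_prop)
      (by intro u hu; simp [hF u hu]) (by fun_prop)]
    rw [← intervalIntegral.integral_finsetSum, ← intervalIntegral.integral_ofReal]
    · apply intervalIntegral.integral_congr
      intro x hx
      rw [uIcc_of_le zero_le_one] at hx
      simp only []
      have h2 : ∀ m ∈ Finset.range K, ∑ j ∈ Finset.Icc (-K:ℤ) K, F (x + m + j) = P x := by
        intro m hm
        rw [Finset.mem_range] at hm
        rw [hP]; symm
        apply Finset.sum_of_injOn (fun n : ℕ => (n:ℤ) - m)
        · intro a _ b _ hab; simpa using hab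
        · intro n hn
          simp only [Finset.coe_range, mem_Iio, Finset.coe_Icc, mem_Icc] at hn ⊢; omega
        · intro j _ hj
          apply hF
          by_cases h : j + m < 0
          · left
            have : (j:ℝ) + m + 1 ≤ 0 := by exact_mod_cast h
            linarith [hx.2]
          · right
            have : (K:ℤ) ≤ j + m := by
              by_contra h'
              apply hj
              refine ⟨(j+m).toNat, ?_, ?_⟩
              · simp only [Finset.coe_range, mem_Iio]; omega
              · simp only []; omega
            have : (K:ℝ) ≤ j + m := by exact_mod_cast this
            linarith [hx.1]
        · intro n _
          congr 1; push_cast; ring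
      rw [Finset.sum_congr rfl (fun m hm => by rw [h2 m hm]), ← Finset.sum_mul, ← map_sum]
      rw [Complex.conj_mul']
      push_cast; rfl
    · intro m _
      apply Continuous.intervalIntegrable
      have := Complex.continuous_conj; fun_prop
  have hnn : 0 ≤ ∫ x in (0:ℝ)..1, ‖P x‖ ^ 2 :=
    intervalIntegral.integral_nonneg zero_le_one (fun _ _ => by positivity)
  calc (∫ x in (0:ℝ)..1, ‖P x‖ ^ 2) = ‖((∫ x in (0:ℝ)..1, ‖P x‖ ^ 2 : ℝ) : ℂ)‖ := by
        rw [Complex.norm_real, Real.norm_of_nonneg hnn]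
    _ ≤ _ := by rw [hA]; exact norm_sum_le _ _

end HB12

open Real MeasureTheory
namespace HB12
open Filter Topology Set

lemma harm (n : ℕ) : ∑ j ∈ Finset.Ico 1 (n + 1), (1 : ℝ) / j ≤ 1 + Real.log n := by
  have h := harmonic_le_one_add_log n
  rw [harmonic_eq_sum_Icc] at h
  push_cast at h
  simpa [one_div, Finset.Ico_add_one_right_eq_Icc] using h

lemma sum_inv_sqrt (n : ℕ) : ∑ j ∈ Finset.Ico 1 (n + 1), (1 : ℝ) / √j ≤ 2 * √n := by
  induction n with
  | zero => simp
  | succ n ih =>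
    rw [Finset.sum_Ico_succ_top (by omega)]
    have h0 : (0:ℝ) ≤ n := by positivity
    have h1 : 0 < √((n+1:ℕ):ℝ) := by positivity
    have h2 : √(n:ℝ) ≤ √((n+1:ℕ):ℝ) := Real.sqrt_le_sqrt (by push_cast; linarith)
    have h3 := Real.sq_sqrt (show (0:ℝ) ≤ ((n+1:ℕ):ℝ) by positivity)
    have h4 := Real.sq_sqrt h0
    have h5 : 1 / √((n+1:ℕ):ℝ) ≤ 2 * (√((n+1:ℕ):ℝ) - √(n:ℝ)) := by
      rw [div_le_iff₀ h1]
      push_cast at *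
      nlinarith [sq_nonneg (√((n:ℝ)+1) - √(n:ℝ)), Real.sqrt_nonneg (n:ℝ)]
    linarith

lemma spaced_side {R : Finset ℝ} {G T0 : ℝ} (hG : 0 < G)
    (hsp : ∀ r ∈ R, ∀ s ∈ R, r ≠ s → G ≤ |r - s|) (f : ℝ → ℝ)
    (hf : ∀ r ∈ R, G ≤ f r ∧ f r ≤ T0) (hfi : ∀ r ∈ R, ∀ s ∈ R, |r - s| = |f r - f s|) :
    ∑ s ∈ R, 1 / f s ≤ (1 / G) * (1 + Real.log ⌊T0 / G⌋₊) := by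
  have hinj : Set.InjOn (fun s => ⌊f s / G⌋₊) (R : Set ℝ) := by
    intro r hr s hs h
    by_contra hne
    have h1 := hsp r hr s hs hne
    rw [hfi r hr s hs] at h1
    have hfr : 0 ≤ f r / G := div_nonneg (by linarith [(hf r hr).1]) hG.le
    have hfs : 0 ≤ f s / G := div_nonneg (by linarith [(hf s hs).1]) hG.le
    have a1 := Nat.floor_le hfr
    have a2 := Nat.lt_floor_add_one (f r / G)
    have b1 := Nat.floor_le hfs
    have b2 := Nat.lt_floor_add_one (f s / G)
    simp only at h
    rw [h] at a1 a2
    have : |f r / G - f s / G| < 1 := by rw [abs_lt]; constructor <;> linarith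
    rw [← sub_div, abs_div, abs_of_pos hG, div_lt_one hG] at this
    linarith
  calc ∑ s ∈ R, 1 / f s ≤ ∑ s ∈ R, (1 / G) * (1 / ((⌊f s / G⌋₊ : ℕ) : ℝ)) := by
        apply Finset.sum_le_sum
        intro s hs
        obtain ⟨h1, h2⟩ := hf s hs
        have h3 : 1 ≤ f s / G := by rwa [le_div_iff₀ hG, one_mul]
        have h4 : 1 ≤ ⌊f s / G⌋₊ := Nat.le_floor (by simpa using h3)
        have h5 : (1:ℝ) ≤ ⌊f s / G⌋₊ := by exact_mod_cast h4
        have h6 := Nat.floor_le (show 0 ≤ f s / G by linarith)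
        rw [div_mul_div_comm, one_mul]
        apply one_div_le_one_div_of_le (by positivity)
        rw [le_div_iff₀ hG] at h6; linarith
    _ = (1 / G) * ∑ k ∈ R.image (fun s => ⌊f s / G⌋₊), 1 / (k:ℝ) := by
        rw [← Finset.mul_sum, Finset.sum_image hinj]
    _ ≤ (1 / G) * ∑ k ∈ Finset.Ico 1 (⌊T0 / G⌋₊ + 1), 1 / (k:ℝ) := by
        gcongr
        intro k hk
        rw [Finset.mem_image] at hk
        obtain ⟨s, hs, rfl⟩ := hk
        obtain ⟨h1, h2⟩ := hf s hs
        rw [Finset.mem_Ico]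
        constructor
        · apply Nat.le_floor
          rw [Nat.cast_one, le_div_iff₀ hG, one_mul]; exact h1
        · apply Nat.lt_succ_of_le
          apply Nat.floor_le_floor
          gcongr
    _ ≤ _ := by
        gcongr
        exact harm _

lemma spaced_sum {R : Finset ℝ} {G T0 : ℝ} (hG : 0 < G)
    (hsp : ∀ r ∈ R, ∀ s ∈ R, r ≠ s → G ≤ |r - s|) (hT0 : ∀ r ∈ R, ∀ s ∈ R, |r - s| ≤ T0)
    {r : ℝ} (hr : r ∈ R) :
    ∑ s ∈ R.erase r, 1 / |r - s| ≤ (2 / G) * (1 + Real.log ⌊T0 / G⌋₊) := by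
  rw [← Finset.sum_filter_add_sum_filter_not (R.erase r) (fun s => r < s)]
  have h1 : ∑ s ∈ (R.erase r).filter (fun s => r < s), 1 / |r - s| ≤ (1 / G) * (1 + Real.log ⌊T0 / G⌋₊) := by
    apply spaced_side hG
    · intro x hx y hy; simp at hx hy; exact hsp x hx.1.2 y hy.1.2
    · intro x hx; simp at hx; exact ⟨hsp r hr x hx.1.2 (Ne.symm hx.1.1), hT0 r hr x hx.1.2⟩
    · intro x hx y hy; simp at hx hy
      rw [abs_of_neg (show r - x < 0 by linarith), abs_of_neg (show r - y < 0 by linarith)]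
      congr 1; ring
  have h2 : ∑ s ∈ (R.erase r).filter (fun s => ¬ r < s), 1 / |r - s| ≤ (1 / G) * (1 + Real.log ⌊T0 / G⌋₊) := by
    apply spaced_side hG
    · intro x hx y hy; simp at hx hy; exact hsp x hx.1.2 y hy.1.2
    · intro x hx; simp at hx; exact ⟨hsp r hr x hx.1.2 (Ne.symm hx.1.1), hT0 r hr x hx.1.2⟩
    · intro x hx y hy; simp at hx hy
      rw [abs_of_nonneg (show 0 ≤ r - x by linarith), abs_of_nonneg (show 0 ≤ r - y by linarith)]
      rw [← abs_neg]; congr 1; ring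
  calc _ ≤ _ := add_le_add h1 h2
    _ = _ := by ring

variable {U M : ℝ} {a a' : ℝ → ℝ}

lemma cont_ae (ha : Amp U M a a') (hU : 1 ≤ U) (t : ℝ) : Continuous (fun u => (a u : ℂ) * e (th t u)) := by
  rw [continuous_iff_continuousAt]
  intro u
  by_cases h : u < U
  · have : (fun u => (a u : ℂ) * e (th t u)) =ᶠ[𝓝 u] fun _ => 0 := by
      filter_upwards [Iio_mem_nhds h] with v hv
      simp [ha.supp v (Or.inl (le_of_lt hv))]
    exact continuousAt_const.congr this.symm
  · have h0 : 0 < u := by linarith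
    have h1 := (hasDerivAt_th t h0).continuousAt
    have h2 := ha.cont
    have h3 := continuous_e
    exact (Complex.continuous_ofReal.comp h2).continuousAt.mul (h3.continuousAt.comp h1)

noncomputable def FF (R : Finset ℝ) (c : ℝ → ℂ) (a : ℝ → ℝ) (u : ℝ) : ℂ :=
  ∑ r ∈ R, c r * ((a u : ℂ) * e (th r u))

lemma Ac_FF (ha : Amp U M a a') (hU : 1 ≤ U) (R : Finset ℝ) (c : ℝ → ℂ) (j : ℤ) :
    Ac (FF R c a) j = ∑ r ∈ R, ∑ s ∈ R, c r * (starRingEnd ℂ) (c s) * corr a r s j := by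
  have : ∀ x : ℝ, FF R c a (x + j) * (starRingEnd ℂ) (FF R c a x) =
      ∑ r ∈ R, ∑ s ∈ R, c r * (starRingEnd ℂ) (c s) *
        (((a (x + j) * a x : ℝ) : ℂ) * e (th r (x + j) - th s x)) := by
    intro x
    rw [FF, FF, map_sum, Finset.sum_mul_sum]
    apply Finset.sum_congr rfl; intro r _
    apply Finset.sum_congr rfl; intro s _
    rw [sub_eq_add_neg, e_add, map_mul, map_mul, conj_e, Complex.conj_ofReal]
    push_cast; ring
  have hint : ∀ r s : ℝ, Integrable (fun x => c r * (starRingEnd ℂ) (c s) *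
        (((a (x + j) * a x : ℝ) : ℂ) * e (th r (x + j) - th s x))) := by
    intro r s
    apply Integrable.const_mul
    apply Continuous.integrable_of_hasCompactSupport
    · have h1 := (cont_ae ha hU r).comp (continuous_add_const (j:ℝ))
      have h2 := Complex.continuous_conj.comp (cont_ae ha hU s)
      convert h1.mul h2 using 2 with x
      simp only [Pi.mul_apply, Function.comp_apply]
      rw [sub_eq_add_neg, e_add, map_mul, conj_e, Complex.conj_ofReal]
      push_cast; ring
    · apply HasCompactSupport.intro (K := Icc (0:ℝ) (4 * U)) isCompact_Icc
      intro x hx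
      rw [mem_Icc, not_and_or, not_le, not_le] at hx
      rw [ha.supp x (hx.imp (fun h => by linarith) le_of_lt)]; simp
  rw [Ac]
  simp_rw [this]
  rw [integral_finsetSum _ (fun r _ => integrable_finsetSum _ (fun s _ => hint r s))]
  apply Finset.sum_congr rfl; intro r _
  rw [integral_finsetSum _ (fun s _ => hint r s)]
  apply Finset.sum_congr rfl; intro s _
  rw [integral_const_mul, corr]

lemma corr_sum (ha : Amp U M a a') (hU : 1 ≤ U) {T T0 r s ℓ : ℝ} (hT : 0 < T) (hr : T / 2 ≤ r)
    (hrs : |r - s| ≤ T0) {K : ℕ} (hK : 1 + Real.log K ≤ ℓ) :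
    ∑ j ∈ Finset.Ico 1 (K + 1), ‖corr a r s (j:ℕ)‖ ≤
      4000 * M ^ 2 * (U / T) * ℓ + 9000 * M ^ 2 * √(U * T0) / T := by
  have hM := ha.M_nonneg hU
  have hT0 : 0 ≤ T0 := (abs_nonneg _).trans hrs
  have hb : ∀ j ∈ Finset.Ico 1 (K + 1), ‖corr a r s (j:ℕ)‖ ≤
      4000 * M ^ 2 * (U / T) * (1 / (j:ℝ)) +
      (if j ∈ Finset.Ico 1 (⌊20 * U * T0 / T⌋₊ + 1) then 900 * M ^ 2 / √T * (1 / √j) else 0) := by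
    intro j hj
    rw [Finset.mem_Ico] at hj
    have hj1 : (1:ℝ) ≤ j := by exact_mod_cast hj.1
    have hj0 : (0:ℝ) < j := by linarith
    have hite : 0 ≤ (if j ∈ Finset.Ico 1 (⌊20 * U * T0 / T⌋₊ + 1) then 900 * M ^ 2 / √T * (1 / √j) else 0) := by
      split_ifs <;> positivity
    have hfirst : 0 ≤ 4000 * M ^ 2 * (U / T) * (1 / (j:ℝ)) := by positivity
    by_cases h3 : 3 * U ≤ j
    · rw [corr_zero ha r s h3, norm_zero]; linarith
    push Not at h3
    by_cases hc : |r - s| ≤ T * j / (20 * U)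
    · have := corrC ha hU hT hr hj0 h3.le hc
      have e1 : 4000 * M ^ 2 * (U / T) * (1 / (j:ℝ)) = 4000 * M ^ 2 * U / (T * j) := by field_simp
      linarith
    · push Not at hc
      have := corrB ha hU (s := s) hT hr hj0 h3.le
      rw [if_pos]
      · have e1 : 900 * M ^ 2 / √T * (1 / √j) = 900 * M ^ 2 / √(T * j) := by
          rw [Real.sqrt_mul hT.le]; field_simp
        linarith
      · rw [Finset.mem_Ico]
        refine ⟨hj.1, Nat.lt_succ_of_le (Nat.le_floor ?_)⟩
        rw [div_lt_iff₀ (by positivity)] at hc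
        rw [le_div_iff₀ hT]
        nlinarith
  calc _ ≤ _ := Finset.sum_le_sum hb
    _ = 4000 * M ^ 2 * (U / T) * ∑ j ∈ Finset.Ico 1 (K + 1), (1 / (j:ℝ)) +
        ∑ j ∈ Finset.Ico 1 (K + 1) with j ∈ Finset.Ico 1 (⌊20 * U * T0 / T⌋₊ + 1), 900 * M ^ 2 / √T * (1 / √j) := by
      rw [Finset.sum_add_distrib, ← Finset.mul_sum, Finset.sum_filter]
    _ ≤ 4000 * M ^ 2 * (U / T) * ℓ +
        ∑ j ∈ Finset.Ico 1 (⌊20 * U * T0 / T⌋₊ + 1), 900 * M ^ 2 / √T * (1 / √(j:ℝ)) := by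
      apply add_le_add
      · gcongr
        exact (harm K).trans hK
      · apply Finset.sum_le_sum_of_subset_of_nonneg
        · intro j hj; exact (Finset.mem_filter.1 hj).2
        · intros; positivity
    _ ≤ 4000 * M ^ 2 * (U / T) * ℓ + 900 * M ^ 2 / √T * (2 * √(20 * U * T0 / T)) := by
      rw [← Finset.mul_sum]
      gcongr
      refine (sum_inv_sqrt _).trans ?_
      gcongr
      exact Nat.floor_le (by positivity)
    _ ≤ _ := by
      have e1 : √(20 * U * T0 / T) ≤ 5 * √(U * T0) / √T := by
        rw [Real.sqrt_div (by positivity)]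
        gcongr
        apply Real.sqrt_le_iff.2
        refine ⟨by positivity, ?_⟩
        rw [mul_pow, Real.sq_sqrt (by positivity)]
        nlinarith [mul_nonneg (by linarith : 0 ≤ U) hT0]
      have e2 : 900 * M ^ 2 / √T * (2 * √(20 * U * T0 / T)) ≤ 900 * M ^ 2 / √T * (2 * (5 * √(U * T0) / √T)) := by
        gcongr
      have e3 : 900 * M ^ 2 / √T * (2 * (5 * √(U * T0) / √T)) = 9000 * M ^ 2 * √(U * T0) / T := by
        have := Real.sq_sqrt hT.le
        rw [← this]
        field_simp
        rw [Real.sqrt_sq (by positivity)]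
        ring
      linarith

lemma energy (ha : Amp U M a a') (hU : 1 ≤ U) {T T0 G ℓ : ℝ} (hT : 0 < T) (hG : 0 < G) (hGU : G / 4 ≤ U)
    {R : Finset ℝ} (hR : ∀ r ∈ R, T / 2 ≤ r)
    (hsp : ∀ r ∈ R, ∀ s ∈ R, r ≠ s → G ≤ |r - s|) (hT0 : ∀ r ∈ R, ∀ s ∈ R, |r - s| ≤ T0)
    {c : ℝ → ℂ} (hcb : ∀ r ∈ R, ‖c r‖ ≤ 3)
    (hℓ1 : 1 + Real.log ⌈4 * U⌉₊ ≤ ℓ) (hℓ2 : 1 + Real.log ⌊T0 / G⌋₊ ≤ ℓ) :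
    Summable (fun k : ℤ => ‖Fh (FF R c a) k‖ ^ 2) ∧
    ∑' k : ℤ, ‖Fh (FF R c a) k‖ ^ 2 ≤
      9 * M ^ 2 * (412 * R.card * ℓ / G + R.card ^ 2 * (8000 * U * ℓ / T + 18000 * √(U * T0) / T)) := by
  have hM := ha.M_nonneg hU
  have hcont : Continuous (FF R c a) := by
    unfold FF
    exact continuous_finsetSum _ fun r _ => continuous_const.mul (cont_ae ha hU r)
  have hsupp : ∀ u, u ≤ 0 ∨ ((⌈4 * U⌉₊ : ℕ):ℝ) ≤ u → FF R c a u = 0 := by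
    intro u hu
    unfold FF
    rw [ha.supp u (hu.imp (fun h => by linarith) (fun h => (Nat.le_ceil _).trans h))]
    simp
  obtain ⟨h1, h2⟩ := parseval hcont hsupp
  refine ⟨h1, h2.trans ?_⟩
  have hℓ : 1 ≤ ℓ := by
    have : (0:ℝ) ≤ Real.log ⌈4 * U⌉₊ := Real.log_natCast_nonneg _
    linarith
  have hAc : ∀ j : ℤ, ‖Ac (FF R c a) j‖ ≤ ∑ r ∈ R, ∑ s ∈ R, 9 * ‖corr a r s j‖ := by
    intro j
    rw [Ac_FF ha hU]
    refine (norm_sum_le _ _).trans (Finset.sum_le_sum fun r hr => ?_)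
    refine (norm_sum_le _ _).trans (Finset.sum_le_sum fun s hs => ?_)
    rw [norm_mul, norm_mul, Complex.norm_conj]
    gcongr
    nlinarith [hcb r hr, hcb s hs, norm_nonneg (c r), norm_nonneg (c s)]
  have hA0 : ‖Ac (FF R c a) 0‖ ≤ R.card * (9 * M ^ 2 * (412 * ℓ / G)) := by
    refine (hAc 0).trans ?_
    rw [← nsmul_eq_mul]
    apply Finset.sum_le_card_nsmul
    intro r hr
    rw [← Finset.add_sum_erase _ _ hr]
    have e1 : 9 * ‖corr a r r ((0:ℤ):ℝ)‖ ≤ 9 * (12 * M ^ 2 * ℓ / G) := by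
      have := corr_triv ha hU (r := r) (s := r)
      rw [Int.cast_zero]
      have e2 : 3 * M ^ 2 / U ≤ 12 * M ^ 2 * ℓ / G := by
        rw [div_le_div_iff₀ (by linarith) hG]
        have : 0 ≤ 3 * M ^ 2 := by positivity
        have h5 : G ≤ 4 * U * ℓ := by nlinarith
        nlinarith
      linarith
    have e2 : ∑ s ∈ R.erase r, 9 * ‖corr a r s ((0:ℤ):ℝ)‖ ≤ 9 * (400 * M ^ 2 * ℓ / G) := by
      calc _ ≤ ∑ s ∈ R.erase r, (9 * (200 * M ^ 2)) * (1 / |r - s|) := by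
            apply Finset.sum_le_sum
            intro s hs
            rw [Finset.mem_erase] at hs
            have := corr0 ha hU (by linarith [hR r hr] : 0 ≤ r) hs.1.symm
            rw [Int.cast_zero]
            calc _ ≤ _ := mul_le_mul_of_nonneg_left this (by norm_num : (0:ℝ) ≤ 9)
              _ = _ := by ring
        _ ≤ (9 * (200 * M ^ 2)) * ((2 / G) * (1 + Real.log ⌊T0 / G⌋₊)) := by
            rw [← Finset.mul_sum]
            gcongr
            exact spaced_sum hG hsp hT0 hr
        _ ≤ (9 * (200 * M ^ 2)) * ((2 / G) * ℓ) := by gcongr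
        _ = _ := by ring
    calc _ ≤ _ := add_le_add e1 e2
      _ = _ := by ring
  have hAj : ∑ j ∈ Finset.Ico 1 (⌈4 * U⌉₊ + 1), ‖Ac (FF R c a) ((j:ℕ):ℤ)‖ ≤
      R.card * (R.card * (9 * (4000 * M ^ 2 * (U / T) * ℓ + 9000 * M ^ 2 * √(U * T0) / T))) := by
    calc _ ≤ ∑ j ∈ Finset.Ico 1 (⌈4 * U⌉₊ + 1), ∑ r ∈ R, ∑ s ∈ R, 9 * ‖corr a r s (j:ℕ)‖ := by
          apply Finset.sum_le_sum; intro j _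
          simpa using hAc j
      _ = ∑ r ∈ R, ∑ s ∈ R, 9 * ∑ j ∈ Finset.Ico 1 (⌈4 * U⌉₊ + 1), ‖corr a r s (j:ℕ)‖ := by
          rw [Finset.sum_comm]
          apply Finset.sum_congr rfl; intro r _
          rw [Finset.sum_comm]
          apply Finset.sum_congr rfl; intro s _
          rw [Finset.mul_sum]
      _ ≤ _ := by
          rw [← nsmul_eq_mul]
          apply Finset.sum_le_card_nsmul
          intro r hr
          rw [← nsmul_eq_mul]
          apply Finset.sum_le_card_nsmul
          intro s hs
          have := corr_sum ha hU hT (hR r hr) (hT0 r hr s hs) hℓ1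
          linarith
  calc _ ≤ _ := add_le_add hA0 (mul_le_mul_of_nonneg_left hAj (by norm_num : (0:ℝ) ≤ 2))
    _ = _ := by ring

end HB12

open Real MeasureTheory
namespace HB12
open Filter Topology Set

lemma bsum {x : ℝ} (hx : 0 < x) (n : ℕ) :
    ∑ m ∈ Finset.Ico 1 (n + 1), 1 / (1 + (x * m) ^ 2) ≤ 2 / x := by
  have : ∑ m ∈ Finset.Ico 1 (n + 1), 1 / (1 + (x * m) ^ 2) ≤ 2 / x * (1 - 1 / (1 + x * n)) := by
    induction n with
    | zero => simp
    | succ n ih =>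
      rw [Finset.sum_Ico_succ_top (by omega)]
      have hn : (0:ℝ) ≤ n := by positivity
      have hy : 0 ≤ x * n := by positivity
      have : 1 / (1 + (x * ((n+1:ℕ):ℝ)) ^ 2) ≤ 2 / x * (1 / (1 + x * n) - 1 / (1 + x * ((n+1:ℕ):ℝ))) := by
        push_cast
        have e1 : 2 / x * (1 / (1 + x * n) - 1 / (1 + x * ((n:ℝ)+1))) =
          2 / ((1 + x * n) * (1 + x * (n+1))) := by field_simp; ring
        rw [e1, div_le_div_iff₀ (by positivity) (by positivity)]
        nlinarith [sq_nonneg (x * n + x - 1)]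
      linarith
  refine this.trans ?_
  have : 0 ≤ 1 / (1 + x * n) := by positivity
  have h2 : 0 < 2 / x := by positivity
  nlinarith

lemma sum_dvd_le (f : ℕ → ℝ) (hf : ∀ n, 0 ≤ f n) {g : ℕ} (hg : 0 < g) (K : ℕ) :
    ∑ h ∈ Finset.Ico 1 (K + 1), (if g ∣ h then f h else 0) ≤ ∑ m ∈ Finset.Ico 1 (K + 1), f (g * m) := by
  rw [← Finset.sum_filter]
  have : (Finset.Ico 1 (K+1)).filter (fun h => g ∣ h) ⊆ (Finset.Ico 1 (K+1)).image (fun m => g * m) := by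
    intro h hh
    simp only [Finset.mem_filter, Finset.mem_Ico, Finset.mem_image] at hh ⊢
    obtain ⟨⟨h1, h2⟩, m, rfl⟩ := hh
    refine ⟨m, ⟨?_, ?_⟩, rfl⟩
    · exact Nat.pos_of_ne_zero (by rintro rfl; omega)
    · nlinarith
  refine (Finset.sum_le_sum_of_subset_of_nonneg this (fun _ _ _ => hf _)).trans ?_
  rw [Finset.sum_image]
  intro a _ b _ hab
  exact Nat.eq_of_mul_eq_mul_left hg hab

lemma gcd_sum (K : ℕ) :
    ∑ h ∈ Finset.Ico 1 (K + 1), ∑ h' ∈ Finset.Ico 1 (K + 1), 1 / (Nat.lcm h h' : ℝ) ≤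
      (1 + Real.log K) ^ 3 := by
  have hL : 0 ≤ 1 + Real.log K := by have := Real.log_natCast_nonneg K; linarith
  calc _ ≤ ∑ h ∈ Finset.Ico 1 (K + 1), ∑ h' ∈ Finset.Ico 1 (K + 1), ∑ g ∈ Finset.Ico 1 (K + 1),
        (g:ℝ) * (if g ∣ h then 1 / (h:ℝ) else 0) * (if g ∣ h' then 1 / (h':ℝ) else 0) := by
        apply Finset.sum_le_sum; intro h hh
        apply Finset.sum_le_sum; intro h' hh'
        rw [Finset.mem_Ico] at hh hh'
        have e1 : 1 / (Nat.lcm h h' : ℝ) = (Nat.gcd h h' : ℝ) * (1 / (h:ℝ)) * (1 / (h':ℝ)) := by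
          have := Nat.gcd_mul_lcm h h'
          have h1 : (Nat.gcd h h' : ℝ) * (Nat.lcm h h' : ℝ) = h * h' := by exact_mod_cast this
          have h2 : 0 < Nat.lcm h h' := Nat.lcm_pos (by omega) (by omega)
          have h2' : (0:ℝ) < Nat.lcm h h' := by exact_mod_cast h2
          have h3 : (0:ℝ) < h := by exact_mod_cast hh.1
          have h4 : (0:ℝ) < h' := by exact_mod_cast hh'.1
          rw [mul_assoc, one_div_mul_one_div, mul_one_div, div_eq_div_iff h2'.ne' (by positivity)]
          linarith
        have hmem : Nat.gcd h h' ∈ Finset.Ico 1 (K+1) := by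
          rw [Finset.mem_Ico]
          refine ⟨Nat.gcd_pos_of_pos_left _ (by omega), ?_⟩
          have := Nat.gcd_le_left h' (show 0 < h by omega)
          omega
        refine le_trans (le_of_eq ?_) (Finset.single_le_sum (f := fun g : ℕ => (g:ℝ) * (if g ∣ h then 1 / (h:ℝ) else 0) * (if g ∣ h' then 1 / (h':ℝ) else 0)) (fun g _ => ?_) hmem)
        · rw [if_pos (Nat.gcd_dvd_left _ _), if_pos (Nat.gcd_dvd_right _ _), e1]
        · split_ifs <;> positivity
    _ = ∑ g ∈ Finset.Ico 1 (K + 1), (g:ℝ) * (∑ h ∈ Finset.Ico 1 (K + 1), if g ∣ h then 1 / (h:ℝ) else 0) ^ 2 := by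
        rw [Finset.sum_congr rfl (fun h _ => Finset.sum_comm), Finset.sum_comm]
        apply Finset.sum_congr rfl; intro g _
        rw [sq, Finset.sum_mul_sum, Finset.mul_sum]
        apply Finset.sum_congr rfl; intro h _
        rw [Finset.mul_sum]
        apply Finset.sum_congr rfl; intro h' _
        ring
    _ ≤ ∑ g ∈ Finset.Ico 1 (K + 1), (1 + Real.log K) ^ 2 * (1 / (g:ℝ)) := by
        apply Finset.sum_le_sum; intro g hg
        rw [Finset.mem_Ico] at hg
        have hg0 : (0:ℝ) < g := by exact_mod_cast hg.1
        have h1 : ∑ h ∈ Finset.Ico 1 (K + 1), (if g ∣ h then 1 / (h:ℝ) else 0) ≤ (1 / (g:ℝ)) * (1 + Real.log K) := by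
          refine (sum_dvd_le (fun n => 1 / (n:ℝ)) (fun n => by positivity) hg.1 K).trans ?_
          calc _ = (1 / (g:ℝ)) * ∑ m ∈ Finset.Ico 1 (K + 1), 1 / (m:ℝ) := by
                rw [Finset.mul_sum]; apply Finset.sum_congr rfl; intro m _
                push_cast; rw [one_div_mul_one_div]
            _ ≤ _ := by gcongr; exact harm K
        have h0 : 0 ≤ ∑ h ∈ Finset.Ico 1 (K + 1), (if g ∣ h then 1 / (h:ℝ) else 0) :=
          Finset.sum_nonneg (fun h _ => by split_ifs <;> positivity)
        calc _ ≤ (g:ℝ) * ((1 / (g:ℝ)) * (1 + Real.log K)) ^ 2 := by gcongr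
          _ = _ := by field_simp
    _ ≤ (1 + Real.log K) ^ 2 * (1 + Real.log K) := by
        rw [← Finset.mul_sum]
        gcongr
        exact harm K
    _ = _ := by ring

/-- number of divisors at most K -/
noncomputable def dK (K : ℕ) (k : ℤ) : ℝ := ∑ h ∈ Finset.Ico 1 (K + 1), if (h:ℤ) ∣ k then (1:ℝ) else 0

lemma dK_nonneg (K : ℕ) (k : ℤ) : 0 ≤ dK K k := Finset.sum_nonneg (fun h _ => by split_ifs <;> norm_num)

lemma dK_sq_sum {κ : ℝ} (hκ : 0 < κ) (K n : ℕ) :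
    ∑ k ∈ Finset.Ico 1 (n + 1), dK K ((k:ℕ):ℤ) ^ 2 * (1 / (1 + ((k:ℝ) / κ) ^ 2)) ≤
      2 * κ * (1 + Real.log K) ^ 3 := by
  calc _ = ∑ h ∈ Finset.Ico 1 (K + 1), ∑ h' ∈ Finset.Ico 1 (K + 1), ∑ k ∈ Finset.Ico 1 (n + 1),
        if Nat.lcm h h' ∣ k then (1 / (1 + ((k:ℝ) / κ) ^ 2)) else 0 := by
        symm
        rw [Finset.sum_congr rfl (fun h _ => Finset.sum_comm), Finset.sum_comm]
        apply Finset.sum_congr rfl; intro k _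
        rw [dK, sq (∑ h ∈ Finset.Ico 1 (K + 1), _), Finset.sum_mul_sum, Finset.sum_mul]
        apply Finset.sum_congr rfl; intro h _
        rw [Finset.sum_mul]
        apply Finset.sum_congr rfl; intro h' _
        simp only [Int.natCast_dvd_natCast, Nat.lcm_dvd_iff]
        by_cases h1 : h ∣ k <;> by_cases h2 : h' ∣ k <;> simp [h1, h2]
    _ ≤ ∑ h ∈ Finset.Ico 1 (K + 1), ∑ h' ∈ Finset.Ico 1 (K + 1), 2 * κ * (1 / (Nat.lcm h h' : ℝ)) := by
        apply Finset.sum_le_sum; intro h hh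
        apply Finset.sum_le_sum; intro h' hh'
        rw [Finset.mem_Ico] at hh hh'
        have h2 : 0 < Nat.lcm h h' := Nat.lcm_pos (by omega) (by omega)
        have h2' : (0:ℝ) < Nat.lcm h h' := by exact_mod_cast h2
        refine (sum_dvd_le (fun k => (1 / (1 + ((k:ℝ) / κ) ^ 2))) (fun k => by positivity) h2 n).trans ?_
        have := bsum (x := (Nat.lcm h h' : ℝ) / κ) (by positivity) n
        calc _ = ∑ m ∈ Finset.Ico 1 (n + 1), 1 / (1 + ((Nat.lcm h h' : ℝ) / κ * m) ^ 2) := by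
              apply Finset.sum_congr rfl; intro m _
              push_cast; congr 3; ring
          _ ≤ _ := this
          _ = _ := by field_simp
    _ = 2 * κ * ∑ h ∈ Finset.Ico 1 (K + 1), ∑ h' ∈ Finset.Ico 1 (K + 1), 1 / (Nat.lcm h h' : ℝ) := by
        simp_rw [Finset.mul_sum]
    _ ≤ _ := by gcongr; exact gcd_sum K

lemma dK_sq_sum_int {κ : ℝ} (hκ : 0 < κ) (K : ℕ) (s : Finset ℤ) (hs : 0 ∉ s) :
    ∑ k ∈ s, dK K k ^ 2 * (1 / (1 + ((k:ℝ) / κ) ^ 2)) ≤ 4 * κ * (1 + Real.log K) ^ 3 := by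
  have hev : ∀ k : ℤ, dK K (-k) = dK K k := by intro k; simp [dK]
  obtain ⟨n, hn⟩ : ∃ n : ℕ, ∀ k ∈ s, k.natAbs ≤ n := ⟨s.sup Int.natAbs, fun k hk => Finset.le_sup hk⟩
  have hnn : ∀ k : ℤ, 0 ≤ dK K k ^ 2 * (1 / (1 + ((k:ℝ) / κ) ^ 2)) := fun k => by positivity
  have hsub : s ⊆ (Finset.Icc (-n:ℤ) n).erase 0 := by
    intro k hk
    rw [Finset.mem_erase, Finset.mem_Icc]
    have := hn k hk
    exact ⟨by rintro rfl; exact hs hk, by omega, by omega⟩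
  refine (Finset.sum_le_sum_of_subset_of_nonneg hsub (fun k _ _ => hnn k)).trans ?_
  have h1 := sum_symm (fun k => dK K k ^ 2 * (1 / (1 + ((k:ℝ) / κ) ^ 2)))
    (by intro k; simp only [hev]; push_cast; rw [neg_div, neg_sq]) n
  have h2 := Finset.add_sum_erase (Finset.Icc (-n:ℤ) n) (fun k => dK K k ^ 2 * (1 / (1 + ((k:ℝ) / κ) ^ 2)))
    (a := 0) (by simp)
  have h3 := dK_sq_sum hκ K n
  push_cast at h1
  linarith

lemma div_cs {κ : ℝ} (hκ : 0 < κ) (K : ℕ) (g : ℤ → ℝ) (hg : ∀ k, 0 ≤ g k) {E : ℝ}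
    (hs : Summable (fun k : ℤ => (1 + ((k:ℝ) / κ) ^ 2) * g k ^ 2))
    (hE : ∑' k : ℤ, (1 + ((k:ℝ) / κ) ^ 2) * g k ^ 2 ≤ E) (hg0 : g 0 = 0) :
    Summable g ∧
    ∑ h ∈ Finset.Ico 1 (K + 1), ∑' ν : ℤ, g (h * ν) ≤ √(4 * κ * (1 + Real.log K) ^ 3 * E) := by
  have key : ∀ (K : ℕ) (s : Finset ℤ), ∑ k ∈ s, dK K k * g k ≤ √(4 * κ * (1 + Real.log K) ^ 3 * E) := by
    intro K s
    have h0 : ∑ k ∈ s, dK K k * g k = ∑ k ∈ s.erase 0, dK K k * g k := by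
      by_cases h : 0 ∈ s
      · rw [← Finset.add_sum_erase _ _ h, hg0]; ring
      · rw [Finset.erase_eq_of_notMem h]
    rw [h0]
    apply Real.le_sqrt_of_sq_le
    have hpos : ∀ k : ℤ, 0 < 1 + ((k:ℝ) / κ) ^ 2 := fun k => by positivity
    have cs := Finset.sum_mul_sq_le_sq_mul_sq (s.erase 0)
      (fun k => dK K k * √(1 / (1 + ((k:ℝ) / κ) ^ 2))) (fun k => g k * √(1 + ((k:ℝ) / κ) ^ 2))
    have e1 : ∀ k : ℤ, (dK K k * √(1 / (1 + ((k:ℝ) / κ) ^ 2))) * (g k * √(1 + ((k:ℝ) / κ) ^ 2)) = dK K k * g k := by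
      intro k
      rw [Real.sqrt_div zero_le_one, Real.sqrt_one]
      have := Real.sqrt_pos.2 (hpos k)
      field_simp
    simp only [e1] at cs
    refine cs.trans ?_
    have hL : 0 ≤ 1 + Real.log K := by have := Real.log_natCast_nonneg K; linarith
    apply mul_le_mul
    · have := dK_sq_sum_int hκ K (s.erase 0) (by simp)
      refine le_trans (le_of_eq ?_) this
      apply Finset.sum_congr rfl; intro k _
      rw [mul_pow, Real.sq_sqrt (by have := hpos k; positivity)]
    · refine le_trans ?_ hE
      refine le_trans (le_of_eq ?_) (hs.sum_le_tsum (s.erase 0) (fun k _ => by have := hpos k; positivity))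
      apply Finset.sum_congr rfl; intro k _
      rw [mul_pow, Real.sq_sqrt (hpos k).le]; ring
    · apply Finset.sum_nonneg; intros; positivity
    · positivity
  have hsg : Summable g := by
    apply summable_of_sum_le hg (c := √(4 * κ * (1 + Real.log (1:ℕ)) ^ 3 * E))
    intro s
    have hd : ∀ k : ℤ, dK 1 k = 1 := by intro k; rw [dK, Finset.sum_Ico_succ_top le_rfl]; simp
    simpa only [hd, one_mul] using key 1 s
  refine ⟨hsg, ?_⟩
  have h1 : ∀ h ∈ Finset.Ico 1 (K + 1), HasSum (fun k : ℤ => (if (h:ℤ) ∣ k then (1:ℝ) else 0) * g k) (∑' ν : ℤ, g (h * ν)) := by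
    intro h hh
    rw [Finset.mem_Ico] at hh
    have hinj : Function.Injective (fun ν : ℤ => (h:ℤ) * ν) := by
      intro a b hab
      exact mul_left_cancel₀ (by omega : (h:ℤ) ≠ 0) hab
    have h2 := (hsg.comp_injective hinj).hasSum
    refine (hinj.hasSum_iff ?_).1 (h2.congr_fun ?_)
    · intro x hx
      rw [if_neg, zero_mul]
      rintro ⟨ν, rfl⟩
      exact hx ⟨ν, rfl⟩
    · intro ν; simp
  have h2 := hasSum_sum h1
  rw [← h2.tsum_eq]
  apply Real.tsum_le_of_sum_le
  · intro k
    exact Finset.sum_nonneg (fun h _ => mul_nonneg (by split_ifs <;> norm_num) (hg k))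
  · intro s
    refine le_trans (le_of_eq ?_) (key K s)
    apply Finset.sum_congr rfl; intro k _
    rw [dK, Finset.sum_mul]

end HB12

open Real MeasureTheory
namespace HB12
open Filter Topology Set

noncomputable def sg (x : ℝ) : ℝ := Real.smoothTransition (x - 1)
noncomputable def bt (x : ℝ) : ℝ := sg x - sg (x / 2)
noncomputable def bt1 : ℝ → ℝ := deriv bt
noncomputable def bt2 : ℝ → ℝ := deriv bt1

lemma sg_smooth : ContDiff ℝ 3 sg := by
  unfold sg
  exact Real.smoothTransition.contDiff.comp (contDiff_id.sub contDiff_const)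

lemma sg_zero {x : ℝ} (h : x ≤ 1) : sg x = 0 := Real.smoothTransition.zero_of_nonpos (by linarith)
lemma sg_one {x : ℝ} (h : 2 ≤ x) : sg x = 1 := Real.smoothTransition.one_of_one_le (by linarith)

lemma bt_smooth : ContDiff ℝ 3 bt := by
  unfold bt
  exact sg_smooth.sub (sg_smooth.comp (contDiff_id.div_const 2))

lemma bt_supp {x : ℝ} (h : x ≤ 1 ∨ 4 ≤ x) : bt x = 0 := by
  unfold bt
  rcases h with h | h
  · rw [sg_zero h, sg_zero (by linarith)]; simp
  · rw [sg_one (by linarith), sg_one (by linarith)]; simp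

lemma bt1_smooth : ContDiff ℝ 2 bt1 := by
  have := bt_smooth
  rw [show (3 : WithTop ℕ∞) = 2 + 1 by norm_num] at this
  exact (contDiff_succ_iff_deriv.1 this).2.2
lemma bt2_smooth : ContDiff ℝ 1 bt2 := by
  have := bt1_smooth
  rw [show (2 : WithTop ℕ∞) = 1 + 1 by norm_num] at this
  exact (contDiff_succ_iff_deriv.1 this).2.2

lemma bt_hasDeriv (x : ℝ) : HasDerivAt bt (bt1 x) x :=
  ((bt_smooth.differentiable (by norm_num)) x).hasDerivAt
lemma bt1_hasDeriv (x : ℝ) : HasDerivAt bt1 (bt2 x) x :=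
  ((bt1_smooth.differentiable (by norm_num)) x).hasDerivAt

lemma supp_deriv {f : ℝ → ℝ} (hf : ∀ x, x ≤ 1 ∨ 4 ≤ x → f x = 0) (hc : Continuous (deriv f)) :
    ∀ x, x ≤ 1 ∨ 4 ≤ x → deriv f x = 0 := by
  have h1 : Iio (1:ℝ) ⊆ {x | deriv f x = 0} := by
    intro x hx
    have : f =ᶠ[𝓝 x] fun _ => 0 := by
      filter_upwards [Iio_mem_nhds hx] with y hy
      exact hf y (Or.inl (le_of_lt hy))
    simp [this.deriv_eq]
  have h2 : Ioi (4:ℝ) ⊆ {x | deriv f x = 0} := by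
    intro x hx
    have : f =ᶠ[𝓝 x] fun _ => 0 := by
      filter_upwards [Ioi_mem_nhds hx] with y hy
      exact hf y (Or.inr (le_of_lt hy))
    simp [this.deriv_eq]
  have hcl : IsClosed {x | deriv f x = 0} := isClosed_eq hc continuous_const
  have h3 := closure_minimal h1 hcl
  have h4 := closure_minimal h2 hcl
  rw [closure_Iio] at h3
  rw [closure_Ioi] at h4
  rintro x (h | h)
  · exact h3 h
  · exact h4 h

lemma bt1_supp {x : ℝ} (h : x ≤ 1 ∨ 4 ≤ x) : bt1 x = 0 :=
  supp_deriv (fun _ h => bt_supp h) bt1_smooth.continuous x h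
lemma bt2_supp {x : ℝ} (h : x ≤ 1 ∨ 4 ≤ x) : bt2 x = 0 :=
  supp_deriv (fun _ h => bt1_supp h) bt2_smooth.continuous x h

lemma bound_supp {f : ℝ → ℝ} (hf : ∀ x, x ≤ 1 ∨ 4 ≤ x → f x = 0) (hc : Continuous f) :
    ∃ B : ℝ, ∀ x, |f x| ≤ B := by
  obtain ⟨C, hC⟩ := isCompact_Icc.exists_bound_of_continuousOn (s := Icc (1:ℝ) 4) hc.continuousOn
  refine ⟨max C 0, fun x => ?_⟩
  by_cases h : x ∈ Icc (1:ℝ) 4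
  · exact (hC x h).trans (le_max_left _ _)
  · rw [mem_Icc, not_and_or, not_le, not_le] at h
    rw [hf x (h.imp le_of_lt le_of_lt)]; simp

lemma exists_B : ∃ B : ℝ, 1 ≤ B ∧ ∀ x, |bt x| ≤ B ∧ |bt1 x| ≤ B ∧ |bt2 x| ≤ B := by
  obtain ⟨B0, h0⟩ := bound_supp (fun _ h => bt_supp h) bt_smooth.continuous
  obtain ⟨B1, h1⟩ := bound_supp (fun _ h => bt1_supp h) bt1_smooth.continuous
  obtain ⟨B2, h2⟩ := bound_supp (fun _ h => bt2_supp h) bt2_smooth.continuous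
  refine ⟨max 1 (max B0 (max B1 B2)), le_max_left _ _, fun x => ⟨?_, ?_, ?_⟩⟩
  · exact (h0 x).trans (by simp)
  · exact (h1 x).trans (by simp)
  · exact (h2 x).trans (by simp)

noncomputable def BB : ℝ := exists_B.choose
lemma BB_one : 1 ≤ BB := exists_B.choose_spec.1
lemma bt_le (x : ℝ) : |bt x| ≤ BB := (exists_B.choose_spec.2 x).1
lemma bt1_le (x : ℝ) : |bt1 x| ≤ BB := (exists_B.choose_spec.2 x).2.1
lemma bt2_le (x : ℝ) : |bt2 x| ≤ BB := (exists_B.choose_spec.2 x).2.2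

lemma bt_partition {U0 u : ℝ} (hU : 0 < U0) {m : ℕ} (h1 : 2 * U0 ≤ u) (h2 : u ≤ 2 ^ m * U0) :
    ∑ i ∈ Finset.range m, bt (u / (2 ^ i * U0)) = 1 := by
  have : ∀ i : ℕ, bt (u / (2 ^ i * U0)) = sg (u / (2 ^ i * U0)) - sg (u / (2 ^ (i+1) * U0)) := by
    intro i
    rw [bt]; congr 2; field_simp; ring
  simp_rw [this]
  rw [Finset.sum_range_sub', sg_one, sg_zero]
  · norm_num
  · rw [div_le_one (by positivity)]; exact h2
  · rw [pow_zero, one_mul, le_div_iff₀ hU]; exact h1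

noncomputable def pp (u : ℝ) : ℝ := (√(u * (u + 1)))⁻¹
noncomputable def pp1 (u : ℝ) : ℝ := -(u + 1 / 2) * pp u ^ 3
noncomputable def pp2 (u : ℝ) : ℝ := -pp u ^ 3 + 3 * (u + 1 / 2) ^ 2 * pp u ^ 5

lemma pp_sq {u : ℝ} (hu : 0 < u) : pp u ^ 2 = 1 / (u * (u + 1)) := by
  rw [pp, inv_pow, Real.sq_sqrt (by positivity), one_div]

lemma pp_hasDeriv {u : ℝ} (hu : 0 < u) : HasDerivAt pp (pp1 u) u := by
  have h2 : HasDerivAt (fun u : ℝ => u * (u + 1)) (2 * u + 1) u := by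
    have := (hasDerivAt_id u).mul ((hasDerivAt_id u).add_const (1 : ℝ))
    refine this.congr_deriv ?_
    simp; ring
  have hp : 0 < u * (u + 1) := by positivity
  have h3 := (h2.sqrt hp.ne').inv (Real.sqrt_pos.2 hp).ne'
  refine h3.congr_deriv ?_
  unfold pp1 pp
  have := Real.sqrt_pos.2 hp
  field_simp

lemma pp1_hasDeriv {u : ℝ} (hu : 0 < u) : HasDerivAt pp1 (pp2 u) u := by
  have h1 : HasDerivAt (fun u : ℝ => -(u + 1 / 2)) (-1) u := ((hasDerivAt_id u).add_const _).neg
  have h2 := (pp_hasDeriv hu).pow 3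
  refine (h1.mul h2).congr_deriv ?_
  simp only [Pi.pow_apply]
  unfold pp2 pp1
  push_cast; ring

lemma pp_nonneg (u : ℝ) : 0 ≤ pp u := by unfold pp; positivity

lemma pp_le {U u : ℝ} (hU : 0 < U) (hu : U ≤ u) : pp u ≤ 1 / U := by
  unfold pp
  rw [one_div]
  apply inv_anti₀ hU
  apply Real.le_sqrt_of_sq_le
  nlinarith

lemma pp_mul_le {u : ℝ} (hu : 1 ≤ u) : (u + 1 / 2) * pp u ≤ 3 / 2 := by
  have := pp_le (by linarith) (le_refl u)
  calc _ ≤ (u + 1/2) * (1 / u) := by gcongr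
    _ ≤ 3 / 2 := by rw [mul_one_div, div_le_iff₀ (by linarith)]; linarith

lemma pp1_le {U u : ℝ} (hU : 1 ≤ U) (hu : U ≤ u) : |pp1 u| ≤ 3 / 2 / U ^ 2 := by
  have h1 := pp_mul_le (hU.trans hu)
  have h2 := pp_le (by linarith) hu
  have h3 := pp_nonneg u
  have e : |pp1 u| = ((u + 1/2) * pp u) * (pp u * pp u) := by
    rw [pp1, neg_mul, abs_neg, abs_of_nonneg (by have : 0 ≤ u + 1/2 := by linarith
                                                 positivity)]; ring
  rw [e]
  calc _ ≤ 3 / 2 * (1 / U * (1 / U)) := by gcongr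
    _ = _ := by field_simp

lemma pp2_le {U u : ℝ} (hU : 1 ≤ U) (hu : U ≤ u) : |pp2 u| ≤ 31 / 4 / U ^ 3 := by
  have h1 := pp_mul_le (hU.trans hu)
  have h2 := pp_le (by linarith) hu
  have h3 := pp_nonneg u
  have h0 : 0 ≤ u + 1/2 := by linarith
  have e : pp2 u = -(pp u) ^ 3 + 3 * ((u + 1/2) * pp u) ^ 2 * pp u ^ 3 := by
    unfold pp2; ring
  rw [e]
  calc _ ≤ |-(pp u) ^ 3| + |3 * ((u + 1/2) * pp u) ^ 2 * pp u ^ 3| := abs_add_le _ _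
    _ = pp u ^ 3 + 3 * ((u + 1/2) * pp u) ^ 2 * pp u ^ 3 := by
        rw [abs_neg, abs_of_nonneg (by positivity), abs_of_nonneg (by positivity)]
    _ ≤ (1 / U) ^ 3 + 3 * (3 / 2) ^ 2 * (1 / U) ^ 3 := by gcongr
    _ = _ := by field_simp; norm_num

noncomputable def al (U u : ℝ) : ℝ := bt (u / U) * pp u
noncomputable def al1 (U u : ℝ) : ℝ := bt1 (u / U) / U * pp u + bt (u / U) * pp1 u
noncomputable def al2 (U u : ℝ) : ℝ :=
  bt2 (u / U) / U / U * pp u + bt1 (u / U) / U * pp1 u + (bt1 (u / U) / U * pp1 u + bt (u / U) * pp2 u)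
noncomputable def ga (U u : ℝ) : ℝ := U ^ 2 * (al U u * pp u ^ 2)
noncomputable def ga1 (U u : ℝ) : ℝ := U ^ 2 * (al1 U u * pp u ^ 2 + al U u * (2 * pp u * pp1 u))
noncomputable def at1 (U u : ℝ) : ℝ := (al1 U u * (u * (u + 1)) + al U u * (2 * u + 1)) / U ^ 2

lemma ext_deriv {U : ℝ} {f f' : ℝ → ℝ} (h : ∀ u, U ≤ u → HasDerivAt f (f' u) u)
    (h0 : ∀ u < U, f u = 0) (h1 : ∀ u < U, f' u = 0) (u : ℝ) : HasDerivAt f (f' u) u := by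
  by_cases hu : U ≤ u
  · exact h u hu
  · push Not at hu
    rw [h1 u hu]
    have : f =ᶠ[𝓝 u] fun _ => 0 := by
      filter_upwards [Iio_mem_nhds hu] with v hv using h0 v hv
    exact (hasDerivAt_const u (0:ℝ)).congr_of_eventuallyEq this

lemma ext_cont {U : ℝ} {f : ℝ → ℝ} (h : ∀ u, U ≤ u → ContinuousAt f u)
    (h0 : ∀ u < U, f u = 0) : Continuous f := by
  rw [continuous_iff_continuousAt]
  intro u
  by_cases hu : U ≤ u
  · exact h u hu
  · push Not at hu
    have : f =ᶠ[𝓝 u] fun _ => 0 := by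
      filter_upwards [Iio_mem_nhds hu] with v hv using h0 v hv
    exact continuousAt_const.congr this.symm

section
variable {U : ℝ} (hU : 1 ≤ U)
include hU

lemma scale_supp {u : ℝ} (h : u ≤ U ∨ 4 * U ≤ u) : u / U ≤ 1 ∨ 4 ≤ u / U := by
  have h0 : 0 < U := by linarith
  rw [div_le_one h0, le_div_iff₀ h0]; exact h

lemma al_supp {u : ℝ} (h : u ≤ U ∨ 4 * U ≤ u) : al U u = 0 := by
  rw [al, bt_supp (scale_supp hU h)]; ring
lemma al1_supp {u : ℝ} (h : u ≤ U ∨ 4 * U ≤ u) : al1 U u = 0 := by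
  rw [al1, bt_supp (scale_supp hU h), bt1_supp (scale_supp hU h)]; ring
lemma al2_supp {u : ℝ} (h : u ≤ U ∨ 4 * U ≤ u) : al2 U u = 0 := by
  rw [al2, bt_supp (scale_supp hU h), bt1_supp (scale_supp hU h), bt2_supp (scale_supp hU h)]; ring

omit hU in
lemma sc_deriv {f f' : ℝ → ℝ} (h : ∀ x, HasDerivAt f (f' x) x) (u : ℝ) :
    HasDerivAt (fun u => f (u / U)) (f' (u / U) / U) u := by
  have h1 : HasDerivAt (fun u : ℝ => u / U) (1 / U) u := (hasDerivAt_id u).div_const U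
  refine ((h (u / U)).comp u h1).congr_deriv ?_
  ring

lemma al_hasDeriv (u : ℝ) : HasDerivAt (al U) (al1 U u) u := by
  apply ext_deriv (U := U) _ (fun u h => al_supp hU (Or.inl h.le)) (fun u h => al1_supp hU (Or.inl h.le))
  intro u hu
  exact (sc_deriv bt_hasDeriv u).mul (pp_hasDeriv (by linarith))

lemma al1_hasDeriv (u : ℝ) : HasDerivAt (al1 U) (al2 U u) u := by
  apply ext_deriv (U := U) _ (fun u h => al1_supp hU (Or.inl h.le)) (fun u h => al2_supp hU (Or.inl h.le))
  intro u hu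
  have hu0 : 0 < u := by linarith
  exact (((sc_deriv bt1_hasDeriv u).div_const U).mul (pp_hasDeriv hu0)).add
    ((sc_deriv bt_hasDeriv u).mul (pp1_hasDeriv hu0))

lemma ga_hasDeriv (u : ℝ) : HasDerivAt (ga U) (ga1 U u) u := by
  apply ext_deriv (U := U) _ (fun u h => by rw [ga, al_supp hU (Or.inl h.le)]; ring)
    (fun u h => by rw [ga1, al_supp hU (Or.inl h.le), al1_supp hU (Or.inl h.le)]; ring)
  intro u hu
  have hu0 : 0 < u := by linarith
  have := ((al_hasDeriv hU u).mul ((pp_hasDeriv hu0).pow 2)).const_mul (U ^ 2)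
  refine this.congr_deriv ?_
  simp [ga1]

lemma al1_cont : Continuous (al1 U) :=
  continuous_iff_continuousAt.2 fun u => (al1_hasDeriv hU u).continuousAt
lemma al_cont : Continuous (al U) :=
  continuous_iff_continuousAt.2 fun u => (al_hasDeriv hU u).continuousAt

lemma al2_cont : Continuous (al2 U) := by
  apply ext_cont (U := U) _ (fun u h => al2_supp hU (Or.inl h.le))
  intro u hu
  have hu0 : 0 < u := by linarith
  have h0 := bt_smooth.continuous
  have h1 := bt1_smooth.continuous
  have h2 := bt2_smooth.continuous
  have p0 := (pp_hasDeriv hu0).continuousAt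
  have p1 := (pp1_hasDeriv hu0).continuousAt
  have p2 : ContinuousAt pp2 u := by unfold pp2; fun_prop
  unfold al2
  fun_prop

lemma ga1_cont : Continuous (ga1 U) := by
  apply ext_cont (U := U) _ (fun u h => by rw [ga1, al_supp hU (Or.inl h.le), al1_supp hU (Or.inl h.le)]; ring)
  intro u hu
  have hu0 : 0 < u := by linarith
  have h0 := al_cont hU
  have h1 := al1_cont hU
  have p0 := (pp_hasDeriv hu0).continuousAt
  have p1 := (pp1_hasDeriv hu0).continuousAt
  unfold ga1
  fun_prop

lemma al_le {u : ℝ} : |al U u| ≤ BB / U := by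
  have hB := BB_one
  have hU0 : 0 < U := by linarith
  by_cases hu : U ≤ u
  · rw [al, abs_mul, abs_of_nonneg (pp_nonneg u)]
    calc _ ≤ BB * (1 / U) := mul_le_mul (bt_le _) (pp_le hU0 hu) (pp_nonneg u) (by linarith)
      _ = _ := by ring
  · rw [al_supp hU (Or.inl (le_of_not_ge hu)), abs_zero]; positivity

lemma al1_le {u : ℝ} : |al1 U u| ≤ 5 / 2 * BB / U ^ 2 := by
  have hB := BB_one
  have hU0 : 0 < U := by linarith
  by_cases hu : U ≤ u
  · rw [al1]
    refine (abs_add_le _ _).trans ?_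
    rw [abs_mul, abs_mul, abs_div, abs_of_pos hU0, abs_of_nonneg (pp_nonneg u)]
    have hpn := pp_nonneg u
    calc _ ≤ BB / U * (1 / U) + BB * (3 / 2 / U ^ 2) := by
          gcongr
          · exact bt1_le _
          · exact pp_le hU0 hu
          · exact bt_le _
          · exact pp1_le hU hu
      _ = _ := by field_simp; ring
  · rw [al1_supp hU (Or.inl (le_of_not_ge hu)), abs_zero]; positivity

lemma al2_le {u : ℝ} : |al2 U u| ≤ 12 * BB / U ^ 3 := by
  have hB := BB_one
  have hU0 : 0 < U := by linarith
  by_cases hu : U ≤ u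
  · rw [al2]
    refine (abs_add_le _ _).trans ?_
    refine (add_le_add (abs_add_le _ _) (abs_add_le _ _)).trans ?_
    simp only [abs_mul, abs_div, abs_of_pos hU0, abs_of_nonneg (pp_nonneg u)]
    have hpn := pp_nonneg u
    calc _ ≤ BB / U / U * (1 / U) + BB / U * (3 / 2 / U ^ 2) + (BB / U * (3 / 2 / U ^ 2) + BB * (31 / 4 / U ^ 3)) := by
          gcongr
          · exact bt2_le _
          · exact pp_le hU0 hu
          · exact bt1_le _
          · exact pp1_le hU hu
          · exact bt1_le _
          · exact pp1_le hU hu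
          · exact bt_le _
          · exact pp2_le hU hu
      _ = (47 / 4) * BB / U ^ 3 := by field_simp; ring
      _ ≤ _ := by gcongr; norm_num
  · rw [al2_supp hU (Or.inl (le_of_not_ge hu)), abs_zero]; positivity

lemma amp_al : Amp U (12 * BB) (al U) (al1 U) := by
  have hB := BB_one
  have hU0 : 0 < U := by linarith
  refine ⟨al_hasDeriv hU, al1_cont hU, fun u => al_supp hU, fun u => (al_le hU).trans ?_, fun u => (al1_le hU).trans ?_⟩
  · gcongr; linarith
  · gcongr; norm_num

lemma amp_al1 {κ : ℝ} (hκ : 1 ≤ κ) : Amp U (12 * BB) (fun u => al1 U u / κ) (fun u => al2 U u / κ) := by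
  have hB := BB_one
  have hU0 : 0 < U := by linarith
  have hdiv : ∀ x : ℝ, |x / κ| ≤ |x| := by
    intro x; rw [abs_div, abs_of_pos (by linarith : 0 < κ)]; exact div_le_self (abs_nonneg _) hκ
  refine ⟨fun u => (al1_hasDeriv hU u).div_const κ, (al2_cont hU).div_const κ,
    fun u h => by rw [al1_supp hU h, zero_div], fun u => ((hdiv _).trans (al1_le hU)).trans ?_,
    fun u => ((hdiv _).trans (al2_le hU)).trans ?_⟩
  · rw [div_le_div_iff₀ (by positivity) hU0]
    nlinarith [mul_nonneg (mul_nonneg (by linarith : 0 ≤ BB) hU0.le) (by linarith : 0 ≤ U - 1), mul_pos (by linarith : 0 < BB) hU0]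
  · gcongr
    norm_num

lemma amp_ga : Amp U (12 * BB) (ga U) (ga1 U) := by
  have hB := BB_one
  have hU0 : 0 < U := by linarith
  refine ⟨ga_hasDeriv hU, ga1_cont hU, fun u h => by rw [ga, al_supp hU h]; ring, fun u => ?_, fun u => ?_⟩
  · by_cases hu : U ≤ u
    · have h2 := pp_le hU0 hu
      have h3 := pp_nonneg u
      rw [ga, abs_mul, abs_mul, abs_of_nonneg (by positivity : 0 ≤ U ^ 2), abs_of_nonneg (by positivity : 0 ≤ pp u ^ 2)]
      calc _ ≤ U ^ 2 * (BB / U * (1 / U) ^ 2) := by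
            gcongr; exact al_le hU
        _ = BB / U := by field_simp
        _ ≤ _ := by gcongr; linarith
    · rw [ga, al_supp hU (Or.inl (le_of_not_ge hu))]; simp; positivity
  · by_cases hu : U ≤ u
    · have h2 := pp_le hU0 hu
      have h3 := pp_nonneg u
      rw [ga1, abs_mul, abs_of_nonneg (by positivity : 0 ≤ U ^ 2)]
      calc _ ≤ U ^ 2 * (|al1 U u * pp u ^ 2| + |al U u * (2 * pp u * pp1 u)|) := by
            gcongr; exact abs_add_le _ _
        _ = U ^ 2 * (|al1 U u| * pp u ^ 2 + |al U u| * (2 * pp u * |pp1 u|)) := by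
            simp only [abs_mul, abs_pow, abs_of_nonneg h3]; norm_num
        _ ≤ U ^ 2 * (5 / 2 * BB / U ^ 2 * (1 / U) ^ 2 + BB / U * (2 * (1 / U) * (3 / 2 / U ^ 2))) := by
            gcongr
            · exact al1_le hU
            · exact al_le hU
            · exact pp1_le hU hu
        _ = 11 / 2 * BB / U ^ 2 := by field_simp; ring
        _ ≤ _ := by gcongr; norm_num
    · rw [ga1, al_supp hU (Or.inl (le_of_not_ge hu)), al1_supp hU (Or.inl (le_of_not_ge hu))]; simp; positivity

lemma at_hasDeriv (u : ℝ) : HasDerivAt (fun u => al U u * (u * (u + 1)) / U ^ 2) (at1 U u) u := by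
  have h2 : HasDerivAt (fun u : ℝ => u * (u + 1)) (2 * u + 1) u := by
    have := (hasDerivAt_id u).mul ((hasDerivAt_id u).add_const (1 : ℝ))
    refine this.congr_deriv ?_
    simp; ring
  exact ((al_hasDeriv hU u).mul h2).div_const _

lemma amp_at : Amp U (59 * BB) (fun u => al U u * (u * (u + 1)) / U ^ 2) (at1 U) := by
  have hB := BB_one
  have hU0 : 0 < U := by linarith
  refine ⟨at_hasDeriv hU, ?_, fun u h => by rw [al_supp hU h]; ring, fun u => ?_, fun u => ?_⟩
  · have h0 := al_cont hU
    have h1 := al1_cont hU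
    unfold at1; fun_prop
  · by_cases hu : U ≤ u ∧ u ≤ 4 * U
    · obtain ⟨hu1, hu2⟩ := hu
      have h3 : |u * (u + 1)| ≤ 20 * U ^ 2 := by
        rw [abs_of_nonneg (by nlinarith)]; nlinarith
      rw [abs_div, abs_mul, abs_of_pos (by positivity : 0 < U ^ 2)]
      calc _ ≤ BB / U * (20 * U ^ 2) / U ^ 2 := by gcongr; exact al_le hU
        _ = 20 * BB / U := by field_simp
        _ ≤ _ := by gcongr; norm_num
    · rw [not_and_or, not_le, not_le] at hu
      rw [al_supp hU (hu.imp le_of_lt le_of_lt)]; simp; positivity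
  · by_cases hu : U ≤ u ∧ u ≤ 4 * U
    · obtain ⟨hu1, hu2⟩ := hu
      have h3 : |u * (u + 1)| ≤ 20 * U ^ 2 := by
        rw [abs_of_nonneg (by nlinarith)]; nlinarith
      have h4 : |2 * u + 1| ≤ 9 * U := by
        rw [abs_of_nonneg (by nlinarith)]; nlinarith
      rw [at1, abs_div, abs_of_pos (by positivity : 0 < U ^ 2)]
      calc _ ≤ (|al1 U u| * |u * (u + 1)| + |al U u| * |2 * u + 1|) / U ^ 2 := by
            gcongr; rw [← abs_mul, ← abs_mul]; exact abs_add_le _ _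
        _ ≤ (5 / 2 * BB / U ^ 2 * (20 * U ^ 2) + BB / U * (9 * U)) / U ^ 2 := by
            gcongr
            · exact al1_le hU
            · exact al_le hU
        _ = _ := by field_simp; ring
    · rw [not_and_or, not_le, not_le] at hu
      rw [at1, al_supp hU (hu.imp le_of_lt le_of_lt), al1_supp hU (hu.imp le_of_lt le_of_lt)]; simp; positivity
end
end HB12

open Real MeasureTheory
namespace HB12
open Filter Topology Set

lemma int_deriv_zero {H H' : ℝ → ℂ} (hd : ∀ u, HasDerivAt H (H' u) u) (hc : Continuous H') {X : ℝ}
    (hs : ∀ u, u ≤ 0 ∨ X ≤ u → H u = 0) (hs' : ∀ u, u ≤ 0 ∨ X ≤ u → H' u = 0) : ∫ u : ℝ, H' u = 0 := by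
  have : ∫ u : ℝ, H' u = ∫ u in (0:ℝ)..X, H' u := by
    rw [intervalIntegral.integral_eq_integral_of_support_subset]
    intro u hu
    by_contra h
    apply hu
    rw [mem_Ioc, not_and_or, not_lt, not_le] at h
    exact hs' u (h.imp id le_of_lt)
  rw [this, intervalIntegral.integral_eq_sub_of_hasDerivAt (fun u _ => hd u) (hc.intervalIntegrable _ _),
    hs 0 (Or.inl le_rfl), hs X (Or.inr le_rfl), sub_zero]

variable {U M : ℝ} {a a' : ℝ → ℝ}

lemma amp_deriv (ha : Amp U M a a') (hU : 1 ≤ U) (t u : ℝ) :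
    HasDerivAt (fun u => (a u : ℂ) * e (th t u))
      ((a' u : ℂ) * e (th t u) + (-Complex.I * t) * (((a u * pp u ^ 2 : ℝ):ℂ) * e (th t u))) u := by
  by_cases hu : U ≤ u
  · have hu0 : 0 < u := by linarith
    have h1 := (ha.hd u).ofReal_comp
    have h2 := hasDerivAt_e_comp (hasDerivAt_th t hu0)
    refine (h1.mul h2).congr_deriv ?_
    rw [pp_sq hu0]
    push_cast
    ring
  · push Not at hu
    have hz : (fun u => a u) =ᶠ[𝓝 u] fun _ => (0:ℝ) := by
      filter_upwards [Iio_mem_nhds hu] with v hv using ha.supp v (Or.inl (le_of_lt hv))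
    have h0 : a' u = 0 := (ha.hd u).unique ((hasDerivAt_const u (0:ℝ)).congr_of_eventuallyEq hz)
    have h1 : a u = 0 := ha.supp u (Or.inl hu.le)
    rw [h0, h1]
    simp only [Complex.ofReal_zero, zero_mul, mul_zero, add_zero]
    refine (hasDerivAt_const u (0:ℂ)).congr_of_eventuallyEq ?_
    filter_upwards [hz] with v hv
    simp [hv]

lemma FF_cont (ha : Amp U M a a') (hU : 1 ≤ U) (R : Finset ℝ) (c : ℝ → ℂ) : Continuous (FF R c a) := by
  unfold FF
  exact continuous_finsetSum _ fun r _ => continuous_const.mul (cont_ae ha hU r)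

lemma FF_supp (ha : Amp U M a a') (hU : 1 ≤ U) (R : Finset ℝ) (c : ℝ → ℂ) :
    ∀ u, u ≤ 0 ∨ 4 * U ≤ u → FF R c a u = 0 := by
  intro u hu
  unfold FF
  rw [ha.supp u (hu.imp (fun h => by linarith) id)]
  simp

lemma FF_int (ha : Amp U M a a') (hU : 1 ≤ U) (R : Finset ℝ) (c : ℝ → ℂ) {g : ℝ → ℂ} (hg : Continuous g) :
    Integrable (fun u => FF R c a u * g u) := by
  apply ((FF_cont ha hU R c).mul hg).integrable_of_hasCompactSupport
  apply HasCompactSupport.intro (K := Icc (0:ℝ) (4 * U)) isCompact_Icc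
  intro x hx
  rw [mem_Icc, not_and_or, not_le, not_le] at hx
  simp [FF_supp ha hU R c x (hx.imp le_of_lt le_of_lt)]

lemma FF_hasDeriv (hU : 1 ≤ U) (R : Finset ℝ) (c : ℝ → ℂ) {T : ℝ} (hT : 0 < T) (u : ℝ) :
    HasDerivAt (FF R c (al U)) (((T / U ^ 2 : ℝ):ℂ) * (FF R c (fun u => al1 U u / (T / U ^ 2)) u +
      FF R (fun r => -Complex.I * (r / T : ℝ) * c r) (ga U) u)) u := by
  have h := HasDerivAt.fun_sum (u := R) (fun r _ => (amp_deriv (amp_al hU) hU r u).const_mul (c r))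
  refine h.congr_deriv ?_
  rw [FF, FF, ← Finset.sum_add_distrib, Finset.mul_sum]
  apply Finset.sum_congr rfl
  intro r _
  have hU0 : (U:ℂ) ≠ 0 := by exact_mod_cast (by linarith : U ≠ 0)
  have hT0 : (T:ℂ) ≠ 0 := by exact_mod_cast hT.ne'
  simp only [ga]
  push_cast
  field_simp

lemma Fh_deriv (hU : 1 ≤ U) (R : Finset ℝ) (c : ℝ → ℂ) {T : ℝ} (hT : U ^ 2 ≤ T) (k : ℝ) :
    2 * π * k * Complex.I * Fh (FF R c (al U)) k = ((T / U ^ 2 : ℝ):ℂ) *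
      (Fh (FF R c (fun u => al1 U u / (T / U ^ 2))) k +
       Fh (FF R (fun r => -Complex.I * (r / T : ℝ) * c r) (ga U)) k) := by
  have hU0 : 0 < U := by linarith
  have hT0 : 0 < T := lt_of_lt_of_le (by positivity) hT
  have hκ : 1 ≤ T / U ^ 2 := by rwa [le_div_iff₀ (by positivity), one_mul]
  set κ := T / U ^ 2
  have A0 := amp_al hU
  have A1 := amp_al1 hU hκ
  have A2 := amp_ga hU
  set c2 : ℝ → ℂ := fun r => -Complex.I * (r / T : ℝ) * c r
  have hek : ∀ u : ℝ, HasDerivAt (fun u : ℝ => e (-(2 * π * k * u))) (-(2 * π * k * Complex.I) * e (-(2 * π * k * u))) u := by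
    intro u
    have h1 : HasDerivAt (fun u : ℝ => -(2 * π * k * u)) (-(2 * π * k)) u := by
      exact ((hasDerivAt_id u).const_mul (2 * π * k)).neg.congr_deriv (by ring)
    refine (hasDerivAt_e_comp h1).congr_deriv ?_
    push_cast; ring
  have hec : Continuous (fun u : ℝ => e (-(2 * π * k * u))) := by have := continuous_e; fun_prop
  have hFd : ∀ u, HasDerivAt (FF R c (al U)) ((κ:ℂ) * (FF R c (fun u => al1 U u / κ) u + FF R c2 (ga U) u)) u :=
    fun u => FF_hasDeriv hU R c hT0 u
  have hd2 : ∀ u : ℝ, HasDerivAt (fun u => FF R c (al U) u * e (-(2 * π * k * u)))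
      (((κ:ℂ) * (FF R c (fun u => al1 U u / κ) u * e (-(2 * π * k * u))) +
      (κ:ℂ) * (FF R c2 (ga U) u * e (-(2 * π * k * u)))) +
      (-(2 * π * k * Complex.I)) * (FF R c (al U) u * e (-(2 * π * k * u)))) u := fun u =>
    ((hFd u).mul (hek u)).congr_deriv (by ring)
  have hz := int_deriv_zero (X := 4 * U) hd2 (by
      have h0 := FF_cont A0 hU R c
      have h1 := FF_cont A1 hU R c
      have h2 := FF_cont A2 hU R c2
      fun_prop)
    (fun u hu => by rw [FF_supp A0 hU R c u hu, zero_mul])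
    (fun u hu => by
      rw [FF_supp A0 hU R c u hu, FF_supp A1 hU R c u hu, FF_supp A2 hU R c2 u hu]; ring)
  have i0 := FF_int A0 hU R c hec
  have i1 := FF_int A1 hU R c hec
  have i2 := FF_int A2 hU R c2 hec
  have i12 : Integrable (fun u => (κ:ℂ) * (FF R c (fun u => al1 U u / κ) u * e (-(2 * π * k * u))) +
      (κ:ℂ) * (FF R c2 (ga U) u * e (-(2 * π * k * u)))) := (i1.const_mul _).add (i2.const_mul _)
  rw [integral_add i12 (i0.const_mul _),
    integral_add (i1.const_mul _) (i2.const_mul _), integral_const_mul, integral_const_mul, integral_const_mul] at hz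
  simp only [Fh]
  linear_combination -hz

lemma Fh_zero (hU : 1 ≤ U) {t T : ℝ} (hT : 0 < T) (ht : T / 2 ≤ t) :
    ‖∫ u : ℝ, (al U u : ℂ) * e (th t u)‖ ≤ 354 * BB * U / T := by
  have hB := BB_one
  have hU0 : 0 < U := by linarith
  have ht0 : 0 < t := by linarith
  have A := amp_at hU
  have hd := fun u => amp_deriv A hU t u
  have e1 : ∀ u : ℝ, ((at1 U u : ℂ) * e (th t u) + (-Complex.I * t) * (((al U u * (u * (u + 1)) / U ^ 2 * pp u ^ 2 : ℝ):ℂ) * e (th t u)))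
      = (at1 U u : ℂ) * e (th t u) + (-Complex.I * (t / U ^ 2 : ℝ)) * ((al U u : ℂ) * e (th t u)) := by
    intro u
    by_cases hu : u ≤ U
    · rw [al_supp hU (Or.inl hu)]; simp
    · have h0 : 0 < u := by linarith
      rw [pp_sq h0]
      have : al U u * (u * (u + 1)) / U ^ 2 * (1 / (u * (u + 1))) = al U u / U ^ 2 := by field_simp
      rw [this]; push_cast; ring
  simp_rw [e1] at hd
  have hs : ∀ u, u ≤ 0 ∨ 4 * U ≤ u → al U u = 0 := fun u h => al_supp hU (h.imp (fun h => by linarith) id)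
  have hs1 : ∀ u, u ≤ U ∨ 4 * U ≤ u → at1 U u = 0 := fun u h => by
    rw [at1, al_supp hU h, al1_supp hU h]; ring
  have hat : Amp U (59 * BB) (fun u => al U u * (u * (u + 1)) / U ^ 2) (at1 U) := A
  have c0 := cont_ae (amp_al hU) hU t
  have c1 : Continuous (fun u => (at1 U u : ℂ) * e (th t u)) := by
    rw [continuous_iff_continuousAt]
    intro u
    by_cases h : u < U
    · have : (fun u => (at1 U u : ℂ) * e (th t u)) =ᶠ[𝓝 u] fun _ => 0 := by
        filter_upwards [Iio_mem_nhds h] with v hv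
        simp [hs1 v (Or.inl (le_of_lt hv))]
      exact continuousAt_const.congr this.symm
    · have h0 : 0 < u := by linarith
      have h3 := continuous_e
      exact (Complex.continuous_ofReal.comp A.hc).continuousAt.mul
        (h3.continuousAt.comp (hasDerivAt_th t h0).continuousAt)
  have hz := int_deriv_zero (X := 4 * U) hd (by fun_prop)
    (fun u hu => by simp [hs u hu])
    (fun u hu => by simp [hs u hu, hs1 u (hu.imp (fun h => by linarith) id)])
  have cs : ∀ f : ℝ → ℂ, Continuous f → (∀ u, u ≤ 0 ∨ 4 * U ≤ u → f u = 0) → Integrable f := by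
    intro f hf hf0
    apply hf.integrable_of_hasCompactSupport
    apply HasCompactSupport.intro (K := Icc (0:ℝ) (4 * U)) isCompact_Icc
    intro x hx
    rw [mem_Icc, not_and_or, not_le, not_le] at hx
    exact hf0 x (hx.imp le_of_lt le_of_lt)
  have i0 := cs _ c0 (fun u hu => by simp [hs u hu])
  have i1 := cs _ c1 (fun u hu => by simp [hs1 u (hu.imp (fun h => by linarith) id)])
  rw [integral_add i1 (i0.const_mul _), integral_const_mul] at hz
  have hnorm : (t / U ^ 2) * ‖∫ u : ℝ, (al U u : ℂ) * e (th t u)‖ = ‖∫ u : ℝ, (at1 U u : ℂ) * e (th t u)‖ := by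
    have : ∫ u : ℝ, (at1 U u : ℂ) * e (th t u) = Complex.I * (t / U ^ 2 : ℝ) * ∫ u : ℝ, (al U u : ℂ) * e (th t u) := by
      linear_combination hz
    rw [this, norm_mul, norm_mul, Complex.norm_I, Complex.norm_real, Real.norm_of_nonneg (by positivity), one_mul]
  have hb : ‖∫ u : ℝ, (at1 U u : ℂ) * e (th t u)‖ ≤ 59 * BB / U ^ 2 * (3 * U) := by
    have : ∫ u : ℝ, (at1 U u : ℂ) * e (th t u) = ∫ u in U..(4 * U), (at1 U u : ℂ) * e (th t u) := by
      rw [intervalIntegral.integral_eq_integral_of_support_subset]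
      intro u hu
      by_contra h
      apply hu
      rw [mem_Ioc, not_and_or, not_lt, not_le] at h
      simp [hs1 u (h.imp id le_of_lt)]
    rw [this]
    refine (intervalIntegral.norm_integral_le_of_norm_le_const (C := 59 * BB / U ^ 2) fun u _ => ?_).trans ?_
    · rw [norm_mul, norm_e, mul_one, Complex.norm_real]; exact A.b1 u
    · rw [abs_of_pos (by linarith)]; gcongr; linarith
  rw [← hnorm] at hb
  have h1 : ‖∫ u : ℝ, (al U u : ℂ) * e (th t u)‖ ≤ 177 * BB * U / t := by
    rw [le_div_iff₀ ht0]
    rw [div_mul_eq_mul_div, div_mul_eq_mul_div, div_le_div_iff_of_pos_right (by positivity)] at hb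
    nlinarith
  refine h1.trans ?_
  rw [div_le_div_iff₀ ht0 hT]
  have : 0 < BB * U := by positivity
  nlinarith

lemma poisson {F : ℝ → ℂ} (hc : Continuous F) {X : ℝ} (hF : ∀ u, u ≤ 0 ∨ X ≤ u → F u = 0)
    {h N : ℕ} (hh : 0 < h) (hN : h * X ≤ N) (hs : Summable fun ν : ℤ => Fh F (h * ν)) :
    ∑ n ∈ Finset.Ico 1 (N + 1), ((1 / h : ℝ):ℂ) * F (n / h) = ∑' ν : ℤ, Fh F (h * ν) := by
  have hh0 : (0:ℝ) < h := by exact_mod_cast hh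
  set g : ℝ → ℂ := fun x => ((1 / h : ℝ):ℂ) * F (x / h) with hg
  have hgc : Continuous g := by fun_prop
  have hgs : ∀ x, x ≤ 0 ∨ (N:ℝ) ≤ x → g x = 0 := by
    intro x hx
    rw [hg]; simp only
    rw [hF, mul_zero]
    rcases hx with hx | hx
    · left; exact div_nonpos_of_nonpos_of_nonneg hx hh0.le
    · right; rw [le_div_iff₀ hh0]; linarith
  have hft : ∀ ν : ℤ, FourierTransform.fourier g ν = Fh F (h * ν) := by
    intro ν
    rw [Real.fourier_real_eq_integral_exp_smul, Fh]
    have := Measure.integral_comp_div (fun x : ℝ => F x * e (-(2 * π * (h * ν) * x))) (h:ℝ)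
    rw [abs_of_pos hh0] at this
    have h2 : ∫ x : ℝ, F x * e (-(2 * π * (h * ν) * x)) = ((1 / h : ℝ):ℂ) * ∫ x : ℝ, F (x / h) * e (-(2 * π * (h * ν) * (x / h))) := by
      rw [this, Complex.real_smul]
      push_cast
      have : (h:ℂ) ≠ 0 := by exact_mod_cast hh.ne'
      field_simp
    rw [h2, ← integral_const_mul]
    congr 1; ext x
    rw [smul_eq_mul, hg, mul_comm, e, mul_assoc]
    congr 3
    push_cast
    have : (h:ℂ) ≠ 0 := by exact_mod_cast hh.ne'
    field_simp
  have hP := Real.tsum_eq_tsum_fourier_of_rpow_decay_of_summable hgc (b := 2) (by norm_num) (by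
      apply Asymptotics.IsBigO.of_bound 0
      have : ∀ᶠ x in cocompact ℝ, x ∉ Icc (0:ℝ) N := isCompact_Icc.compl_mem_cocompact
      filter_upwards [this] with x hx
      rw [mem_Icc, not_and_or, not_le, not_le] at hx
      rw [hgs x (hx.imp le_of_lt le_of_lt)]; simp) (by simpa only [hft] using hs) 0
  simp only [hft, zero_add] at hP
  have h3 : ∑' n : ℤ, g n = ∑ n ∈ Finset.Ico 1 (N + 1), g (n:ℕ) := by
    rw [tsum_eq_sum (s := (Finset.Ico 1 (N+1)).image (fun n : ℕ => (n:ℤ)))]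
    · rw [Finset.sum_image (by intro a _ b _ hab; exact Int.ofNat_inj.1 hab)]
      rfl
    · intro n hn
      apply hgs
      by_cases h1 : n ≤ 0
      · left; exact_mod_cast h1
      · right
        have : (N:ℤ) ≤ n := by
          by_contra h2
          apply hn
          rw [Finset.mem_image]
          exact ⟨n.toNat, by rw [Finset.mem_Ico]; omega, by omega⟩
        exact_mod_cast this
  rw [← h3, hP]
  apply tsum_congr
  intro ν
  simp

end HB12

open Real MeasureTheory
namespace HB12
open Filter Topology Set

noncomputable def KK (U T : ℝ) : ℕ := ⌊T / U ^ 2⌋₊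

noncomputable def MU (U T : ℝ) (N : ℕ) (t : ℝ) : ℂ :=
  ∑ h ∈ Finset.Ico 1 (KK U T + 1), ∑ n ∈ Finset.Ico 1 (N + 1),
    ((1 / h : ℝ):ℂ) * ((al U (n / h) : ℂ) * e (th t (n / h)))

lemma FF_zero_le {U T : ℝ} (hU : 1 ≤ U) (hT : 0 < T) {R : Finset ℝ} (hR : ∀ r ∈ R, T / 2 ≤ r) {c : ℝ → ℂ}
    (hcb : ∀ r ∈ R, ‖c r‖ ≤ 1) : ‖Fh (FF R c (al U)) 0‖ ≤ R.card * (354 * BB * U / T) := by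
  have hi : ∀ r, Integrable (fun u => (al U u : ℂ) * e (th r u)) := by
    intro r
    have := FF_int (amp_al hU) hU {r} (fun _ => 1) (g := fun _ => 1) continuous_const
    simpa [FF] using this
  have h1 : Fh (FF R c (al U)) 0 = ∑ r ∈ R, c r * ∫ u : ℝ, (al U u : ℂ) * e (th r u) := by
    simp only [Fh, FF, mul_zero, zero_mul, neg_zero, e_zero, mul_one]
    rw [integral_finsetSum _ (fun r _ => (hi r).const_mul _)]
    simp_rw [integral_const_mul]
  rw [h1, ← nsmul_eq_mul]
  refine (norm_sum_le _ _).trans (Finset.sum_le_card_nsmul _ _ _ fun r hr => ?_)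
  rw [norm_mul]
  calc _ ≤ 1 * (354 * BB * U / T) := mul_le_mul (hcb r hr) (Fh_zero hU hT (hR r hr)) (norm_nonneg _) zero_le_one
    _ = _ := one_mul _

lemma lv {U T T0 G ℓ : ℝ} {N : ℕ} (hU : 1 ≤ U) (hUT : U ^ 2 ≤ T) (hN : 4 * T / U ≤ N) (hG : 0 < G)
    (hGU : G / 4 ≤ U) {R : Finset ℝ} (hR : ∀ r ∈ R, T / 2 ≤ r) (hR2 : ∀ r ∈ R, r ≤ 5 * T / 2)
    (hsp : ∀ r ∈ R, ∀ s ∈ R, r ≠ s → G ≤ |r - s|) (hT0 : ∀ r ∈ R, ∀ s ∈ R, |r - s| ≤ T0)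
    (hℓ1 : 1 + Real.log ⌈4 * U⌉₊ ≤ ℓ) (hℓ2 : 1 + Real.log ⌊T0 / G⌋₊ ≤ ℓ) (hℓ3 : 1 + Real.log (KK U T) ≤ ℓ) :
    ∑ r ∈ R, ‖MU U T N r‖ ≤ 354 * BB * R.card / U + √(4 * (T / U ^ 2) * ℓ ^ 3 * (3 * (9 * (12 * BB) ^ 2 *
      (412 * R.card * ℓ / G + R.card ^ 2 * (8000 * U * ℓ / T + 18000 * √(U * T0) / T))))) := by
  have hU0 : 0 < U := by linarith
  have hTp : 0 < T := lt_of_lt_of_le (by positivity) hUT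
  have hB := BB_one
  have hκ1 : 1 ≤ T / U ^ 2 := by rwa [le_div_iff₀ (by positivity), one_mul]
  set κ := T / U ^ 2 with hκdef
  have hκ : 0 < κ := by linarith
  set K := KK U T with hK
  set c : ℝ → ℂ := fun r => (starRingEnd ℂ) (MU U T N r) / (‖MU U T N r‖ : ℂ) with hc
  have hc1 : ∀ r, ‖c r‖ ≤ 1 := by
    intro r
    rw [hc]; simp only
    rw [norm_div, RCLike.norm_conj, Complex.norm_real, norm_norm]
    exact div_self_le_one _
  have hcM : ∀ r, c r * MU U T N r = (‖MU U T N r‖ : ℂ) := by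
    intro r
    rw [hc]; simp only
    by_cases h : ‖MU U T N r‖ = 0
    · simp [norm_eq_zero.1 h]
    · rw [div_mul_eq_mul_div, Complex.conj_mul']
      have : (‖MU U T N r‖ : ℂ) ≠ 0 := by exact_mod_cast h
      field_simp
  set c2 : ℝ → ℂ := fun r => -Complex.I * (r / T : ℝ) * c r with hc2
  have hc2b : ∀ r ∈ R, ‖c2 r‖ ≤ 3 := by
    intro r hr
    have h1 : 0 ≤ r / T := div_nonneg (by linarith [hR r hr]) hTp.le
    have h2 : r / T ≤ 3 := by rw [div_le_iff₀ hTp]; linarith [hR2 r hr]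
    rw [hc2]; simp only
    rw [norm_mul, norm_mul, norm_neg, Complex.norm_I, one_mul, Complex.norm_real, Real.norm_of_nonneg h1]
    nlinarith [hc1 r, norm_nonneg (c r)]
  have hc3 : ∀ r ∈ R, ‖c r‖ ≤ 3 := fun r _ => (hc1 r).trans (by norm_num)
  set F := FF R c (al U) with hF
  obtain ⟨s0, E0⟩ := energy (amp_al hU) hU hTp hG hGU hR hsp hT0 hc3 hℓ1 hℓ2
  obtain ⟨s1, E1⟩ := energy (amp_al1 hU hκ1) hU hTp hG hGU hR hsp hT0 hc3 hℓ1 hℓ2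
  obtain ⟨s2, E2⟩ := energy (amp_ga hU) hU hTp hG hGU hR hsp hT0 hc2b hℓ1 hℓ2
  set EE := 9 * (12 * BB) ^ 2 * (412 * R.card * ℓ / G + R.card ^ 2 * (8000 * U * ℓ / T + 18000 * √(U * T0) / T)) with hEE
  set F1 := FF R c (fun u => al1 U u / κ) with hF1
  set F2 := FF R c2 (ga U) with hF2
  set g : ℤ → ℝ := fun k => if k = 0 then 0 else ‖Fh F k‖ with hg
  have hg0 : ∀ k, 0 ≤ g k := fun k => by rw [hg]; simp only; split_ifs <;> positivity
  have hgle : ∀ k, g k ≤ ‖Fh F k‖ := fun k => by rw [hg]; simp only; split_ifs <;> simp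
  have hpt : ∀ k : ℤ, (1 + ((k:ℝ) / κ) ^ 2) * g k ^ 2 ≤ ‖Fh F k‖ ^ 2 + (‖Fh F1 k‖ ^ 2 + ‖Fh F2 k‖ ^ 2) := by
    intro k
    have hd := congrArg norm (Fh_deriv hU R c hUT (k:ℝ))
    rw [← hκdef, ← hF1, ← hF2, ← hF] at hd
    simp only [norm_mul, Complex.norm_I, mul_one, Complex.norm_real, Real.norm_of_nonneg hκ.le,
      Real.norm_of_nonneg pi_pos.le, Complex.norm_ofNat] at hd
    have h1 : (2 * π) * (|(k:ℝ)| / κ * ‖Fh F k‖) ≤ ‖Fh F1 k‖ + ‖Fh F2 k‖ := by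
      have h2 := norm_add_le (Fh F1 k) (Fh F2 k)
      have : (2 * π) * (|(k:ℝ)| / κ * ‖Fh F k‖) = ‖Fh F1 k + Fh F2 k‖ := by
        rw [Real.norm_eq_abs] at hd
        field_simp
        linarith
      rw [this]; exact h2
    have hpi := Real.pi_gt_three
    set x := |(k:ℝ)| / κ * ‖Fh F k‖ with hx
    have hx0 : 0 ≤ x := by positivity
    have hx2 : x ^ 2 = ((k:ℝ) / κ) ^ 2 * ‖Fh F k‖ ^ 2 := by rw [hx, mul_pow, div_pow _ κ, sq_abs, div_pow _ κ]
    have hxx : 2 * x ≤ ‖Fh F1 k‖ + ‖Fh F2 k‖ := by nlinarith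
    have hgk : g k ^ 2 ≤ ‖Fh F k‖ ^ 2 := pow_le_pow_left₀ (hg0 k) (hgle k) 2
    calc (1 + ((k:ℝ) / κ) ^ 2) * g k ^ 2 ≤ (1 + ((k:ℝ) / κ) ^ 2) * ‖Fh F k‖ ^ 2 := by gcongr
      _ = ‖Fh F k‖ ^ 2 + x ^ 2 := by rw [hx2]; ring
      _ ≤ _ := by nlinarith [sq_nonneg (‖Fh F1 k‖ - ‖Fh F2 k‖)]
  have hsum := s0.add (s1.add s2)
  have hs : Summable fun k : ℤ => (1 + ((k:ℝ) / κ) ^ 2) * g k ^ 2 :=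
    Summable.of_nonneg_of_le (fun k => by positivity) hpt hsum
  have hE : ∑' k : ℤ, (1 + ((k:ℝ) / κ) ^ 2) * g k ^ 2 ≤ 3 * EE := by
    refine (hs.tsum_le_tsum hpt hsum).trans ?_
    rw [s0.tsum_add (s1.add s2), s1.tsum_add s2]
    linarith
  obtain ⟨gs, gb⟩ := div_cs hκ K g hg0 hs hE (by simp [hg])
  set z := ‖Fh F 0‖ with hz
  have hone : ∀ h ∈ Finset.Ico 1 (K + 1), ‖∑ n ∈ Finset.Ico 1 (N + 1), ((1 / h : ℝ):ℂ) * F (n / h)‖ ≤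
      ∑' ν : ℤ, g (h * ν) + z := by
    intro h hh
    rw [Finset.mem_Ico] at hh
    have hh0 : (0:ℝ) < h := by exact_mod_cast hh.1
    have hinj : Function.Injective (fun ν : ℤ => (h:ℤ) * ν) := fun x y hxy => by
      have : (h:ℤ) ≠ 0 := by omega
      exact mul_left_cancel₀ this hxy
    have gs' : Summable (fun ν : ℤ => g (h * ν)) := gs.comp_injective hinj
    have hs0 : HasSum (fun ν : ℤ => if ν = 0 then z else 0) z := hasSum_ite_eq 0 z
    have heq : ∀ ν : ℤ, ‖Fh F (h * ν)‖ = g (h * ν) + if ν = 0 then z else 0 := by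
      intro ν
      have : (h:ℤ) ≠ 0 := by omega
      by_cases hν : ν = 0
      · simp [hg, hν, hz]
      · simp [hg, hν, show h ≠ 0 by omega]
    have hsn : Summable fun ν : ℤ => ‖Fh F (h * ν)‖ := by
      simp_rw [heq]; exact gs'.add hs0.summable
    rw [poisson (FF_cont (amp_al hU) hU R c) (FF_supp (amp_al hU) hU R c) (by omega) ?_ hsn.of_norm]
    · refine (norm_tsum_le_tsum_norm hsn).trans ?_
      simp_rw [heq]
      rw [gs'.tsum_add hs0.summable, hs0.tsum_eq]
    · have h1 : (h:ℝ) ≤ κ := by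
        calc (h:ℝ) ≤ K := by exact_mod_cast (by omega : h ≤ K)
          _ ≤ κ := Nat.floor_le hκ.le
      calc (h:ℝ) * (4 * U) ≤ κ * (4 * U) := by gcongr
        _ = 4 * T / U := by rw [hκdef]; field_simp
        _ ≤ N := hN
  have hmain : ((∑ r ∈ R, ‖MU U T N r‖ : ℝ):ℂ) = ∑ h ∈ Finset.Ico 1 (K + 1), ∑ n ∈ Finset.Ico 1 (N + 1), ((1 / h : ℝ):ℂ) * F (n / h) := by
    push_cast
    simp_rw [← hcM]
    simp only [MU, hF, FF, Finset.mul_sum]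
    rw [Finset.sum_comm]
    refine Finset.sum_congr rfl fun h _ => ?_
    rw [Finset.sum_comm]
    refine Finset.sum_congr rfl fun n _ => Finset.sum_congr rfl fun r _ => ?_
    push_cast
    ring
  have h5 : ∑ r ∈ R, ‖MU U T N r‖ ≤ ∑ h ∈ Finset.Ico 1 (K + 1), (∑' ν : ℤ, g (h * ν) + z) := by
    have : ∑ r ∈ R, ‖MU U T N r‖ = ‖((∑ r ∈ R, ‖MU U T N r‖ : ℝ):ℂ)‖ := by
      rw [Complex.norm_real, Real.norm_of_nonneg (Finset.sum_nonneg fun _ _ => norm_nonneg _)]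
    rw [this, hmain]
    exact (norm_sum_le _ _).trans (Finset.sum_le_sum hone)
  rw [Finset.sum_add_distrib, Finset.sum_const, Nat.card_Ico, nsmul_eq_mul, Nat.add_sub_cancel] at h5
  have hKκ : (K:ℝ) ≤ κ := Nat.floor_le hκ.le
  have hz2 : (K:ℝ) * z ≤ 354 * BB * R.card / U := by
    calc (K:ℝ) * z ≤ κ * (R.card * (354 * BB * U / T)) :=
          mul_le_mul hKκ (FF_zero_le hU hTp hR (fun r _ => hc1 r)) (norm_nonneg _) hκ.le
      _ = _ := by rw [hκdef]; field_simp
  have hEE0 : 0 ≤ EE := by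
    have h : 0 ≤ ∑' k : ℤ, ‖Fh F k‖ ^ 2 := tsum_nonneg (fun k : ℤ => sq_nonneg ‖Fh F k‖)
    linarith
  have hlogK : 0 ≤ Real.log K := Real.log_natCast_nonneg K
  have h6 : √(4 * κ * (1 + Real.log K) ^ 3 * (3 * EE)) ≤ √(4 * κ * ℓ ^ 3 * (3 * EE)) := by
    apply Real.sqrt_le_sqrt
    gcongr
  linarith

end HB12

open Real MeasureTheory
namespace HB12
open Filter Topology Set

noncomputable def phi (v : ℝ) : ℝ := (1 / (2 * π)) * sinc (v / 2) ^ 2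
noncomputable def La (x : ℝ) : ℝ := max 0 (1 - |x|)

lemma phi_nonneg (v : ℝ) : 0 ≤ phi v := by unfold phi; positivity
@[fun_prop] lemma phi_cont : Continuous phi := by
  have := continuous_sinc
  unfold phi; fun_prop
@[fun_prop] lemma La_cont : Continuous La := by unfold La; fun_prop

lemma sinc_sq_le (x : ℝ) : sinc x ^ 2 ≤ 2 / (1 + x ^ 2) := by
  rw [le_div_iff₀ (by positivity)]
  have h1 : sinc x ^ 2 ≤ 1 := by rw [sq_le_one_iff_abs_le_one]; exact abs_sinc_le_one x
  have h2 : sinc x ^ 2 * x ^ 2 ≤ 1 := by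
    by_cases hx : x = 0
    · simp [hx]
    · rw [sinc_of_ne_zero hx, div_pow, div_mul_cancel₀ _ (by positivity)]; exact sin_sq_le_one x
  linarith

lemma phi_le (v : ℝ) : phi v ≤ 2 / (1 + v ^ 2) := by
  have h := sinc_sq_le (v / 2)
  have hpi := pi_gt_three
  have h1 : 1 / (2 * π) ≤ 1 / 6 := by apply one_div_le_one_div_of_le <;> linarith
  calc phi v ≤ 1 / 6 * (2 / (1 + (v / 2) ^ 2)) := by unfold phi; gcongr
    _ ≤ _ := by
      rw [div_mul_div_comm, div_le_div_iff₀ (by positivity) (by positivity)]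
      nlinarith [sq_nonneg v]

lemma phi_ge {v : ℝ} (hv : |v| ≤ 2) : 1 / 16 ≤ phi v := by
  have key : ∀ x : ℝ, 0 ≤ x → x ≤ 1 → 2 / π ≤ sinc x := by
    intro x h0 h1
    rcases h0.eq_or_lt with h | h
    · rw [← h, sinc_zero, div_le_one pi_pos]; linarith [pi_gt_three]
    · rw [sinc_of_ne_zero h.ne', le_div_iff₀ h]
      exact mul_le_sin h0 (by linarith [pi_gt_three])
  have h2 : 2 / π ≤ sinc (v / 2) := by
    rcases le_total 0 v with h | h
    · rw [abs_of_nonneg h] at hv; exact key _ (by linarith) (by linarith)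
    · rw [abs_of_nonpos h] at hv
      rw [← sinc_neg]; exact key _ (by linarith) (by linarith)
  have h3 : (2 / π) ^ 2 ≤ sinc (v / 2) ^ 2 := by gcongr
  have hp : π ^ 3 ≤ 32 := by
    have := pi_lt_d2
    calc π ^ 3 ≤ 3.15 ^ 3 := by gcongr
      _ ≤ 32 := by norm_num
  calc 1 / 16 ≤ 1 / (2 * π) * (2 / π) ^ 2 := by
        rw [div_pow, div_mul_div_comm, div_le_div_iff₀ (by norm_num) (by positivity)]
        nlinarith
    _ ≤ _ := by unfold phi; gcongr

lemma phi_int : Integrable phi := by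
  refine (integrable_inv_one_add_sq.const_mul 2).mono' phi_cont.aestronglyMeasurable (ae_of_all _ fun v => ?_)
  rw [Real.norm_of_nonneg (phi_nonneg v)]
  exact (phi_le v).trans (by rw [div_eq_mul_inv])

lemma La_hat {a : ℝ} (ha : a ≠ 0) : ∫ x : ℝ, e (-(a * x)) * (La x : ℂ) = ((sinc (a / 2) ^ 2 : ℝ):ℂ) := by
  have hac : (a:ℂ) ≠ 0 := by exact_mod_cast ha
  have hsplit : ∫ x : ℝ, e (-(a * x)) * (La x : ℂ) = (∫ x in (-1:ℝ)..0, e (-(a * x)) * (La x : ℂ)) +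
      ∫ x in (0:ℝ)..1, e (-(a * x)) * (La x : ℂ) := by
    have hc : Continuous fun x => e (-(a * x)) * (La x : ℂ) := by fun_prop
    rw [intervalIntegral.integral_add_adjacent_intervals (hc.intervalIntegrable _ _) (hc.intervalIntegrable _ _),
      intervalIntegral.integral_eq_integral_of_support_subset]
    intro u hu
    by_contra h
    apply hu
    have : La u = 0 := by
      unfold La
      rw [max_eq_left]
      rw [mem_Ioc, not_and_or, not_lt, not_le] at h
      rcases h with h | h
      · linarith [neg_abs_le u]
      · linarith [le_abs_self u]
    simp [this]
  have hde : ∀ x : ℝ, HasDerivAt (fun x : ℝ => e (-(a * x))) (-(a * Complex.I) * e (-(a * x))) x := by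
    intro x
    have h1 : HasDerivAt (fun x : ℝ => -(a * x)) (-a) x :=
      ((hasDerivAt_id x).const_mul a).neg.congr_deriv (by ring)
    refine (hasDerivAt_e_comp h1).congr_deriv ?_
    push_cast; ring
  have hof : ∀ x : ℝ, HasDerivAt (fun x : ℝ => (x:ℂ)) 1 x := fun x => Complex.ofRealCLM.hasDerivAt
  have hI : Complex.I ^ 2 = -1 := Complex.I_sq
  have e1 : ∫ x in (0:ℝ)..1, e (-(a * x)) * (La x : ℂ) = -e (-a) / a ^ 2 - Complex.I / a + 1 / a ^ 2 := by
    have hd : ∀ x : ℝ, HasDerivAt (fun x : ℝ => (1 - (x:ℂ)) * (Complex.I / a) * e (-(a * x)) - e (-(a * x)) / a ^ 2)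
        (e (-(a * x)) * (1 - (x:ℂ))) x := by
      intro x
      refine (((((hasDerivAt_const x (1:ℂ)).sub (hof x)).mul_const (Complex.I / a)).mul (hde x)).sub
        ((hde x).div_const _)).congr_deriv ?_
      simp only [Pi.sub_apply, Pi.add_apply]
      field_simp
      linear_combination (-e (-(a * x)) * a * (1 - x)) * hI
    rw [intervalIntegral.integral_congr (g := fun x : ℝ => e (-(a * x)) * (1 - (x:ℂ)))]
    · rw [intervalIntegral.integral_eq_sub_of_hasDerivAt (fun x _ => hd x)
        (Continuous.intervalIntegrable (by fun_prop) _ _)]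
      simp [e_zero]; ring
    · intro x hx
      rw [uIcc_of_le zero_le_one, mem_Icc] at hx
      simp only [La]
      rw [abs_of_nonneg hx.1, max_eq_right (by linarith [hx.2])]
      push_cast; ring
  have e2 : ∫ x in (-1:ℝ)..0, e (-(a * x)) * (La x : ℂ) = -e a / a ^ 2 + Complex.I / a + 1 / a ^ 2 := by
    have hd : ∀ x : ℝ, HasDerivAt (fun x : ℝ => (1 + (x:ℂ)) * (Complex.I / a) * e (-(a * x)) + e (-(a * x)) / a ^ 2)
        (e (-(a * x)) * (1 + (x:ℂ))) x := by
      intro x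
      refine (((((hasDerivAt_const x (1:ℂ)).add (hof x)).mul_const (Complex.I / a)).mul (hde x)).add
        ((hde x).div_const _)).congr_deriv ?_
      simp only [Pi.sub_apply, Pi.add_apply]
      field_simp
      linear_combination (-e (-(a * x)) * a * (1 + x)) * hI
    rw [intervalIntegral.integral_congr (g := fun x : ℝ => e (-(a * x)) * (1 + (x:ℂ)))]
    · rw [intervalIntegral.integral_eq_sub_of_hasDerivAt (fun x _ => hd x)
        (Continuous.intervalIntegrable (by fun_prop) _ _)]
      simp [e_zero]; ring
    · intro x hx
      rw [uIcc_of_le (by norm_num), mem_Icc] at hx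
      simp only [La]
      rw [abs_of_nonpos hx.2, max_eq_right (by linarith [hx.1])]
      push_cast; ring
  rw [hsplit, e1, e2]
  have hcos : e a + e (-a) = ((2 - 4 * sin (a / 2) ^ 2 : ℝ):ℂ) := by
    have h1 : (2 - 4 * sin (a / 2) ^ 2 : ℝ) = 2 * cos a := by
      have := cos_two_mul (a / 2)
      have h3 := sin_sq_add_cos_sq (a / 2)
      rw [show 2 * (a / 2) = a by ring] at this
      nlinarith
    rw [h1]
    push_cast
    rw [Complex.two_cos, e, e]
    push_cast
    ring_nf
  rw [sinc_of_ne_zero (by positivity)]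
  push_cast at hcos ⊢
  field_simp
  linear_combination -hcos

lemma phi_hat (ξ : ℝ) : ∫ v : ℝ, (phi v : ℂ) * e (v * ξ) = (La ξ : ℂ) := by
  have hLc : Continuous (fun x => (La x : ℂ)) := by fun_prop
  have hLi : Integrable (fun x => (La x : ℂ)) := by
    apply hLc.integrable_of_hasCompactSupport
    apply HasCompactSupport.intro (K := Icc (-1:ℝ) 1) isCompact_Icc
    intro x hx
    rw [mem_Icc, ← abs_le, not_le] at hx
    simp [La, max_eq_left (by linarith : 1 - |x| ≤ 0)]
  have hF : FourierTransform.fourier (fun x => (La x : ℂ)) =ᵐ[volume] fun w : ℝ => ((sinc (π * w) ^ 2 : ℝ):ℂ) := by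
    have h0 : ∀ᵐ w : ℝ, w ∉ ({0} : Set ℝ) := (Set.countable_singleton 0).ae_notMem volume
    filter_upwards [h0] with w hw
    have hw' : w ≠ 0 := hw
    have := La_hat (a := 2 * π * w) (by positivity)
    rw [show 2 * π * w / 2 = π * w by ring] at this
    rw [← this, Real.fourier_real_eq_integral_exp_smul]
    congr 1; ext x
    rw [smul_eq_mul, e]
    congr 2
    push_cast; ring
  have hsc : Continuous (fun w : ℝ => ((sinc (π * w) ^ 2 : ℝ):ℂ)) := by
    have := continuous_sinc
    fun_prop
  have hFi : Integrable (fun w : ℝ => ((sinc (π * w) ^ 2 : ℝ):ℂ)) := by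
    refine (integrable_inv_one_add_sq.const_mul 2).mono' hsc.aestronglyMeasurable (ae_of_all _ fun v => ?_)
    rw [Complex.norm_real, Real.norm_of_nonneg (by positivity), ← div_eq_mul_inv]
    refine (sinc_sq_le _).trans ?_
    have := pi_gt_three
    rw [mul_pow]
    apply div_le_div_of_nonneg_left (by norm_num) (by positivity)
    have : 1 ≤ π ^ 2 := by nlinarith
    nlinarith [sq_nonneg v]
  have hinv := congrFun (hLc.fourierInv_fourier_eq hLi (hFi.congr hF.symm)) ξ
  rw [← hinv, Real.fourierInv_congr_ae hF, Real.fourierInv_eq']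
  have h1 := Measure.integral_comp_mul_left (fun v : ℝ => (phi v : ℂ) * e (v * ξ)) (2 * π)
  rw [abs_of_pos (by positivity)] at h1
  have h2 : ∫ v : ℝ, (phi v : ℂ) * e (v * ξ) = ((2 * π : ℝ):ℂ) * ∫ w : ℝ, (phi (2 * π * w) : ℂ) * e (2 * π * w * ξ) := by
    rw [h1, Complex.real_smul, ← mul_assoc, ← Complex.ofReal_mul, mul_inv_cancel₀ (by positivity)]
    simp
  rw [h2, ← integral_const_mul]
  congr 1; ext w
  rw [smul_eq_mul, phi, show 2 * π * w / 2 = π * w by ring, e]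
  have : (π:ℂ) ≠ 0 := by exact_mod_cast pi_pos.ne'
  push_cast
  simp only [RCLike.inner_apply, conj_trivial]
  push_cast
  field_simp

lemma phi_int_one : ∫ v : ℝ, phi v = 1 := by
  have h := phi_hat 0
  simp only [mul_zero, e_zero, mul_one, La, abs_zero, sub_zero] at h
  rw [max_eq_right zero_le_one, integral_complex_ofReal] at h
  exact_mod_cast h

end HB12

open Real MeasureTheory
namespace HB12
open Filter Topology Set

/-- one term of the off-diagonal sum -/
noncomputable def qq (U t : ℝ) (h n : ℕ) : ℂ := ((1 / h : ℝ):ℂ) * ((al U (n / h) : ℂ) * e (th t (n / h)))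

lemma qq_supp {U t : ℝ} (hU : 1 ≤ U) {h n : ℕ} (hh : 1 ≤ h) (hn : (n:ℝ) ≤ U * h ∨ 4 * U * h ≤ n) : qq U t h n = 0 := by
  have hh0 : (0:ℝ) < h := by exact_mod_cast hh
  rw [qq, al_supp hU (hn.imp (fun h => by rwa [div_le_iff₀ hh0]) (fun h => by rwa [le_div_iff₀ hh0]))]
  simp

lemma qq_norm {U t : ℝ} (hU : 1 ≤ U) (h n : ℕ) : ‖qq U t h n‖ ≤ 1 / h * (BB / U) := by
  rw [qq, norm_mul, norm_mul, norm_e, mul_one, Complex.norm_real, Complex.norm_real, Real.norm_of_nonneg (by positivity)]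
  gcongr
  exact al_le hU

lemma th_step (t : ℝ) {h n : ℕ} (hh : 1 ≤ h) (hn : 1 ≤ n) :
    th t (n / h) - th t ((n + 1 : ℕ) / h) = t * Real.log (1 + h / (n * (n + h + 1))) := by
  have hh0 : (0:ℝ) < h := by exact_mod_cast hh
  have hn0 : (0:ℝ) < n := by exact_mod_cast hn
  rw [th, th, ← mul_sub, ← Real.log_div (by positivity) (by positivity)]
  congr 2
  push_cast
  field_simp
  ring

lemma qq_inner {U T t : ℝ} (hU : 1 ≤ U) (hT : 0 < T) (ht : T / 2 ≤ t) (ht2 : t ≤ 5 * T / 2) {h : ℕ} (hh : 1 ≤ h)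
    (hhT : T / U ^ 2 ≤ h) (M : ℕ) : ‖∑ n ∈ Finset.Ico 1 M, qq U t h n‖ ≤ 26880 * BB * (U / T) := by
  have hB := BB_one
  have hU0 : 0 < U := by linarith
  have ht0 : 0 < t := by linarith
  have hh1 : (1:ℝ) ≤ h := by exact_mod_cast hh
  have hh0 : (0:ℝ) < h := by linarith
  have hUh : 1 ≤ U * h := by nlinarith
  set A := ⌈U * h⌉₊ with hA
  set B' := min M ⌈4 * U * h⌉₊ with hB'
  set B := max A B' with hBd
  have hA1 : U * h ≤ A := Nat.le_ceil _
  have hA0 : 1 ≤ A := by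
    have : (1:ℝ) ≤ A := by linarith
    exact_mod_cast this
  have hBle : B ≤ ⌈4 * U * h⌉₊ := by
    apply max_le _ (min_le_right _ _)
    apply Nat.ceil_mono
    nlinarith
  have hBle2 : (B:ℝ) ≤ 4 * (U * h) + 1 := by
    have h1 : (B:ℝ) ≤ (⌈4 * U * h⌉₊ : ℕ) := by exact_mod_cast hBle
    have := Nat.ceil_lt_add_one (show 0 ≤ 4 * U * h by positivity)
    linarith
  have hres : ∑ n ∈ Finset.Ico 1 M, qq U t h n = ∑ n ∈ Finset.Ico A B, qq U t h n := by
    symm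
    apply Finset.sum_subset
    · intro n hn
      rw [Finset.mem_Ico] at hn ⊢
      omega
    · intro n hn hn2
      rw [Finset.mem_Ico] at hn hn2
      apply qq_supp hU hh
      by_cases h1 : n < A
      · left; exact (Nat.lt_ceil.1 h1).le
      · right; exact Nat.ceil_le.1 (by omega : ⌈4 * U * h⌉₊ ≤ n)
  have amp := amp_al hU
  have key := kl (fun n => 1 / h * al U (n / h)) (fun n => th t (n / h)) A B (le_max_left _ _)
    (12 * BB / (U * h)) (T / (140 * U ^ 2 * h)) (48 * BB / (U * h)) (by positivity) ?_ ?_ ?_ ?_ ?_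
  · rw [hres]
    have e1 : ∀ n : ℕ, ((1 / h * al U (n / h) : ℝ):ℂ) * e (th t (n / h)) = qq U t h n := by
      intro n; rw [qq]; push_cast; ring
    simp_rw [e1] at key
    refine key.trans (le_of_eq ?_)
    field_simp
    ring
  · intro n _ _
    rw [abs_mul, abs_of_pos (by positivity)]
    calc 1 / h * |al U (n / h)| ≤ 1 / h * (12 * BB / U) := by gcongr; exact amp.b0 _
      _ = _ := by field_simp
  · calc ∑ n ∈ Finset.Ico A B, |1 / h * al U ((n + 1 : ℕ) / h) - 1 / h * al U (n / h)|
        ≤ ∑ n ∈ Finset.Ico A B, 12 * BB / (U * h) ^ 2 := by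
          apply Finset.sum_le_sum
          intro n _
          have := Convex.norm_image_sub_le_of_norm_hasDerivWithin_le (f := al U) (f' := al1 U) (s := Set.univ)
            (C := 12 * BB / U ^ 2) (x := n / h) (y := (n + 1 : ℕ) / h) (fun x _ => (amp.hd x).hasDerivWithinAt) (fun x _ => amp.b1 x) convex_univ
            trivial trivial
          have e2 : ‖((n + 1 : ℕ):ℝ) / h - n / h‖ = 1 / h := by
            rw [← sub_div]; push_cast; rw [add_sub_cancel_left, Real.norm_of_nonneg (by positivity)]
          rw [e2, Real.norm_eq_abs] at this
          rw [← mul_sub, abs_mul, abs_of_pos (by positivity : (0:ℝ) < 1 / h)]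
          calc 1 / h * _ ≤ 1 / h * (12 * BB / U ^ 2 * (1 / h)) := by gcongr
            _ = _ := by field_simp
      _ = (B - A : ℕ) * (12 * BB / (U * h) ^ 2) := by rw [Finset.sum_const, Nat.card_Ico, nsmul_eq_mul]
      _ ≤ (4 * (U * h)) * (12 * BB / (U * h) ^ 2) := by
          gcongr
          rw [Nat.cast_sub (le_max_left _ _)]
          linarith
      _ = _ := by field_simp; ring
  · intro n h1 h2
    have hn1 : 1 ≤ n := hA0.trans h1
    have hnr : (A:ℝ) ≤ n := by exact_mod_cast h1
    have hnr2 : (n:ℝ) ≤ B := by exact_mod_cast h2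
    have hn0 : (0:ℝ) < n := by exact_mod_cast hn1
    rw [th_step t hh hn1]
    set x : ℝ := h / (n * (n + h + 1)) with hx
    have hx0 : 0 ≤ x := by positivity
    have hx1 : x ≤ 1 := by
      rw [hx, div_le_one (by positivity)]
      have : (1:ℝ) ≤ n := by exact_mod_cast hn1
      nlinarith
    have hxl : 1 / (35 * U ^ 2 * h) ≤ x := by
      rw [hx, div_le_div_iff₀ (by positivity) (by positivity)]
      have h5 : (n:ℝ) ≤ 5 * (U * h) := by linarith
      have h6 : (n:ℝ) + h + 1 ≤ 7 * (U * h) := by nlinarith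
      calc 1 * (n * (n + h + 1) : ℝ) ≤ 1 * ((5 * (U * h)) * (7 * (U * h))) := by gcongr
        _ = _ := by ring
    have h3 := log_one_add_ge hx0
    have h4 : x / 2 ≤ x / (1 + x) := by gcongr; linarith
    calc T / (140 * U ^ 2 * h) = T / 2 * (1 / (35 * U ^ 2 * h) / 2) := by field_simp; norm_num
      _ ≤ t * Real.log (1 + x) := by gcongr; linarith
  · intro n h1 h2
    have hn1 : 1 ≤ n := hA0.trans h1
    have hnr : (A:ℝ) ≤ n := by exact_mod_cast h1
    have hn0 : (0:ℝ) < n := by exact_mod_cast hn1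
    rw [th_step t hh hn1]
    have h3 := log_one_add_le (x := (h:ℝ) / (n * (n + h + 1))) (by positivity)
    have h4 : (h:ℝ) / (n * (n + h + 1)) ≤ 1 / T := by
      rw [div_le_div_iff₀ (by positivity) hT]
      rw [div_le_iff₀ (by positivity)] at hhT
      have h5 : U * h * (U * h) ≤ n * (n + h + 1) := by
        gcongr <;> linarith
      nlinarith
    calc t * _ ≤ (5 * T / 2) * (1 / T) := mul_le_mul ht2 (by linarith)
          (Real.log_nonneg (le_add_of_nonneg_right (by positivity))) (by positivity)
      _ ≤ 3 := by field_simp; norm_num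
  · intro n h1 h2
    have hn1 : 1 ≤ n := hA0.trans h1
    have hn0 : (0:ℝ) < n := by exact_mod_cast hn1
    rw [th_step t hh hn1, show n + 2 = (n + 1) + 1 by ring, th_step t hh (by omega)]
    have : (h:ℝ) / ((n + 1 : ℕ) * ((n + 1 : ℕ) + h + 1)) ≤ h / (n * (n + h + 1)) := by
      push_cast
      gcongr <;> linarith
    have h0 : (0:ℝ) ≤ (h:ℝ) / ((n + 1 : ℕ) * ((n + 1 : ℕ) + h + 1)) := by positivity
    gcongr

/-- full off-diagonal sum at scale U -/
noncomputable def SS (U t : ℝ) (N : ℕ) : ℂ := ∑ h ∈ Finset.Ico 1 (N + 1), ∑ n ∈ Finset.Ico 1 (N + 1 - h), qq U t h n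

lemma SS_h {U t : ℝ} (hU : 1 ≤ U) {N h : ℕ} (hh : 1 ≤ h) (hN : N / U ≤ h) (M : ℕ) (hM : M ≤ N + 1) :
    ∑ n ∈ Finset.Ico 1 M, qq U t h n = 0 := by
  apply Finset.sum_eq_zero
  intro n hn
  rw [Finset.mem_Ico] at hn
  apply qq_supp hU hh
  left
  rw [div_le_iff₀ (by linarith)] at hN
  have : (n:ℝ) ≤ N := by exact_mod_cast (by omega : n ≤ N)
  linarith

lemma sum_h_le (U : ℝ) (N : ℕ) (f : ℕ → ℂ) {c : ℝ} (hU : 1 ≤ U) (hc : 0 ≤ c) (s : Finset ℕ) (hs : ∀ h ∈ s, 1 ≤ h)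
    (hf : ∀ h ∈ s, ‖f h‖ ≤ c) (hf0 : ∀ h ∈ s, N / U ≤ h → f h = 0) : ‖∑ h ∈ s, f h‖ ≤ c * (N / U) := by
  have h0 : 0 ≤ N / U := by positivity
  rw [← Finset.sum_filter_of_ne (p := fun h : ℕ => (h:ℝ) ≤ N / U)]
  · refine (norm_sum_le_of_le _ (fun h hh => hf h (Finset.mem_filter.1 hh).1)).trans ?_
    rw [Finset.sum_const, nsmul_eq_mul, mul_comm]
    gcongr
    have hsub : s.filter (fun h : ℕ => (h:ℝ) ≤ N / U) ⊆ Finset.Ico 1 (⌊N / U⌋₊ + 1) := by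
      intro h hh
      rw [Finset.mem_filter] at hh
      rw [Finset.mem_Ico]
      exact ⟨hs h hh.1, Nat.lt_succ_of_le (Nat.le_floor hh.2)⟩
    have := Finset.card_le_card hsub
    rw [Nat.card_Ico, Nat.add_sub_cancel] at this
    exact le_trans (by exact_mod_cast this) (Nat.floor_le h0)
  · intro h hh hne
    by_contra hcon
    exact hne (hf0 h hh (not_le.1 hcon).le)

lemma SS_triv {U t : ℝ} (hU : 1 ≤ U) (N : ℕ) : ‖SS U t N‖ ≤ 5 * BB * (N / U) := by
  have hB := BB_one
  have hU0 : 0 < U := by linarith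
  apply sum_h_le U N _ hU (by positivity) _ (fun h hh => (Finset.mem_Ico.1 hh).1)
  · intro h hh
    rw [Finset.mem_Ico] at hh
    have hh1 : (1:ℝ) ≤ h := by exact_mod_cast hh.1
    rw [← Finset.sum_filter_of_ne (p := fun n : ℕ => n < ⌈4 * U * h⌉₊)]
    · refine (norm_sum_le_of_le _ (fun n _ => qq_norm hU h n)).trans ?_
      rw [Finset.sum_const, nsmul_eq_mul]
      have hsub : (Finset.Ico 1 (N + 1 - h)).filter (fun n : ℕ => n < ⌈4 * U * h⌉₊) ⊆ Finset.range ⌈4 * U * h⌉₊ := by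
        intro n hn; rw [Finset.mem_filter] at hn; exact Finset.mem_range.2 hn.2
      have h1 := Finset.card_le_card hsub
      rw [Finset.card_range] at h1
      have h2 := Nat.ceil_lt_add_one (show 0 ≤ 4 * U * h by positivity)
      have h3 : ((Finset.card ((Finset.Ico 1 (N + 1 - h)).filter (fun n : ℕ => n < ⌈4 * U * h⌉₊)) : ℕ):ℝ) ≤ (⌈4 * U * h⌉₊ : ℕ) := by
        exact_mod_cast h1
      calc _ ≤ (5 * (U * h)) * (1 / h * (BB / U)) := by gcongr; nlinarith
        _ = _ := by field_simp
    · intro n hn hne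
      by_contra hcon
      exact hne (qq_supp hU hh.1 (Or.inr (Nat.ceil_le.1 (not_lt.1 hcon))))
  · intro h hh h2
    rw [Finset.mem_Ico] at hh
    exact SS_h hU hh.1 h2 _ (by omega)

lemma SS_le {U t T : ℝ} (hU : 5 ≤ U) (hT : 0 < T) (ht : T / 2 ≤ t) (ht2 : t ≤ 5 * T / 2) {N : ℕ} (hN : T ≤ N)
    (hN2 : (N:ℝ) ≤ 2 * T) : ‖SS U t N‖ ≤ ‖MU U T N t‖ + 53760 * BB := by
  have hB := BB_one
  have hU0 : 0 < U := by linarith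
  have hU1 : 1 ≤ U := by linarith
  have hκ : 0 ≤ T / U ^ 2 := by positivity
  have hKle : (KK U T : ℝ) ≤ T / U ^ 2 := Nat.floor_le hκ
  have hKN : KK U T ≤ N := by
    have : (KK U T : ℝ) ≤ N := by
      refine hKle.trans (le_trans ?_ hN)
      rw [div_le_iff₀ (by positivity)]
      have : 1 ≤ U ^ 2 := by nlinarith
      nlinarith
    exact_mod_cast this
  have hsplit : SS U t N = MU U T N t + ∑ h ∈ Finset.Ico (KK U T + 1) (N + 1), ∑ n ∈ Finset.Ico 1 (N + 1 - h), qq U t h n := by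
    rw [SS, ← Finset.sum_Ico_consecutive _ (by omega : 1 ≤ KK U T + 1) (by omega : KK U T + 1 ≤ N + 1)]
    congr 1
    rw [MU]
    apply Finset.sum_congr rfl
    intro h hh
    rw [Finset.mem_Ico] at hh
    apply Finset.sum_subset
    · intro n hn; rw [Finset.mem_Ico] at hn ⊢; omega
    · intro n hn hn2
      rw [Finset.mem_Ico] at hn hn2
      apply qq_supp hU1 hh.1
      right
      have h1 : (N:ℝ) + 1 ≤ n + h := by exact_mod_cast (by omega : N + 1 ≤ n + h)
      have h2 : (h:ℝ) ≤ T / U ^ 2 := le_trans (by exact_mod_cast (by omega : h ≤ KK U T)) hKle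
      have h3 : (4 * U + 1) * h ≤ T := by
        calc (4 * U + 1) * h ≤ (4 * U + 1) * (T / U ^ 2) := by gcongr
          _ ≤ T := by
            rw [mul_div_assoc', div_le_iff₀ (by positivity)]
            have : 4 * U + 1 ≤ U ^ 2 := by nlinarith
            nlinarith
      linarith
  rw [hsplit]
  refine (norm_add_le _ _).trans ?_
  gcongr
  refine (sum_h_le U N _ hU1 (c := 26880 * BB * (U / T)) (by positivity) _ ?_ ?_ ?_).trans ?_
  · intro h hh; rw [Finset.mem_Ico] at hh; omega
  · intro h hh
    rw [Finset.mem_Ico] at hh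
    exact qq_inner hU1 hT ht ht2 (by omega) (Nat.lt_of_floor_lt (by rw [KK] at hh; omega)).le _
  · intro h hh h2
    rw [Finset.mem_Ico] at hh
    exact SS_h hU1 (by omega) h2 _ (by omega)
  · calc 26880 * BB * (U / T) * (N / U) ≤ 26880 * BB * (U / T) * (2 * T / U) := by gcongr
      _ = _ := by field_simp; norm_num

end HB12

open Real MeasureTheory
namespace HB12
open Filter Topology Set

lemma norm_sum_sq (z : ℕ → ℂ) (N : ℕ) : ‖∑ n ∈ Finset.Ico 1 (N + 1), z n‖ ^ 2 = ∑ n ∈ Finset.Ico 1 (N + 1), ‖z n‖ ^ 2 +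
    2 * ∑ h ∈ Finset.Ico 1 (N + 1), ∑ n ∈ Finset.Ico 1 (N + 1 - h), ((starRingEnd ℂ) (z n) * z (n + h)).re := by
  induction N with
  | zero => simp
  | succ N ih =>
    have key : ∀ f : ℕ → ℕ → ℝ, ∑ h ∈ Finset.Ico 1 (N + 2), ∑ n ∈ Finset.Ico 1 (N + 2 - h), f n (n + h) =
        ∑ h ∈ Finset.Ico 1 (N + 1), ∑ n ∈ Finset.Ico 1 (N + 1 - h), f n (n + h) + ∑ n ∈ Finset.Ico 1 (N + 1), f n (N + 1) := by
      intro f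
      rw [Finset.sum_Ico_succ_top (by omega : 1 ≤ N + 1)]
      have h1 : ∑ n ∈ Finset.Ico 1 (N + 2 - (N + 1)), f n (n + (N + 1)) = 0 := by
        rw [show N + 2 - (N + 1) = 1 by omega]; simp
      have h2 := Finset.sum_Ico_reflect (fun n => f n (N + 1)) 1 (m := N + 1) (n := N + 1) (by omega)
      rw [show N + 1 + 1 - (N + 1) = 1 by omega, show N + 1 + 1 - 1 = N + 1 by omega] at h2
      rw [h1, add_zero, ← h2, ← Finset.sum_add_distrib]
      apply Finset.sum_congr rfl
      intro h hh
      rw [Finset.mem_Ico] at hh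
      rw [show N + 2 - h = (N + 1 - h) + 1 by omega, Finset.sum_Ico_succ_top (by omega : 1 ≤ N + 1 - h),
        show N + 1 - h + h = N + 1 by omega]
    rw [key (fun n m => ((starRingEnd ℂ) (z n) * z m).re), Finset.sum_Ico_succ_top (by omega : 1 ≤ N + 1), Finset.sum_Ico_succ_top (by omega : 1 ≤ N + 1)]
    rw [← Complex.re_sum, ← Finset.sum_mul, ← map_sum]
    set S := ∑ n ∈ Finset.Ico 1 (N + 1), z n
    have : ‖S + z (N + 1)‖ ^ 2 = ‖S‖ ^ 2 + ‖z (N + 1)‖ ^ 2 + 2 * ((starRingEnd ℂ) S * z (N + 1)).re := by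
      simp only [Complex.sq_norm, Complex.normSq_apply, Complex.add_re, Complex.add_im, Complex.mul_re, Complex.conj_re, Complex.conj_im]
      ring
    rw [this, ih]
    ring

lemma e_re (x : ℝ) : (e x).re = cos x := by
  rw [e, mul_comm, Complex.exp_ofReal_mul_I_re]

lemma DD_sq (N : ℕ) (t : ℝ) : ‖DD N t‖ ^ 2 = ∑ n ∈ Finset.Ico 1 (N + 1), (1:ℝ) / n +
    ∑ h ∈ Finset.Ico 1 (N + 1), ∑ n ∈ Finset.Ico 1 (N + 1 - h), (2 * (1 / h * pp (n / h))) * cos (th t (n / h)) := by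
  rw [DD, norm_sum_sq, Finset.mul_sum]
  congr 1
  · apply Finset.sum_congr rfl
    intro n hn
    rw [norm_mul, norm_e, mul_one, Complex.norm_real, Real.norm_of_nonneg (by positivity), div_pow, one_pow, Real.sq_sqrt (by positivity)]
  · apply Finset.sum_congr rfl
    intro h hh
    rw [Finset.mul_sum]
    apply Finset.sum_congr rfl
    intro n hn
    rw [Finset.mem_Ico] at hh hn
    have hh0 : (0:ℝ) < h := by exact_mod_cast hh.1
    have hn0 : (0:ℝ) < n := by exact_mod_cast hn.1
    have e1 : (starRingEnd ℂ) (((1 / √(n:ℝ) : ℝ):ℂ) * e (-(t * Real.log n))) * (((1 / √((n + h : ℕ):ℝ) : ℝ):ℂ) * e (-(t * Real.log (n + h : ℕ))))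
        = ((1 / √(n:ℝ) * (1 / √((n + h : ℕ):ℝ)) : ℝ):ℂ) * e (-(th t (n / h))) := by
      have : -(th t (n / h)) = t * Real.log n + -(t * Real.log (n + h : ℕ)) := by
        rw [th, show 1 + 1 / ((n:ℝ) / h) = (n + h : ℕ) / n by push_cast; field_simp, Real.log_div (by push_cast; positivity) (by positivity)]
        ring
      rw [this, e_add, map_mul, conj_e, neg_neg, Complex.conj_ofReal]
      push_cast
      ring
    rw [e1, Complex.re_ofReal_mul, e_re, cos_neg, ← mul_assoc]
    congr 2
    rw [pp, one_div, one_div, ← mul_inv, ← Real.sqrt_mul (by positivity), one_div, ← mul_inv]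
    congr 1
    rw [← Real.sqrt_sq hh0.le, ← Real.sqrt_mul (by positivity), Real.sqrt_sq hh0.le]
    congr 1
    push_cast
    field_simp

noncomputable def WW (N : ℕ) (G t0 : ℝ) : ℝ := ∫ v : ℝ, phi v * ‖DD N (t0 + G * v)‖ ^ 2

lemma phi_mul_int {f : ℝ → ℝ} (hf : Continuous f) {C : ℝ} (hb : ∀ v, |f v| ≤ C) : Integrable (fun v => phi v * f v) := by
  refine (phi_int.mul_const C).mono' (phi_cont.mul hf).aestronglyMeasurable (ae_of_all _ fun v => ?_)
  rw [norm_mul, Real.norm_of_nonneg (phi_nonneg v)]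
  exact mul_le_mul_of_nonneg_left (hb v) (phi_nonneg v)

lemma th_cont (t0 G u : ℝ) : Continuous fun v : ℝ => th (t0 + G * v) u := by unfold th; fun_prop

lemma cos_int (t0 G u : ℝ) : Integrable (fun v => phi v * cos (th (t0 + G * v) u)) :=
  phi_mul_int (continuous_cos.comp (th_cont t0 G u)) (fun _ => abs_cos_le_one _)

lemma cos_int_zero {G u : ℝ} (hG : 2 ≤ G) (hu : 0 < u) (hu2 : u ≤ G / 2) (t0 : ℝ) :
    ∫ v : ℝ, phi v * cos (th (t0 + G * v) u) = 0 := by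
  set b := Real.log (1 + 1 / u) with hb
  have h1 : ∀ v : ℝ, phi v * cos (th (t0 + G * v) u) = (e (t0 * b) * ((phi v : ℂ) * e (v * (G * b)))).re := by
    intro v
    have : e (t0 * b) * ((phi v : ℂ) * e (v * (G * b))) = (phi v : ℂ) * e (th (t0 + G * v) u) := by
      rw [th, ← hb, show (t0 + G * v) * b = t0 * b + v * (G * b) by ring, e_add]; ring
    rw [this, Complex.re_ofReal_mul, e_re]
  simp_rw [h1]
  have hi : Integrable (fun v : ℝ => e (t0 * b) * ((phi v : ℂ) * e (v * (G * b)))) := by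
    apply Integrable.const_mul
    refine phi_int.mono' (by fun_prop) (ae_of_all _ fun v => ?_)
    rw [norm_mul, norm_e, mul_one, Complex.norm_real, Real.norm_of_nonneg (phi_nonneg v)]
  have h2 : ∫ v : ℝ, (e (t0 * b) * ((phi v : ℂ) * e (v * (G * b)))).re =
      (∫ v : ℝ, e (t0 * b) * ((phi v : ℂ) * e (v * (G * b)))).re := integral_re hi
  rw [h2, integral_const_mul, phi_hat]
  have hb1 : 1 ≤ G * b := by
    have h3 := log_one_add_ge (x := 1 / u) (by positivity)
    have h4 : 1 / u / (1 + 1 / u) = 1 / (u + 1) := by field_simp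
    rw [h4] at h3
    have h5 : 1 / G ≤ 1 / (u + 1) := by gcongr; linarith
    have h6 : 1 / G ≤ b := h5.trans h3
    rw [div_le_iff₀ (by linarith)] at h6
    linarith
  have : La (G * b) = 0 := by
    rw [La, max_eq_left]
    linarith [le_abs_self (G * b)]
  rw [this]; simp

lemma int_cos_sum (t0 G c0 : ℝ) (N : ℕ) (a : ℕ → ℕ → ℝ) :
    Integrable (fun v => phi v * (c0 + ∑ h ∈ Finset.Ico 1 (N + 1), ∑ n ∈ Finset.Ico 1 (N + 1 - h), a h n * cos (th (t0 + G * v) (n / h)))) ∧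
    ∫ v : ℝ, phi v * (c0 + ∑ h ∈ Finset.Ico 1 (N + 1), ∑ n ∈ Finset.Ico 1 (N + 1 - h), a h n * cos (th (t0 + G * v) (n / h))) =
    c0 + ∑ h ∈ Finset.Ico 1 (N + 1), ∑ n ∈ Finset.Ico 1 (N + 1 - h), a h n * ∫ v : ℝ, phi v * cos (th (t0 + G * v) (n / h)) := by
  have e1 : ∀ v, phi v * (c0 + ∑ h ∈ Finset.Ico 1 (N + 1), ∑ n ∈ Finset.Ico 1 (N + 1 - h), a h n * cos (th (t0 + G * v) (n / h))) =
      phi v * c0 + ∑ h ∈ Finset.Ico 1 (N + 1), ∑ n ∈ Finset.Ico 1 (N + 1 - h), a h n * (phi v * cos (th (t0 + G * v) (n / h))) := by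
    intro v
    rw [mul_add, Finset.mul_sum]
    congr 1
    refine Finset.sum_congr rfl fun h _ => ?_
    rw [Finset.mul_sum]
    exact Finset.sum_congr rfl fun n _ => by ring
  have i1 : ∀ h n : ℕ, Integrable (fun v => a h n * (phi v * cos (th (t0 + G * v) (n / h)))) := fun h n => (cos_int t0 G _).const_mul _
  have i2 : ∀ h ∈ Finset.Ico 1 (N + 1), Integrable (fun v => ∑ n ∈ Finset.Ico 1 (N + 1 - h), a h n * (phi v * cos (th (t0 + G * v) (n / h)))) :=
    fun h _ => integrable_finsetSum _ fun n _ => i1 h n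
  have i3 := integrable_finsetSum (Finset.Ico 1 (N + 1)) i2
  simp_rw [e1]
  refine ⟨(phi_int.mul_const c0).add i3, ?_⟩
  rw [integral_add (phi_int.mul_const c0) i3, integral_mul_const, phi_int_one, one_mul, integral_finsetSum _ i2]
  congr 1
  refine Finset.sum_congr rfl fun h hh => ?_
  rw [integral_finsetSum _ fun n _ => i1 h n]
  exact Finset.sum_congr rfl fun n _ => integral_const_mul _ _

lemma SS_sum_re (t G : ℝ) (N m : ℕ) : 2 * ∑ i ∈ Finset.range m, (SS (2 ^ i * (G / 4)) t N).re =
    ∑ h ∈ Finset.Ico 1 (N + 1), ∑ n ∈ Finset.Ico 1 (N + 1 - h),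
      (2 * ((∑ i ∈ Finset.range m, bt (n / h / (2 ^ i * (G / 4)))) * (1 / h * pp (n / h)))) * cos (th t (n / h)) := by
  simp only [SS, Complex.re_sum]
  rw [Finset.sum_comm, Finset.mul_sum]
  refine Finset.sum_congr rfl fun h _ => ?_
  rw [Finset.sum_comm, Finset.mul_sum]
  refine Finset.sum_congr rfl fun n _ => ?_
  rw [Finset.mul_sum, Finset.sum_mul, Finset.mul_sum, Finset.sum_mul]
  refine Finset.sum_congr rfl fun i _ => ?_
  rw [qq, ← mul_assoc, ← Complex.ofReal_mul, Complex.re_ofReal_mul, e_re, al]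
  ring

lemma WW_eq {G : ℝ} (hG : 2 ≤ G) (t0 : ℝ) {N m : ℕ} (hm : (N:ℝ) ≤ 2 ^ m * (G / 4)) :
    Integrable (fun v => phi v * (∑ n ∈ Finset.Ico 1 (N + 1), (1:ℝ) / n + 2 * ∑ i ∈ Finset.range m, (SS (2 ^ i * (G / 4)) (t0 + G * v) N).re)) ∧
    WW N G t0 = ∫ v : ℝ, phi v * (∑ n ∈ Finset.Ico 1 (N + 1), (1:ℝ) / n + 2 * ∑ i ∈ Finset.range m, (SS (2 ^ i * (G / 4)) (t0 + G * v) N).re) := by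
  simp_rw [WW, DD_sq, SS_sum_re]
  refine ⟨(int_cos_sum _ _ _ _ _).1, ?_⟩
  rw [(int_cos_sum _ _ _ _ _).2, (int_cos_sum _ _ _ _ _).2]
  congr 1
  refine Finset.sum_congr rfl fun h hh => Finset.sum_congr rfl fun n hn => ?_
  rw [Finset.mem_Ico] at hh hn
  have hh1 : (1:ℝ) ≤ h := by exact_mod_cast hh.1
  have hn0 : (0:ℝ) < n := by exact_mod_cast hn.1
  by_cases hu : (n:ℝ) / h ≤ G / 2
  · rw [cos_int_zero hG (by positivity) hu]; simp
  · rw [bt_partition (by linarith) (by linarith) ?_, one_mul]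
    refine le_trans ?_ hm
    calc (n:ℝ) / h ≤ n := div_le_self hn0.le hh1
      _ ≤ N := by exact_mod_cast (by omega : n ≤ N)

lemma cauchy_int {X : ℝ} (hX : 0 < X) : Integrable (fun v : ℝ => 4 / (X ^ 2 + v ^ 2)) ∧ ∫ v : ℝ, 4 / (X ^ 2 + v ^ 2) = 4 * π / X := by
  have e1 : ∀ v : ℝ, 4 / (X ^ 2 + v ^ 2) = 4 / X ^ 2 * (1 + (v / X) ^ 2)⁻¹ := by
    intro v; field_simp
  simp_rw [e1]
  refine ⟨(integrable_inv_one_add_sq.comp_div hX.ne').const_mul _, ?_⟩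
  rw [integral_const_mul, Measure.integral_comp_div (fun v : ℝ => (1 + v ^ 2)⁻¹), integral_univ_inv_one_add_sq, abs_of_pos hX, smul_eq_mul]
  field_simp

lemma W_sum {G T Y : ℝ} (hG : 20 ≤ G) (hT : 0 < T) {N m : ℕ} (hN : T ≤ N) (hN2 : (N:ℝ) ≤ 2 * T)
    (hm : (N:ℝ) ≤ 2 ^ m * (G / 4)) (R : Finset ℝ) (hR : ∀ r ∈ R, T ≤ r ∧ r ≤ 2 * T)
    (hY : ∀ s, |s| ≤ T / 4 → ∑ r ∈ R, ∑ i ∈ Finset.range m, ‖MU (2 ^ i * (G / 4)) T N (r + s)‖ ≤ Y) :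
    ∑ r ∈ R, WW N G r ≤ R.card * (1 + Real.log N + 111720 * BB * m) + 2 * Y := by
  have hB := BB_one
  set X := T / (4 * G) with hX
  have hX0 : 0 < X := by positivity
  have hY0 : 0 ≤ Y := le_trans (Finset.sum_nonneg fun _ _ => Finset.sum_nonneg fun _ _ => norm_nonneg _) (hY 0 (by simp; positivity))
  obtain ⟨ic, vc⟩ := cauchy_int hX0
  set H := ∑ n ∈ Finset.Ico 1 (N + 1), (1:ℝ) / n with hH
  set q := (40 * BB * (T / G)) with hq
  have hpt : ∀ v : ℝ, ∑ r ∈ R, phi v * (H + 2 * ∑ i ∈ Finset.range m, (SS (2 ^ i * (G / 4)) (r + G * v) N).re) ≤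
      phi v * (R.card * H + 2 * (Y + R.card * m * (53760 * BB))) + 2 * (R.card * m * q) * (4 / (X ^ 2 + v ^ 2)) := by
    intro v
    have hp := phi_nonneg v
    have hU : ∀ i : ℕ, 5 ≤ 2 ^ i * (G / 4) ∧ G / 4 ≤ 2 ^ i * (G / 4) := fun i => by
      have : (1:ℝ) ≤ 2 ^ i := one_le_pow₀ (by norm_num)
      constructor <;> nlinarith
    have e1 : ∑ r ∈ R, phi v * (H + 2 * ∑ i ∈ Finset.range m, (SS (2 ^ i * (G / 4)) (r + G * v) N).re) =
        phi v * (R.card * H) + 2 * (phi v * ∑ r ∈ R, ∑ i ∈ Finset.range m, (SS (2 ^ i * (G / 4)) (r + G * v) N).re) := by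
      rw [← Finset.mul_sum, Finset.sum_add_distrib, Finset.sum_const, nsmul_eq_mul, ← Finset.mul_sum]; ring
    have key : phi v * ∑ r ∈ R, ∑ i ∈ Finset.range m, (SS (2 ^ i * (G / 4)) (r + G * v) N).re ≤
        phi v * (Y + R.card * m * (53760 * BB)) + (R.card * m * q) * (4 / (X ^ 2 + v ^ 2)) := by
      by_cases hv : |v| ≤ X
      · have hGv : |G * v| ≤ T / 4 := by
          rw [abs_mul, abs_of_pos (by linarith : 0 < G)]
          calc G * |v| ≤ G * X := by gcongr
            _ = T / 4 := by rw [hX]; field_simp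
        have h1 : ∑ r ∈ R, ∑ i ∈ Finset.range m, (SS (2 ^ i * (G / 4)) (r + G * v) N).re ≤ Y + R.card * m * (53760 * BB) := by
          calc _ ≤ ∑ r ∈ R, ∑ i ∈ Finset.range m, (‖MU (2 ^ i * (G / 4)) T N (r + G * v)‖ + 53760 * BB) := by
                apply Finset.sum_le_sum; intro r hr
                apply Finset.sum_le_sum; intro i _
                have hab := abs_le.1 hGv
                exact (Complex.re_le_norm _).trans (SS_le (hU i).1 hT (by linarith [hR r hr]) (by linarith [hR r hr]) hN hN2)
            _ = ∑ r ∈ R, ∑ i ∈ Finset.range m, ‖MU (2 ^ i * (G / 4)) T N (r + G * v)‖ + R.card * m * (53760 * BB) := by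
                simp only [Finset.sum_add_distrib, Finset.sum_const, nsmul_eq_mul, Finset.card_range]; ring
            _ ≤ _ := by gcongr; exact hY _ hGv
        have h2 : 0 ≤ (R.card * m * q) * (4 / (X ^ 2 + v ^ 2)) := by positivity
        nlinarith [mul_le_mul_of_nonneg_left h1 hp]
      · push Not at hv
        have h1 : ∑ r ∈ R, ∑ i ∈ Finset.range m, (SS (2 ^ i * (G / 4)) (r + G * v) N).re ≤ R.card * m * q := by
          calc _ ≤ ∑ r ∈ R, ∑ i ∈ Finset.range m, q := by
                apply Finset.sum_le_sum; intro r hr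
                apply Finset.sum_le_sum; intro i _
                refine (Complex.re_le_norm _).trans ((SS_triv (by linarith [(hU i).1]) N).trans ?_)
                calc 5 * BB * (N / (2 ^ i * (G / 4))) ≤ 5 * BB * (2 * T / (G / 4)) := by gcongr; exact (hU i).2
                  _ = q := by rw [hq]; field_simp; norm_num
            _ = _ := by simp only [Finset.sum_const, nsmul_eq_mul, Finset.card_range]; ring
        have h2 : phi v ≤ 4 / (X ^ 2 + v ^ 2) := by
          refine (phi_le v).trans ?_
          have : X ^ 2 ≤ v ^ 2 := by rw [← sq_abs v]; gcongr
          rw [div_le_div_iff₀ (by positivity) (by positivity)]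
          nlinarith
        have h3 : 0 ≤ phi v * (Y + R.card * m * (53760 * BB)) := by positivity
        calc _ ≤ phi v * (R.card * m * q) := by gcongr
          _ ≤ (4 / (X ^ 2 + v ^ 2)) * (R.card * m * q) := by gcongr
          _ ≤ _ := by linarith
    rw [e1]
    linarith
  have h1 : ∑ r ∈ R, WW N G r = ∫ v : ℝ, ∑ r ∈ R, phi v * (H + 2 * ∑ i ∈ Finset.range m, (SS (2 ^ i * (G / 4)) (r + G * v) N).re) := by
    rw [integral_finsetSum _ fun r _ => (WW_eq (by linarith) r hm).1]
    exact Finset.sum_congr rfl fun r _ => (WW_eq (by linarith) r hm).2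
  have h2 := integral_mono (integrable_finsetSum R fun r _ => (WW_eq (by linarith) r hm).1)
    ((phi_int.mul_const _).add (ic.const_mul _)) hpt
  simp only [Pi.add_apply] at h2
  rw [← h1, integral_add (phi_int.mul_const _) (ic.const_mul _), integral_mul_const, integral_const_mul, phi_int_one, vc] at h2
  have hH2 : H ≤ 1 + Real.log N := harm N
  have hpi := pi_lt_d2
  have h3 : q * (4 * π / X) ≤ 2100 * BB := by
    have : q * (4 * π / X) = 640 * BB * π := by rw [hq, hX]; field_simp; norm_num
    rw [this]; nlinarith
  have h4 : 2 * (R.card * m * q) * (4 * π / X) ≤ 2 * (R.card * m) * (2100 * BB) := by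
    calc _ = 2 * (R.card * m) * (q * (4 * π / X)) := by ring
      _ ≤ _ := by gcongr
  have h5 : (R.card:ℝ) * H ≤ R.card * (1 + Real.log N) := by gcongr
  linarith

end HB12

open Real MeasureTheory
namespace HB12
open Filter Topology Set

lemma lv_arith {T G L U x R B S : ℝ} (hT : 0 < T) (hG : 0 < G) (hL : 0 < L) (hx : 0 < x) (hx4 : x ≤ 4) (hU : U = G / x)
    (hGL : L ^ 2 ≤ G) (hR : 0 ≤ R) (hS : S ≤ 2 * G ^ 2 / (x * L)) :
    4 * (T / U ^ 2) * (3 * L) ^ 3 * (3 * (9 * (12 * B) ^ 2 *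
      (412 * R * (3 * L) / G + R ^ 2 * (8000 * U * (3 * L) / T + 18000 * S / T)))) ≤
      160000000000 * B ^ 2 * (x / 4) * (L ^ 4 * (R * T / G ^ 3) + (R * L) ^ 2) := by
  subst hU
  have e1 : 4 * (T / (G / x) ^ 2) * (3 * L) ^ 3 * (3 * (9 * (12 * B) ^ 2 *
      (412 * R * (3 * L) / G + R ^ 2 * (8000 * (G / x) * (3 * L) / T + 18000 * S / T)))) =
      419904 * B ^ 2 * (1236 * (L ^ 4 * (R * T / G ^ 3)) * (x * x) + R ^ 2 * x * (24000 * (L ^ 4 / G)) + R ^ 2 * (18000 * L ^ 3 * x ^ 2 / G ^ 2) * S) := by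
    field_simp; ring
  rw [e1]
  set Q := L ^ 4 * (R * T / G ^ 3) with hQ
  have hQ0 : 0 ≤ Q := by positivity
  have h1 : L ^ 4 / G ≤ L ^ 2 := by
    rw [div_le_iff₀ hG]
    nlinarith [mul_le_mul_of_nonneg_left hGL (sq_nonneg L)]
  have h2 : R ^ 2 * (18000 * L ^ 3 * x ^ 2 / G ^ 2) * S ≤ R ^ 2 * x * (36000 * L ^ 2) := by
    calc _ ≤ R ^ 2 * (18000 * L ^ 3 * x ^ 2 / G ^ 2) * (2 * G ^ 2 / (x * L)) := by gcongr
      _ = _ := by field_simp; ring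
  have h3 : R ^ 2 * x * (24000 * (L ^ 4 / G)) ≤ R ^ 2 * x * (24000 * L ^ 2) := by gcongr
  have h4 : 1236 * Q * (x * x) ≤ 1236 * Q * (4 * x) := by gcongr
  calc _ ≤ 419904 * B ^ 2 * (1236 * Q * (4 * x) + R ^ 2 * x * (24000 * L ^ 2) + R ^ 2 * x * (36000 * L ^ 2)) := by gcongr
    _ = B ^ 2 * x * (419904 * 4944 * Q + 419904 * 60000 * (R * L) ^ 2) := by ring
    _ ≤ B ^ 2 * x * (40000000000 * Q + 40000000000 * (R * L) ^ 2) := by gcongr <;> norm_num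
    _ = _ := by ring

lemma MU_scale {T G L : ℝ} (hT : 5 ≤ T) (hL : L = Real.log T) (hL1 : 1 ≤ L) (hG : 20 ≤ G) (hGL : L ^ 2 ≤ G) (hGT : G ≤ T) {N : ℕ} (hN : T ≤ N)
    {R : Finset ℝ} (hR : ∀ r ∈ R, T / 2 ≤ r) (hR2 : ∀ r ∈ R, r ≤ 5 * T / 2)
    (hsp : ∀ r ∈ R, ∀ s ∈ R, r ≠ s → G ≤ |r - s|) (hT0 : ∀ r ∈ R, ∀ s ∈ R, |r - s| ≤ G ^ 3 / L ^ 2) (i : ℕ) :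
    ∑ r ∈ R, ‖MU (2 ^ i * (G / 4)) T N r‖ ≤ 500000 * BB * (√2)⁻¹ ^ i * (R.card * L + L ^ 2 * √(R.card * T / G ^ 3)) := by
  have hB := BB_one
  have hL0 : 0 < L := by linarith
  have h2i : (1:ℝ) ≤ 2 ^ i := one_le_pow₀ (by norm_num)
  set U := 2 ^ i * (G / 4) with hU
  have hGU : G / 4 ≤ U := by rw [hU]; nlinarith
  have hU1 : 1 ≤ U := by linarith
  set ρ := (√2)⁻¹ ^ i with hρ
  have hρ2 : ρ ^ 2 = (2 ^ i)⁻¹ := by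
    rw [hρ, ← pow_mul, mul_comm, pow_mul, inv_pow, Real.sq_sqrt (by norm_num), inv_pow]
  have hρ0 : 0 < ρ := by positivity
  have hρ1 : ρ ≤ 1 := by
    rw [← sq_le_one_iff₀ hρ0.le, hρ2]; exact inv_le_one_of_one_le₀ h2i
  by_cases hUT : U ^ 2 ≤ T
  · have hUT1 : U ≤ T := by nlinarith
    have hlog : ∀ k : ℕ, (k:ℝ) ≤ T ^ 2 → 1 + Real.log k ≤ 3 * L := by
      intro k hk
      rcases Nat.eq_zero_or_pos k with h | h
      · subst h; simp; linarith
      · have h1 := Real.log_le_log (by exact_mod_cast h) hk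
        rw [Real.log_pow, ← hL] at h1
        push_cast at h1
        linarith
    have key := lv (N := N) (T0 := G ^ 3 / L ^ 2) (ℓ := 3 * L) hU1 hUT ?_ (by linarith : 0 < G) hGU hR hR2 hsp hT0 ?_ ?_ ?_
    · refine key.trans ?_
      set P := L ^ 2 * √(R.card * T / G ^ 3) with hP
      have hP2 : P ^ 2 = L ^ 4 * (R.card * T / G ^ 3) := by
        rw [hP, mul_pow, Real.sq_sqrt (by positivity)]; ring
      have hP0 : 0 ≤ P := by positivity
      have hs : √(4 * (T / U ^ 2) * (3 * L) ^ 3 * (3 * (9 * (12 * BB) ^ 2 *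
          (412 * R.card * (3 * L) / G + R.card ^ 2 * (8000 * U * (3 * L) / T + 18000 * √(U * (G ^ 3 / L ^ 2)) / T))))) ≤
          400000 * BB * ρ * (R.card * L + P) := by
        rw [Real.sqrt_le_iff]
        refine ⟨by positivity, ?_⟩
        refine (lv_arith (x := 4 / 2 ^ i) (by linarith) (by linarith) hL0 (by positivity) ?_ ?_ hGL (by positivity) ?_).trans ?_
        · exact div_le_self (by norm_num) h2i
        · rw [hU]; field_simp
        · rw [Real.sqrt_le_iff]
          refine ⟨by positivity, ?_⟩
          have e1 : (2 * G ^ 2 / (4 / 2 ^ i * L)) ^ 2 = G ^ 4 * (2 ^ i) / (4 * L ^ 2) * 2 ^ i := by field_simp; norm_num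
          have e2 : U * (G ^ 3 / L ^ 2) = G ^ 4 * (2 ^ i) / (4 * L ^ 2) := by rw [hU]; field_simp
          rw [e1, e2]
          exact le_mul_of_one_le_right (by positivity) h2i
        · rw [← hP2]
          calc _ = 160000000000 * BB ^ 2 * ρ ^ 2 * (P ^ 2 + (R.card * L) ^ 2) := by rw [hρ2]; field_simp
            _ ≤ 160000000000 * BB ^ 2 * ρ ^ 2 * (R.card * L + P) ^ 2 := by
              gcongr
              have : 0 ≤ (R.card:ℝ) * L * P := by positivity
              nlinarith
            _ = _ := by ring
      have h1 : 354 * BB * R.card / U ≤ 100000 * BB * ρ * (R.card * L + P) := by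
        rw [div_le_iff₀ (by linarith)]
        have hρU : 1 ≤ ρ * U := by
          have : ρ ^ 2 * U = G / 4 := by rw [hρ2, hU]; field_simp
          nlinarith
        have h5 : (R.card:ℝ) ≤ R.card * L + P := by nlinarith [(Nat.cast_nonneg R.card : (0:ℝ) ≤ _)]
        calc 354 * BB * R.card ≤ 100000 * BB * (R.card * L + P) := by gcongr; norm_num
          _ ≤ (100000 * BB * (R.card * L + P)) * (ρ * U) := le_mul_of_one_le_right (by positivity) hρU
          _ = _ := by ring
      linarith
    · refine le_trans ?_ hN
      rw [div_le_iff₀ (by linarith)]; nlinarith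
    · apply hlog
      have := Nat.ceil_lt_add_one (show 0 ≤ 4 * U by positivity)
      nlinarith
    · apply hlog
      refine (Nat.floor_le (by positivity)).trans ?_
      rw [div_div, div_le_iff₀ (by positivity)]
      have : 1 ≤ L ^ 2 := one_le_pow₀ hL1
      calc G ^ 3 = G ^ 2 * (1 * G) := by ring
        _ ≤ T ^ 2 * (L ^ 2 * G) := by gcongr
    · apply hlog
      refine (Nat.floor_le (by positivity)).trans ?_
      rw [div_le_iff₀ (by positivity)]
      have : 1 ≤ U ^ 2 := one_le_pow₀ hU1
      nlinarith
  · have : KK U T = 0 := by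
      rw [KK, Nat.floor_eq_zero, div_lt_one (by positivity)]
      exact not_le.1 hUT
    simp only [MU, this]
    simp
    positivity

lemma geom_le (m : ℕ) : ∑ i ∈ Finset.range m, (√2)⁻¹ ^ i ≤ 4 := by
  have h0 : (√2)⁻¹ ≤ 3 / 4 := by
    rw [inv_le_comm₀ (by positivity) (by norm_num)]
    apply Real.le_sqrt_of_sq_le; norm_num
  have h1 : ∀ n : ℕ, ∑ i ∈ Finset.range n, ((3:ℝ) / 4) ^ i = 4 - 4 * (3 / 4) ^ n := by
    intro n
    rw [geom_sum_eq (by norm_num)]; ring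
  calc _ ≤ ∑ i ∈ Finset.range m, ((3:ℝ) / 4) ^ i := by gcongr
    _ ≤ 4 := by rw [h1]; have : (0:ℝ) ≤ (3 / 4) ^ m := by positivity
                linarith

/-- threshold constant -/
noncomputable def AA : ℝ := 5000000 * BB

lemma lv_count {T G L : ℝ} (hT : 5 ≤ T) (hL : L = Real.log T) (hL1 : 4 ≤ L) (hG : 20 ≤ G) (hGL : L ^ 2 ≤ G) (hGT : G ≤ T)
    {R : Finset ℝ} (hR : ∀ r ∈ R, T ≤ r ∧ r ≤ 2 * T)
    (hsp : ∀ r ∈ R, ∀ s ∈ R, r ≠ s → G ≤ |r - s|) (hT0 : ∀ r ∈ R, ∀ s ∈ R, |r - s| ≤ G ^ 3 / L ^ 2)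
    (hW : ∀ r ∈ R, AA * L ≤ WW ⌈T⌉₊ G r) : (R.card:ℝ) ≤ 100 * (L ^ 2 * T / G ^ 3) := by
  have hB := BB_one
  set N := ⌈T⌉₊ with hNd
  have hN : T ≤ N := Nat.le_ceil T
  have hN2 : (N:ℝ) ≤ 2 * T := by have := Nat.ceil_lt_add_one (show 0 ≤ T by linarith); linarith
  set m := Nat.clog 2 N with hm
  have hNm : (N:ℝ) ≤ 2 ^ m := by exact_mod_cast Nat.le_pow_clog (by norm_num) N
  have hlogN : Real.log N ≤ 1 + L := by
    have h1 := Real.log_le_log (by linarith) hN2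
    rw [Real.log_mul (by norm_num) (by linarith), ← hL] at h1
    linarith [Real.log_two_lt_d9]
  have hm3 : (m:ℝ) ≤ 3 * L := by
    have hN1 : 1 < N := by
      have : (1:ℝ) < N := by linarith
      exact_mod_cast this
    have h1 : 2 ^ (m - 1) < N := Nat.pow_pred_clog_lt_self (by norm_num) hN1
    have hm1 : 1 ≤ m := Nat.clog_pos (by norm_num) hN1
    have h2 : Real.log (2 ^ (m - 1)) ≤ Real.log N := Real.log_le_log (by positivity) (by exact_mod_cast h1.le)
    rw [Real.log_pow, Nat.cast_sub hm1] at h2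
    push_cast at h2
    have := Real.log_two_gt_d9
    have hm1' : (1:ℝ) ≤ m := by exact_mod_cast hm1
    nlinarith
  set P := L ^ 2 * √(R.card * T / G ^ 3) with hP
  have hP0 : 0 ≤ P := by positivity
  have hWs := W_sum (Y := 2000000 * BB * (R.card * L + P)) hG (by linarith) hN hN2 (by nlinarith : (N:ℝ) ≤ 2 ^ m * (G / 4)) R hR (by
    intro s hs
    rw [Finset.sum_comm]
    have hab := abs_le.1 hs
    have h1 : ∀ i ∈ Finset.range m, ∑ r ∈ R, ‖MU (2 ^ i * (G / 4)) T N (r + s)‖ ≤ 500000 * BB * (√2)⁻¹ ^ i * (R.card * L + P) := by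
      intro i _
      have := MU_scale (R := R.map (addRightEmbedding s)) hT hL (by linarith) hG hGL hGT hN ?_ ?_ ?_ ?_ i
      · rwa [Finset.sum_map, Finset.card_map] at this
      all_goals simp only [Finset.mem_map, addRightEmbedding_apply, forall_exists_index, and_imp, forall_apply_eq_imp_iff₂]
      · intro r hr; linarith [hR r hr]
      · intro r hr; linarith [hR r hr]
      · intro r hr q hq hne
        rw [add_sub_add_right_eq_sub]; exact hsp r hr q hq (fun h => hne (by rw [h]))
      · intro r hr q hq
        rw [add_sub_add_right_eq_sub]; exact hT0 r hr q hq
    refine (Finset.sum_le_sum h1).trans ?_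
    rw [← Finset.sum_mul, ← Finset.mul_sum]
    have := geom_le m
    calc _ ≤ 500000 * BB * 4 * (R.card * L + P) := by gcongr
      _ = _ := by ring)
  have hlow : (R.card:ℝ) * (AA * L) ≤ ∑ r ∈ R, WW N G r := by
    rw [← nsmul_eq_mul]; exact Finset.card_nsmul_le_sum _ _ _ hW
  have hRc : (0:ℝ) ≤ R.card := Nat.cast_nonneg _
  have h1 : (R.card:ℝ) * (1 + Real.log N + 111720 * BB * m) ≤ R.card * (400000 * BB * L) := by
    gcongr
    nlinarith
  have h2 : (R.card:ℝ) * L ≤ 10 * P := by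
    unfold AA at hlow
    have hRL : 0 ≤ (R.card:ℝ) * L := by positivity
    have : BB * (600000 * (R.card * L)) ≤ BB * (4000000 * P) := by linarith
    have := le_of_mul_le_mul_left this (by linarith)
    linarith
  rcases hRc.eq_or_lt with h0 | h0
  · rw [← h0]; positivity
  have h3 : ((R.card:ℝ) * L) ^ 2 ≤ (10 * P) ^ 2 := by gcongr
  have hP2 : P ^ 2 = L ^ 4 * (R.card * T / G ^ 3) := by
    rw [hP, mul_pow, Real.sq_sqrt (by positivity)]; ring
  rw [mul_pow 10 P, hP2] at h3
  have h4 : ((R.card:ℝ) * L ^ 2) * R.card ≤ (R.card * L ^ 2) * (100 * (L ^ 2 * T / G ^ 3)) := by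
    calc _ = (R.card * L) ^ 2 := by ring
      _ ≤ _ := h3
      _ = _ := by ring
  exact le_of_mul_le_mul_left h4 (by positivity)

end HB12

open Real MeasureTheory
namespace HB12
open Filter Topology Set

lemma DD_cont (N : ℕ) : Continuous (DD N) := by
  unfold DD
  apply continuous_finsetSum
  intro n _
  fun_prop

lemma DD_norm (N : ℕ) (t : ℝ) : ‖DD N t‖ ≤ 2 * √N := by
  refine (norm_sum_le _ _).trans ((le_of_eq ?_).trans (sum_inv_sqrt N))
  apply Finset.sum_congr rfl
  intro n _
  rw [norm_mul, norm_e, mul_one, Complex.norm_real, Real.norm_of_nonneg (by positivity)]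

lemma DD_norm2 (N : ℕ) (t : ℝ) : ‖DD N t‖ ^ 2 ≤ 4 * N := by
  have h := DD_norm N t
  calc ‖DD N t‖ ^ 2 ≤ (2 * √N) ^ 2 := by gcongr
    _ = 4 * (N:ℝ) := by rw [mul_pow, Real.sq_sqrt (by positivity)]; norm_num

lemma phi_e_int (c : ℂ) (ξ : ℝ) : Integrable (fun v => (phi v:ℂ) * (c * e (v * ξ))) := by
  have h1 : Integrable (fun v => ((phi v : ℝ):ℂ)) := phi_int.ofReal
  have := h1.mul_bdd (g := fun v => c * e (v * ξ)) (c := ‖c‖) (by fun_prop) (ae_of_all _ fun v => by rw [norm_mul, norm_e, mul_one])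
  exact this

lemma DD_phi (N : ℕ) (t δ : ℝ) : ∫ v, (phi v:ℂ) * DD N (t + v * δ) =
    ∑ n ∈ Finset.Ico 1 (N + 1), ((1 / √(n:ℝ) : ℝ):ℂ) * e (-(t * Real.log n)) * (La (-(δ * Real.log n)) : ℂ) := by
  have h1 : ∀ v, (phi v:ℂ) * DD N (t + v * δ) = ∑ n ∈ Finset.Ico 1 (N + 1),
      (phi v:ℂ) * ((((1 / √(n:ℝ) : ℝ):ℂ) * e (-(t * Real.log n))) * e (v * (-(δ * Real.log n)))) := by
    intro v
    rw [DD, Finset.mul_sum]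
    apply Finset.sum_congr rfl
    intro n _
    rw [show -((t + v * δ) * Real.log n) = -(t * Real.log n) + v * (-(δ * Real.log n)) by ring, e_add]
    ring
  simp only [h1]
  rw [integral_finsetSum _ (fun n _ => phi_e_int _ _)]
  apply Finset.sum_congr rfl
  intro n _
  rw [← phi_hat, ← integral_const_mul]
  congr 1
  ext v
  ring

lemma DD_repr (N : ℕ) (t lam : ℝ) (hl : 0 < lam) (hN : Real.log N ≤ lam) :
    DD N t = 2 * (∫ v, (phi v:ℂ) * DD N (t + v * (1 / (2 * lam)))) - ∫ v, (phi v:ℂ) * DD N (t + v * (1 / lam)) := by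
  rw [DD_phi, DD_phi, Finset.mul_sum, ← Finset.sum_sub_distrib, DD]
  apply Finset.sum_congr rfl
  intro n hn
  rw [Finset.mem_Ico] at hn
  have h0 : 0 ≤ Real.log n := Real.log_natCast_nonneg n
  have h1 : Real.log n ≤ lam := (Real.log_le_log (by exact_mod_cast hn.1) (by exact_mod_cast Nat.lt_succ_iff.1 hn.2)).trans hN
  have h2 : Real.log n / lam ≤ 1 := (div_le_one hl).2 h1
  have e1 : La (-(1 / lam * Real.log n)) = 1 - Real.log n / lam := by
    rw [La, abs_neg, abs_of_nonneg (by positivity), max_eq_right] <;> rw [one_div_mul_eq_div]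
    linarith
  have e2 : La (-(1 / (2 * lam) * Real.log n)) = 1 - Real.log n / lam / 2 := by
    rw [La, abs_neg, abs_of_nonneg (by positivity), max_eq_right] <;> rw [show 1 / (2 * lam) * Real.log n = Real.log n / lam / 2 by field_simp]
    have : 0 ≤ Real.log n / lam := by positivity
    linarith
  rw [e1, e2]
  push_cast
  ring

lemma phi_jensen {g : ℝ → ℝ} (hg : Continuous g) {C : ℝ} (hC : ∀ v, |g v| ≤ C) :
    (∫ v, phi v * g v) ^ 2 ≤ ∫ v, phi v * g v ^ 2 := by
  have hC0 : 0 ≤ C := (abs_nonneg _).trans (hC 0)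
  set m := ∫ v, phi v * g v with hm
  have i1 : Integrable (fun v => phi v * g v) := phi_mul_int hg hC
  have i2 : Integrable (fun v => phi v * g v ^ 2) := phi_mul_int (f := fun v => g v ^ 2) (C := C ^ 2) (by fun_prop) (fun v => by
    rw [abs_pow]; exact pow_le_pow_left₀ (abs_nonneg _) (hC v) 2)
  have h : 0 ≤ ∫ v, phi v * (g v - m) ^ 2 := integral_nonneg (fun v => mul_nonneg (phi_nonneg v) (sq_nonneg _))
  have e1 : ∫ v, phi v * (g v - m) ^ 2 = (∫ v, phi v * g v ^ 2) - 2 * m * m + m ^ 2 * 1 := by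
    rw [← phi_int_one, ← integral_const_mul (m ^ 2)]
    nth_rewrite 3 [hm]
    have i3 : Integrable (fun v => phi v * g v ^ 2 - 2 * m * (phi v * g v)) := i2.sub (i1.const_mul _)
    rw [← integral_const_mul (2 * m), ← integral_sub i2 (i1.const_mul _), ← integral_add i3 (phi_int.const_mul _)]
    congr 1
    ext v
    ring
  nlinarith

lemma DD_le_W (N : ℕ) (t lam : ℝ) (hl : 0 < lam) (hN : Real.log N ≤ lam) :
    ‖DD N t‖ ^ 2 ≤ 8 * WW N (1 / (2 * lam)) t + 2 * WW N (1 / lam) t := by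
  have hc := DD_cont N
  have key : ∀ δ : ℝ, ‖∫ v, (phi v:ℂ) * DD N (t + v * δ)‖ ^ 2 ≤ WW N δ t := by
    intro δ
    have h1 : ‖∫ v, (phi v:ℂ) * DD N (t + v * δ)‖ ≤ ∫ v, phi v * ‖DD N (t + δ * v)‖ := by
      refine (norm_integral_le_integral_norm _).trans (le_of_eq ?_)
      congr 1
      ext v
      rw [norm_mul, Complex.norm_real, Real.norm_of_nonneg (phi_nonneg v), mul_comm v δ]
    calc _ ≤ (∫ v, phi v * ‖DD N (t + δ * v)‖) ^ 2 := by gcongr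
      _ ≤ _ := phi_jensen (g := fun v => ‖DD N (t + δ * v)‖) (C := 2 * √N) (by fun_prop) (fun v => by
        rw [abs_norm]; exact DD_norm _ _)
  have k1 := key (1 / (2 * lam))
  have k2 := key (1 / lam)
  rw [DD_repr N t lam hl hN]
  set a := ∫ v, (phi v:ℂ) * DD N (t + v * (1 / (2 * lam)))
  set b := ∫ v, (phi v:ℂ) * DD N (t + v * (1 / lam))
  have h : ‖2 * a - b‖ ≤ 2 * ‖a‖ + ‖b‖ := by
    refine (norm_sub_le _ _).trans ?_
    rw [norm_mul]; simp
  have h2 : ‖2 * a - b‖ ^ 2 ≤ (2 * ‖a‖ + ‖b‖) ^ 2 := by gcongr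
  nlinarith [sq_nonneg (2 * ‖a‖ - ‖b‖)]

/-- rescaled form of the window -/
lemma WW_scale (N : ℕ) (G t : ℝ) (hG : 0 < G) : ∫ s, phi (s / G) * ‖DD N (t + s)‖ ^ 2 = G * WW N G t := by
  have := Measure.integral_comp_div (fun v => phi v * ‖DD N (t + G * v)‖ ^ 2) G
  rw [abs_of_pos hG, smul_eq_mul] at this
  rw [WW, ← this]
  congr 1
  ext s
  rw [mul_div_cancel₀ _ hG.ne']

lemma WW_int (N : ℕ) (G t : ℝ) (hG : 0 < G) : Integrable (fun s => phi (s / G) * ‖DD N (t + s)‖ ^ 2) := by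
  have hc := DD_cont N
  have := (phi_mul_int (f := fun v => ‖DD N (t + G * v)‖ ^ 2) (C := 4 * N) (by fun_prop) (fun v => by
    rw [abs_of_nonneg (by positivity)]; exact DD_norm2 _ _)).comp_div hG.ne'
  refine this.congr (ae_of_all _ fun s => ?_)
  simp only []
  rw [mul_div_cancel₀ _ hG.ne']

lemma bdd_int (N : ℕ) (t : ℝ) {f : ℝ → ℝ} (hf : Integrable f) : Integrable (fun s => f s * ‖DD N (t + s)‖ ^ 2) := by
  have hc := DD_cont N
  exact hf.mul_bdd (g := fun s => ‖DD N (t + s)‖ ^ 2) (c := 4 * N) (by fun_prop) (ae_of_all _ fun v => by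
    rw [Real.norm_of_nonneg (by positivity)]; exact DD_norm2 _ _)

lemma W_le_Q (N : ℕ) (t mu : ℝ) (hmu : 1 ≤ mu) : WW N (1 / mu) t ≤ 2 * mu * ∫ s, (1 + s ^ 2)⁻¹ * ‖DD N (t + s)‖ ^ 2 := by
  have hmu0 : 0 < mu := by linarith
  have h := WW_scale N (1 / mu) t (by positivity)
  have h1 : ∫ s, phi (s / (1 / mu)) * ‖DD N (t + s)‖ ^ 2 ≤ ∫ s, 2 * ((1 + s ^ 2)⁻¹ * ‖DD N (t + s)‖ ^ 2) := by
    refine integral_mono (WW_int N _ t (by positivity)) ((bdd_int N t integrable_inv_one_add_sq).const_mul 2) (fun s => ?_)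
    simp only []
    rw [← mul_assoc]
    gcongr
    refine (phi_le _).trans ?_
    rw [div_eq_mul_inv]
    refine mul_le_mul_of_nonneg_left (inv_anti₀ (by positivity) ?_) (by norm_num)
    rw [div_div_eq_mul_div, div_one]
    have : 1 ≤ mu ^ 2 := one_le_pow₀ hmu
    nlinarith [sq_nonneg s]
  rw [h, integral_const_mul] at h1
  have h2 := mul_le_mul_of_nonneg_left h1 hmu0.le
  rw [← mul_assoc, mul_one_div_cancel hmu0.ne', one_mul] at h2
  linarith

lemma ker_le (G s : ℝ) (hG : 1 ≤ G) (m : ℕ) : (1 + s ^ 2)⁻¹ ≤ ∑ i ∈ Finset.range (m + 1), 64 * (1 / 4) ^ i * phi (s / (2 ^ i * G)) +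
    4 / ((2 ^ m * G) ^ 2 + s ^ 2) := by
  have hnn : ∀ i ∈ Finset.range (m + 1), 0 ≤ 64 * (1 / 4) ^ i * phi (s / (2 ^ i * G)) := fun i _ =>
    mul_nonneg (by positivity) (phi_nonneg _)
  have hs0 : (0:ℝ) < 1 + s ^ 2 := by positivity
  by_cases h : |s| ≤ 2 ^ m * G
  · have hex : ∃ i, |s| ≤ 2 ^ i * G := ⟨m, h⟩
    classical
    set i := Nat.find hex with hi
    have h1 : |s| ≤ 2 ^ i * G := Nat.find_spec hex
    have him : i ≤ m := Nat.find_min' hex h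
    have h2 := Finset.single_le_sum hnn (Finset.mem_range.2 (Nat.lt_succ_iff.2 him))
    have hp : 1 / 16 ≤ phi (s / (2 ^ i * G)) := by
      apply phi_ge
      rw [abs_div, abs_of_pos (show (0:ℝ) < 2 ^ i * G by positivity), div_le_iff₀ (by positivity)]
      linarith [show (0:ℝ) < 2 ^ i * G by positivity]
    have h3 : (1 + s ^ 2)⁻¹ ≤ 4 * (1 / 4) ^ i := by
      rcases Nat.eq_zero_or_pos i with h0 | h0
      · rw [h0, pow_zero]
        refine (inv_le_one_of_one_le₀ (by nlinarith [sq_nonneg s])).trans (by norm_num)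
      · obtain ⟨k, hk⟩ : ∃ k, i = k + 1 := ⟨i - 1, by omega⟩
        have h4 : ¬ |s| ≤ 2 ^ k * G := Nat.find_min hex (by omega)
        have h5 : (2:ℝ) ^ k ≤ |s| := by
          have : (0:ℝ) < 2 ^ k := by positivity
          nlinarith
        have h6 : (4:ℝ) ^ k ≤ s ^ 2 := by
          rw [← sq_abs, show (4:ℝ) = 2 ^ 2 by norm_num, ← pow_mul, mul_comm, pow_mul]; gcongr
        rw [hk, pow_succ (1 / 4 : ℝ), show (4:ℝ) * ((1 / 4) ^ k * (1 / 4)) = (4 ^ k)⁻¹ by rw [one_div, inv_pow]; ring]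
        gcongr
        linarith
    have h7 : 4 * (1 / 4) ^ i ≤ 64 * (1 / 4) ^ i * phi (s / (2 ^ i * G)) := by
      have : (0:ℝ) < (1 / 4) ^ i := by positivity
      nlinarith
    have : 0 ≤ 4 / ((2 ^ m * G) ^ 2 + s ^ 2) := by positivity
    linarith
  · push Not at h
    have h1 : (2 ^ m * G) ^ 2 ≤ s ^ 2 := by rw [← sq_abs s]; gcongr
    have h0 : 0 < (2 ^ m * G) ^ 2 := by positivity
    have : (1 + s ^ 2)⁻¹ ≤ 4 / ((2 ^ m * G) ^ 2 + s ^ 2) := by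
      rw [inv_eq_one_div, div_le_div_iff₀ hs0 (by positivity)]
      linarith
    linarith [Finset.sum_nonneg hnn]

lemma Q_le (N : ℕ) (t G : ℝ) (hG : 1 ≤ G) (m : ℕ) (B : ℝ) (hB0 : 0 ≤ B) (hB : ∀ i ≤ m, WW N (2 ^ i * G) t ≤ B) :
    ∫ s, (1 + s ^ 2)⁻¹ * ‖DD N (t + s)‖ ^ 2 ≤ 128 * G * B + 16 * π * N / (2 ^ m * G) := by
  have hX : 0 < 2 ^ m * G := by positivity
  obtain ⟨hc1, hc2⟩ := cauchy_int hX
  have i1 : ∀ i ∈ Finset.range (m + 1), Integrable (fun s => 64 * (1 / 4) ^ i * (phi (s / (2 ^ i * G)) * ‖DD N (t + s)‖ ^ 2)) :=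
    fun i _ => (WW_int N _ t (by positivity)).const_mul _
  have h1 : ∫ s, (1 + s ^ 2)⁻¹ * ‖DD N (t + s)‖ ^ 2 ≤ ∫ s, (∑ i ∈ Finset.range (m + 1), 64 * (1 / 4) ^ i * (phi (s / (2 ^ i * G)) * ‖DD N (t + s)‖ ^ 2) +
      4 * N * (4 / ((2 ^ m * G) ^ 2 + s ^ 2))) := by
    refine integral_mono (bdd_int N t integrable_inv_one_add_sq) ((integrable_finsetSum _ i1).add (hc1.const_mul _)) (fun s => ?_)
    simp only []
    have h2 := mul_le_mul_of_nonneg_right (ker_le G s hG m) (sq_nonneg ‖DD N (t + s)‖)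
    rw [add_mul, Finset.sum_mul] at h2
    simp only [mul_assoc] at h2 ⊢
    refine h2.trans (add_le_add le_rfl ?_)
    rw [mul_comm, ← mul_assoc]
    exact mul_le_mul_of_nonneg_right (DD_norm2 _ _) (by positivity)
  rw [integral_add (integrable_finsetSum _ i1) (hc1.const_mul _), integral_finsetSum _ i1, integral_const_mul, hc2] at h1
  refine h1.trans ?_
  gcongr ?_ + ?_
  · calc _ ≤ ∑ i ∈ Finset.range (m + 1), 64 * (1 / 2) ^ i * (G * B) := by
          apply Finset.sum_le_sum
          intro i hi
          rw [integral_const_mul, WW_scale _ _ _ (by positivity)]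
          have := hB i (Nat.lt_succ_iff.1 (Finset.mem_range.1 hi))
          calc _ ≤ 64 * (1 / 4) ^ i * (2 ^ i * G * B) := by gcongr
            _ = _ := by
              rw [show (1 / 4 : ℝ) = 1 / 2 * (1 / 2) by norm_num, mul_pow, one_div, inv_pow]
              field_simp
      _ ≤ _ := by
          have hgs : ∑ i ∈ Finset.range (m + 1), (1 / 2 : ℝ) ^ i ≤ 2 := by
            rw [geom_sum_eq (by norm_num), show ∀ x : ℝ, (x - 1) / (1 / 2 - 1) = 2 - 2 * x by intro x; ring]
            have : (0:ℝ) < (1 / 2) ^ (m + 1) := by positivity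
            linarith
          rw [← Finset.sum_mul, ← Finset.mul_sum]
          have := mul_le_mul_of_nonneg_right hgs (show 0 ≤ 64 * (G * B) by positivity)
          linarith
  · apply le_of_eq; ring

lemma DD_le (T L G t : ℝ) (m : ℕ) (hL : L = Real.log T) (hL1 : 4 ≤ L) (hT : 5 ≤ T) (hG : 1 ≤ G) (hm : T / 2 ≤ 2 ^ m * G)
    (hB : ∀ i ≤ m, WW ⌈T⌉₊ (2 ^ i * G) t ≤ AA * L) :
    ‖DD ⌈T⌉₊ t‖ ^ 2 ≤ 24000 * AA * L ^ 2 * G := by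
  have hBB := BB_one
  have hA : 1 ≤ AA := by unfold AA; linarith
  set N := ⌈T⌉₊ with hNd
  have hN : T ≤ N := Nat.le_ceil T
  have hN2 : (N:ℝ) ≤ 2 * T := by have := Nat.ceil_lt_add_one (show 0 ≤ T by linarith); linarith
  have hlogN : Real.log N ≤ 2 * L := by
    have h1 := Real.log_le_log (by linarith) hN2
    rw [Real.log_mul (by norm_num) (by linarith), ← hL] at h1
    linarith [Real.log_two_lt_d9]
  have h1 := DD_le_W N t (2 * L) (by linarith) hlogN
  have h2 := W_le_Q N t (2 * (2 * L)) (by linarith)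
  have h3 := W_le_Q N t (2 * L) (by linarith)
  have h4 := Q_le N t G hG m (AA * L) (by positivity) hB
  have h5 : 16 * π * N / (2 ^ m * G) ≤ 16 * 4 * 4 := by
    rw [div_le_iff₀ (by positivity)]
    have := Real.pi_le_four
    calc 16 * π * N ≤ 16 * 4 * (2 * T) := by gcongr
      _ ≤ _ := by linarith
  set Q := ∫ s, (1 + s ^ 2)⁻¹ * ‖DD N (t + s)‖ ^ 2
  have h6 : 1 * 4 ≤ G * (AA * L) := by
    have : 4 ≤ AA * L := by nlinarith
    gcongr
  have h7 : ‖DD N t‖ ^ 2 ≤ 72 * L * Q := by linarith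
  calc _ ≤ 72 * L * Q := h7
    _ ≤ 72 * L * (320 * (G * (AA * L))) := by
      gcongr
      linarith
    _ ≤ _ := by
      have : 0 ≤ L * (G * (AA * L)) := by positivity
      nlinarith

end HB12

open Real MeasureTheory
namespace HB12
open Filter Topology Set

lemma cells_count {T G L : ℝ} (hT : 5 ≤ T) (hL : L = Real.log T) (hL1 : 4 ≤ L) (hG : 20 ≤ G) (hGL : L ^ 2 ≤ G) (hGT : G ≤ T)
    {R : Finset ℝ} (hR : ∀ r ∈ R, T ≤ r ∧ r ≤ 2 * T) (hinj : ∀ r ∈ R, ∀ s ∈ R, ⌊r / G⌋₊ = ⌊s / G⌋₊ → r = s)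
    (hW : ∀ r ∈ R, AA * L ≤ WW ⌈T⌉₊ G r) : (R.card:ℝ) ≤ 20400 * (L ^ 2 * T / G ^ 3) ^ 2 := by
  classical
  have hG0 : 0 < G := by linarith
  set T0 := G ^ 3 / L ^ 2 with hT0
  have hT00 : 0 < T0 := by positivity
  set x := L ^ 2 * T / G ^ 3 with hx
  have hx0 : 0 < x := by positivity
  set f : ℝ → ℕ × ℕ := fun r => (⌊r / G⌋₊ % 2, ⌊r / T0⌋₊) with hf
  set tt : Finset (ℕ × ℕ) := Finset.range 2 ×ˢ Finset.range (⌊2 * T / T0⌋₊ + 1) with htt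
  have key := Finset.card_le_mul_card_image_of_maps_to (s := R) (t := tt) (f := f) ?_ ⌊100 * x⌋₊ ?_
  · have hc : (tt.card:ℝ) = 2 * (⌊2 * T / T0⌋₊ + 1) := by
      rw [htt, Finset.card_product, Finset.card_range, Finset.card_range]; push_cast; ring
    have hk : (R.card:ℝ) ≤ ⌊100 * x⌋₊ * (2 * (⌊2 * T / T0⌋₊ + 1)) := by rw [← hc]; exact_mod_cast key
    rcases lt_or_ge (100 * x) 1 with h | h
    · rw [Nat.floor_eq_zero.2 h] at hk
      simp only [Nat.cast_zero, zero_mul] at hk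
      exact hk.trans (by positivity)
    · have h1 : (⌊100 * x⌋₊ : ℝ) ≤ 100 * x := Nat.floor_le (by positivity)
      have h2 : (⌊2 * T / T0⌋₊ : ℝ) ≤ 2 * x := by
        refine (Nat.floor_le (by positivity)).trans (le_of_eq ?_)
        rw [hT0, hx]; field_simp
      calc _ ≤ _ := hk
        _ ≤ 100 * x * (2 * (2 * x + 100 * x)) := by gcongr
        _ = _ := by ring
  · intro r hr
    simp only [htt, hf, Finset.mem_product, Finset.mem_range]
    refine ⟨Nat.mod_lt _ (by norm_num), Nat.lt_succ_iff.2 (Nat.floor_le_floor ?_)⟩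
    have := (hR r hr).2
    gcongr
  · rintro ⟨b1, b2⟩ -
    apply Nat.le_floor
    have hm : ∀ r ∈ R.filter (fun a => f a = (b1, b2)), r ∈ R ∧ ⌊r / G⌋₊ % 2 = b1 ∧ ⌊r / T0⌋₊ = b2 := by
      intro r hr
      simpa only [hf, Finset.mem_filter, Prod.mk.injEq] using hr
    have hbd : ∀ r ∈ R, ∀ c : ℝ, 0 < c → (⌊r / c⌋₊ : ℝ) * c ≤ r ∧ r < (⌊r / c⌋₊ + 1) * c := by
      intro r hr c hc
      have hr0 : 0 ≤ r := by linarith [(hR r hr).1]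
      exact ⟨(le_div_iff₀ hc).1 (Nat.floor_le (by positivity)), (div_lt_iff₀ hc).1 (Nat.lt_floor_add_one _)⟩
    apply lv_count hT hL hL1 hG hGL hGT (fun r hr => hR r (hm r hr).1) _ _ (fun r hr => hW r (hm r hr).1)
    · have main : ∀ r ∈ R, ∀ s ∈ R, ⌊r / G⌋₊ + 2 ≤ ⌊s / G⌋₊ → G ≤ s - r := by
        intro r hr s hs h
        have h' : (⌊r / G⌋₊ : ℝ) + 2 ≤ ⌊s / G⌋₊ := by exact_mod_cast h
        have h1 := (hbd r hr G hG0).2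
        have h2 := (hbd s hs G hG0).1
        nlinarith
      intro r hr s hs hne
      obtain ⟨hr1, hr2, -⟩ := hm r hr
      obtain ⟨hs1, hs2, -⟩ := hm s hs
      have : ⌊r / G⌋₊ ≠ ⌊s / G⌋₊ := fun h => hne (hinj r hr1 s hs1 h)
      rcases (by omega : ⌊r / G⌋₊ + 2 ≤ ⌊s / G⌋₊ ∨ ⌊s / G⌋₊ + 2 ≤ ⌊r / G⌋₊) with h | h
      · rw [abs_sub_comm]; exact (main r hr1 s hs1 h).trans (le_abs_self _)
      · exact (main s hs1 r hr1 h).trans (le_abs_self _)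
    · intro r hr s hs
      obtain ⟨hr1, -, hr2⟩ := hm r hr
      obtain ⟨hs1, -, hs2⟩ := hm s hs
      have h1 := hbd r hr1 T0 hT00
      have h2 := hbd s hs1 T0 hT00
      rw [hr2] at h1
      rw [hs2] at h2
      rw [abs_le]
      constructor <;> nlinarith

lemma select (p : ℝ → Prop) {M G : ℝ} (hG : 0 < G) (hp : ∀ t, p t → 0 ≤ t ∧ t ≤ M) :
    ∃ R : Finset ℝ, (∀ r ∈ R, p r) ∧ (∀ r ∈ R, ∀ s ∈ R, ⌊r / G⌋₊ = ⌊s / G⌋₊ → r = s) ∧ ∀ t, p t → ∃ r ∈ R, |t - r| ≤ G := by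
  classical
  set K := (Finset.range (⌊M / G⌋₊ + 1)).filter (fun k => ∃ t, p t ∧ ⌊t / G⌋₊ = k) with hK
  have hch : ∀ k : ℕ, ∃ t, k ∈ K → p t ∧ ⌊t / G⌋₊ = k := by
    intro k
    by_cases hk : k ∈ K
    · obtain ⟨t, ht⟩ := (Finset.mem_filter.1 hk).2
      exact ⟨t, fun _ => ht⟩
    · exact ⟨0, fun h => absurd h hk⟩
  choose r hr using hch
  refine ⟨K.image r, ?_, ?_, ?_⟩
  · intro x hx
    obtain ⟨k, hk, rfl⟩ := Finset.mem_image.1 hx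
    exact (hr k hk).1
  · intro x hx y hy h
    obtain ⟨k, hk, rfl⟩ := Finset.mem_image.1 hx
    obtain ⟨l, hl, rfl⟩ := Finset.mem_image.1 hy
    rw [(hr k hk).2, (hr l hl).2] at h
    rw [h]
  · intro t ht
    obtain ⟨h0, hM⟩ := hp t ht
    have hk : ⌊t / G⌋₊ ∈ K := by
      rw [hK, Finset.mem_filter, Finset.mem_range]
      refine ⟨Nat.lt_succ_iff.2 (Nat.floor_le_floor ?_), t, ht, rfl⟩
      gcongr
    refine ⟨_, Finset.mem_image_of_mem r hk, ?_⟩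
    obtain ⟨h1, h2⟩ := hr _ hk
    obtain ⟨h3, -⟩ := hp _ h1
    have a1 : (⌊t / G⌋₊ : ℝ) ≤ t / G := Nat.floor_le (by positivity)
    have a2 := Nat.lt_floor_add_one (t / G)
    have b1 : (⌊r ⌊t / G⌋₊ / G⌋₊ : ℝ) ≤ r ⌊t / G⌋₊ / G := Nat.floor_le (by positivity)
    have b2 := Nat.lt_floor_add_one (r ⌊t / G⌋₊ / G)
    rw [h2] at b1 b2
    rw [le_div_iff₀ hG] at a1 b1
    rw [div_lt_iff₀ hG] at a2 b2
    rw [abs_le]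
    constructor <;> linarith

lemma int_phi_le (N : ℕ) {T G : ℝ} (r : ℝ) (hT : 0 ≤ T) (hG : 0 < G) :
    ∫ t in T..(2 * T), phi ((t - r) / G) * ‖DD N t‖ ^ 2 ≤ G * WW N G r := by
  have hi := (WW_int N G r hG).comp_sub_right r
  have he := integral_sub_right_eq_self (μ := volume) (fun s => phi (s / G) * ‖DD N (r + s)‖ ^ 2) r
  simp only [add_sub_cancel] at hi he
  rw [WW_scale N G r hG] at he
  rw [← he, intervalIntegral.integral_of_le (by linarith)]
  exact setIntegral_le_integral hi (ae_of_all _ fun t => mul_nonneg (phi_nonneg _) (by positivity))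

lemma block_D {T L : ℝ} (hL : L = Real.log T) (hL1 : 10 ≤ L) (hT : 33 ≤ T) (hLT : L ^ 8 ≤ 40320 * T) :
    ∫ t in T..(2 * T), ‖DD ⌈T⌉₊ t‖ ^ 12 ≤ 10 ^ 10 * (24000 * AA) ^ 6 * T ^ 2 * L ^ 16 := by
  classical
  have hBB := BB_one
  have hA : 1 ≤ AA := by unfold AA; linarith
  have hL2T : 20 * L ^ 2 ≤ T := by
    have h1 : 10 ^ 6 ≤ L ^ 6 := by gcongr
    nlinarith [mul_le_mul_of_nonneg_right h1 (sq_nonneg L)]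
  set N := ⌈T⌉₊ with hN
  have hcD := DD_cont N
  set C := 24000 * AA with hC
  have hC0 : 0 < C := by positivity
  -- scales
  obtain ⟨J, hJ1, hJ2⟩ := exists_nat_pow_near (show (1:ℝ) ≤ T by linarith) (one_lt_two)
  obtain ⟨k0, hk1, hk2⟩ := exists_nat_pow_near (show (1:ℝ) ≤ L ^ 2 by nlinarith) (one_lt_two)
  set j0 := k0 + 1 with hj0
  have hj0a : (2:ℝ) ^ j0 ≤ 2 * L ^ 2 := by rw [hj0, pow_succ]; linarith
  have hjj : j0 ≤ J := by
    have : (2:ℝ) ^ j0 < 2 ^ (J + 1) := by nlinarith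
    have := (pow_lt_pow_iff_right₀ (one_lt_two (α := ℝ))).1 this
    omega
  have hpow : ∀ j, j0 ≤ j → L ^ 2 ≤ (2:ℝ) ^ j ∧ (20:ℝ) ≤ 2 ^ j := by
    intro j hj
    have h1 : (2:ℝ) ^ j0 ≤ 2 ^ j := pow_le_pow_right₀ (by norm_num) hj
    constructor <;> nlinarith
  have hpowT : ∀ j, j ≤ J → (2:ℝ) ^ j ≤ T := fun j hj => (pow_le_pow_right₀ (by norm_num) hj).trans hJ1
  -- pointwise bound at good points
  have hgood : ∀ t j, j ≤ J → (∀ k, j ≤ k → k ≤ J → WW N (2 ^ k) t ≤ AA * L) → ‖DD N t‖ ^ 2 ≤ C * L ^ 2 * 2 ^ j := by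
    intro t j hj h
    refine DD_le T L (2 ^ j) t (J - j) hL (by linarith) (by linarith) (one_le_pow₀ (by norm_num)) ?_ ?_
    · rw [← pow_add, Nat.sub_add_cancel hj]; rw [pow_succ] at hJ2; linarith
    · intro i hi
      rw [← pow_add]
      exact h _ (by omega) (by omega)
  -- the top scale is good
  have htop : ∀ t, T ≤ t → t ≤ 2 * T → WW N (2 ^ J) t ≤ AA * L := by
    intro t h1 h2
    by_contra hcon
    push Not at hcon
    have := lv_count (R := {t}) (by linarith) hL (by linarith) (hpow J hjj).2 (hpow J hjj).1 hJ1 (by simp [h1, h2])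
      (by simp) (by simp; positivity) (by simpa using hcon.le)
    rw [Finset.card_singleton, ← mul_div_assoc, le_div_iff₀ (by positivity)] at this
    have h3 : T / 2 ≤ 2 ^ J := by rw [pow_succ] at hJ2; linarith
    have h4 : (T / 2) ^ 3 ≤ (2 ^ J) ^ 3 := by gcongr
    push_cast at this
    have h5 : 100 * (L ^ 2 * T) ≤ 5 * T * T := by nlinarith
    have h6 : 41 ≤ T := by nlinarith
    have h7 : 41 * (T * T) ≤ T * (T * T) := by gcongr
    nlinarith [mul_pos (show 0 < T by linarith) (show 0 < T by linarith)]
  -- selection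
  have hsel : ∀ j, ∃ R : Finset ℝ, (∀ r ∈ R, (T ≤ r ∧ r ≤ 2 * T) ∧ AA * L ≤ WW N (2 ^ j) r ∧ WW N (2 ^ (j + 1)) r ≤ AA * L) ∧
      (∀ r ∈ R, ∀ s ∈ R, ⌊r / 2 ^ j⌋₊ = ⌊s / 2 ^ j⌋₊ → r = s) ∧
      ∀ t, ((T ≤ t ∧ t ≤ 2 * T) ∧ AA * L ≤ WW N (2 ^ j) t ∧ WW N (2 ^ (j + 1)) t ≤ AA * L) → ∃ r ∈ R, |t - r| ≤ 2 ^ j :=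
    fun j => select (fun t => (T ≤ t ∧ t ≤ 2 * T) ∧ AA * L ≤ WW N (2 ^ j) t ∧ WW N (2 ^ (j + 1)) t ≤ AA * L) (M := 2 * T)
      (by positivity) (fun t ht => ⟨by linarith [ht.1.1], ht.1.2⟩)
  choose R hR1 hR2 hR3 using hsel
  set F : ℕ → ℝ → ℝ → ℝ := fun j r t => (C * L ^ 2 * 2 ^ (j + 1)) ^ 5 * 16 * (phi ((t - r) / 2 ^ (j + 1)) * ‖DD N t‖ ^ 2) with hF
  have hF0 : ∀ j r t, 0 ≤ F j r t := fun j r t => by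
    have := phi_nonneg ((t - r) / 2 ^ (j + 1))
    positivity
  have hFc : ∀ j r, Continuous (F j r) := fun j r => by simp only [hF]; fun_prop
  have hpt : ∀ t ∈ Icc T (2 * T), ‖DD N t‖ ^ 12 ≤ (C * L ^ 2 * 2 ^ j0) ^ 6 + ∑ j ∈ Finset.Ico j0 J, ∑ r ∈ R j, F j r t := by
    intro t ht
    have hS0 : 0 ≤ ∑ j ∈ Finset.Ico j0 J, ∑ r ∈ R j, F j r t :=
      Finset.sum_nonneg fun j _ => Finset.sum_nonneg fun r _ => hF0 j r t
    by_cases hall : ∀ k, j0 ≤ k → k ≤ J → WW N (2 ^ k) t ≤ AA * L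
    · have h1 := hgood t j0 hjj hall
      calc ‖DD N t‖ ^ 12 = (‖DD N t‖ ^ 2) ^ 6 := by ring
        _ ≤ (C * L ^ 2 * 2 ^ j0) ^ 6 := by gcongr
        _ ≤ _ := by linarith
    · push Not at hall
      obtain ⟨k, hka, hkb, hkc⟩ := hall
      set S := (Finset.Icc j0 J).filter (fun j => AA * L < WW N (2 ^ j) t) with hS
      have hne : S.Nonempty := ⟨k, by simp [hS, hka, hkb, hkc]⟩
      obtain ⟨hj1, hj2⟩ := Finset.mem_filter.1 (S.max'_mem hne)
      set j := S.max' hne with hj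
      rw [Finset.mem_Icc] at hj1
      have hup : ∀ l, j + 1 ≤ l → l ≤ J → WW N (2 ^ l) t ≤ AA * L := by
        intro l hl hlJ
        by_contra hcon
        have := S.le_max' l (Finset.mem_filter.2 ⟨Finset.mem_Icc.2 ⟨by omega, hlJ⟩, not_le.1 hcon⟩)
        omega
      have hjJ : j < J := by
        rcases hj1.2.lt_or_eq with h | h
        · exact h
        · rw [h] at hj2; exact absurd (htop t ht.1 ht.2) (not_le.2 hj2)
      have hg := hgood t (j + 1) hjJ hup
      obtain ⟨r, hr, hrt⟩ := hR3 j t ⟨ht, hj2.le, hup (j + 1) le_rfl hjJ⟩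
      have hp : 1 / 16 ≤ phi ((t - r) / 2 ^ (j + 1)) := by
        apply phi_ge
        rw [abs_div, abs_of_pos (show (0:ℝ) < 2 ^ (j + 1) by positivity), div_le_iff₀ (by positivity), pow_succ]
        linarith [show (0:ℝ) < 2 ^ j by positivity]
      have h1 : ‖DD N t‖ ^ 12 ≤ F j r t := by
        calc ‖DD N t‖ ^ 12 = (‖DD N t‖ ^ 2) ^ 5 * 16 * (1 / 16 * ‖DD N t‖ ^ 2) := by ring
          _ ≤ F j r t := by simp only [hF]; gcongr
      have h2 := Finset.single_le_sum (fun r _ => hF0 j r t) hr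
      have h3 := Finset.single_le_sum (f := fun j => ∑ r ∈ R j, F j r t) (fun j _ => Finset.sum_nonneg fun r _ => hF0 j r t) (Finset.mem_Ico.2 ⟨hj1.1, hjJ⟩)
      have : 0 ≤ (C * L ^ 2 * 2 ^ j0) ^ 6 := by positivity
      linarith
  have hint := intervalIntegral.integral_mono_on (μ := volume) (a := T) (b := 2 * T) (by linarith)
    (Continuous.intervalIntegrable (by fun_prop) _ _) (Continuous.intervalIntegrable (by fun_prop) _ _) hpt
  refine hint.trans ?_
  rw [intervalIntegral.integral_add (Continuous.intervalIntegrable (by fun_prop) _ _) (Continuous.intervalIntegrable (by fun_prop) _ _),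
    intervalIntegral.integral_const, intervalIntegral.integral_finsetSum (fun j _ => Continuous.intervalIntegrable (by fun_prop) _ _)]
  have hterm : ∀ j ∈ Finset.Ico j0 J, ∫ t in T..(2 * T), ∑ r ∈ R j, F j r t ≤ 30000000 * C ^ 6 * T ^ 2 * L ^ 15 := by
    intro j hj
    rw [Finset.mem_Ico] at hj
    rw [intervalIntegral.integral_finsetSum (fun r _ => (hFc j r).intervalIntegrable _ _)]
    have hcnt := cells_count (by linarith) hL (by linarith) (hpow j hj.1).2 (hpow j hj.1).1 (hpowT j hj.2.le) (fun r hr => (hR1 j r hr).1)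
      (hR2 j) (fun r hr => (hR1 j r hr).2.1)
    have h1 : ∀ r ∈ R j, ∫ t in T..(2 * T), F j r t ≤ (C * L ^ 2 * 2 ^ (j + 1)) ^ 5 * 16 * (2 ^ (j + 1) * (AA * L)) := by
      intro r hr
      simp only [hF]
      rw [intervalIntegral.integral_const_mul]
      have h2 := int_phi_le N (T := T) (G := 2 ^ (j + 1)) r (by linarith) (by positivity)
      have h3 := (hR1 j r hr).2.2
      have : (2:ℝ) ^ (j + 1) * WW N (2 ^ (j + 1)) r ≤ 2 ^ (j + 1) * (AA * L) := by gcongr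
      gcongr
      exact h2.trans this
    refine (Finset.sum_le_card_nsmul _ _ _ h1).trans ?_
    rw [nsmul_eq_mul]
    have hg0 : (0:ℝ) < 2 ^ j := by positivity
    have hAC : AA ≤ C / 24000 := by rw [hC]; linarith
    calc _ ≤ 20400 * (L ^ 2 * T / (2 ^ j) ^ 3) ^ 2 * ((C * L ^ 2 * 2 ^ (j + 1)) ^ 5 * 16 * (2 ^ (j + 1) * (C / 24000 * L))) := by gcongr
      _ = 20400 * 16 * 64 / 24000 * (C ^ 6 * T ^ 2 * L ^ 15) := by rw [pow_succ]; field_simp; ring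
      _ ≤ 30000000 * (C ^ 6 * T ^ 2 * L ^ 15) := by gcongr; norm_num
      _ = _ := by ring
  have hsum := Finset.sum_le_card_nsmul _ _ _ hterm
  rw [nsmul_eq_mul, Nat.card_Ico] at hsum
  have hJL : ((J - j0 : ℕ):ℝ) ≤ 2 * L := by
    have h1 : ((J - j0 : ℕ):ℝ) ≤ J := by exact_mod_cast Nat.sub_le _ _
    have h2 := Real.log_le_log (by positivity) hJ1
    rw [Real.log_pow, ← hL] at h2
    nlinarith [Real.log_two_gt_d9, (Nat.cast_nonneg J : (0:ℝ) ≤ J)]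
  have hfirst : (2 * T - T) • (C * L ^ 2 * 2 ^ j0) ^ 6 ≤ 64 * 40320 * (C ^ 6 * T ^ 2 * L ^ 16) := by
    rw [smul_eq_mul]
    calc _ ≤ (2 * T - T) * (C * L ^ 2 * (2 * L ^ 2)) ^ 6 := by
          have : 0 ≤ 2 * T - T := by linarith
          gcongr
      _ = 64 * C ^ 6 * T * L ^ 16 * L ^ 8 := by ring
      _ ≤ 64 * C ^ 6 * T * L ^ 16 * (40320 * T) := by gcongr
      _ = _ := by ring
  have hsum2 : ((J - j0 : ℕ):ℝ) * (30000000 * C ^ 6 * T ^ 2 * L ^ 15) ≤ 60000000 * (C ^ 6 * T ^ 2 * L ^ 16) := by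
    calc _ ≤ 2 * L * (30000000 * C ^ 6 * T ^ 2 * L ^ 15) := by gcongr
      _ = _ := by ring
  have hpos : 0 ≤ C ^ 6 * T ^ 2 * L ^ 16 := by positivity
  linarith

end HB12

open Real MeasureTheory
namespace HB12
open Filter Topology Set

lemma zeta_cont : Continuous (fun t : ℝ => ‖riemannZeta (1 / 2 + Complex.I * (t : ℂ))‖ ^ 12) := by
  rw [continuous_iff_continuousAt]
  intro t
  have h1 : (1 / 2 + Complex.I * (t : ℂ)) ≠ 1 := by
    intro h
    have := congrArg Complex.re h
    norm_num at this
  have h2 : ContinuousAt (fun t : ℝ => (1 / 2 + Complex.I * (t : ℂ))) t := by fun_prop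
  have h3 := (differentiableAt_riemannZeta h1).continuousAt
  exact (ContinuousAt.comp (f := fun t : ℝ => (1 / 2 + Complex.I * (t : ℂ))) h3 h2).norm.pow 12

lemma block_Z : ∃ C : ℝ, 0 < C ∧ ∀ T : ℝ, Real.exp 10 ≤ T →
    ∫ t in T..(2 * T), ‖riemannZeta (1 / 2 + Complex.I * (t : ℂ))‖ ^ 12 ≤ C * T ^ 2 * Real.log T ^ 17 := by
  have hBB := BB_one
  have hA : 0 < AA := by unfold AA; linarith
  refine ⟨2 ^ 11 * (10 ^ 10 * (24000 * AA) ^ 6 + 500 ^ 12), by positivity, fun T hT => ?_⟩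
  have hT0 : 0 < T := (Real.exp_pos _).trans_le hT
  set L := Real.log T with hL
  have hL1 : 10 ≤ L := (Real.le_log_iff_exp_le hT0).2 hT
  have hLT : L ^ 8 ≤ 40320 * T := by
    have := Real.pow_div_factorial_le_exp L (by linarith) 8
    rw [hL, Real.exp_log hT0, ← hL, div_le_iff₀ (by positivity)] at this
    norm_num [Nat.factorial] at this
    linarith
  have hT33 : 33 ≤ T := by
    have h1 : 10 ^ 8 ≤ L ^ 8 := by gcongr
    linarith
  have hD := block_D hL hL1 hT33 hLT
  have hcD := DD_cont ⌈T⌉₊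
  have hm := intervalIntegral.integral_mono_on (μ := volume) (a := T) (b := 2 * T) (by linarith)
    (zeta_cont.intervalIntegrable _ _) (g := fun t => 2 ^ 11 * (‖DD ⌈T⌉₊ t‖ ^ 12 + 500 ^ 12)) (Continuous.intervalIntegrable (by fun_prop) _ _) (by
      intro t ht
      have h1 := zeta_approx T t (by linarith) ht.1 ht.2
      have h2 : ‖riemannZeta (1 / 2 + Complex.I * (t : ℂ))‖ ≤ ‖DD ⌈T⌉₊ t‖ + 500 := by
        have := norm_le_norm_add_norm_sub' (riemannZeta (1 / 2 + Complex.I * (t : ℂ))) (DD ⌈T⌉₊ t)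
        linarith
      calc _ ≤ (‖DD ⌈T⌉₊ t‖ + 500) ^ 12 := by gcongr
        _ ≤ _ := add_pow_le (norm_nonneg _) (by norm_num) 12)
  refine hm.trans ?_
  rw [intervalIntegral.integral_const_mul, intervalIntegral.integral_add (Continuous.intervalIntegrable (by fun_prop) _ _)
    (Continuous.intervalIntegrable (by fun_prop) _ _), intervalIntegral.integral_const, smul_eq_mul]
  have h1 : T ≤ T ^ 2 := by nlinarith
  have h2 : T ^ 2 ≤ T ^ 2 * L ^ 17 := le_mul_of_one_le_right (by positivity) (one_le_pow₀ (by linarith))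
  have h3 : T ^ 2 * L ^ 16 ≤ T ^ 2 * L ^ 17 := by gcongr <;> linarith
  calc _ ≤ 2 ^ 11 * (10 ^ 10 * (24000 * AA) ^ 6 * T ^ 2 * L ^ 16 + (2 * T - T) * 500 ^ 12) := by gcongr
    _ = 2 ^ 11 * (10 ^ 10 * (24000 * AA) ^ 6 * (T ^ 2 * L ^ 16) + T * 500 ^ 12) := by ring
    _ ≤ 2 ^ 11 * (10 ^ 10 * (24000 * AA) ^ 6 * (T ^ 2 * L ^ 17) + (T ^ 2 * L ^ 17) * 500 ^ 12) := by
      gcongr; linarith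
    _ = _ := by ring

lemma moment12 : ∃ C : ℝ, 0 < C ∧ ∀ T : ℝ, 2 ≤ T →
      (∫ t in (0:ℝ)..T, ‖riemannZeta (1 / 2 + Complex.I * (t : ℂ))‖ ^ 12) ≤ C * T ^ 2 * Real.log T ^ 17 := by
  obtain ⟨C1, hC1, hblock⟩ := block_Z
  have hint : ∀ a b : ℝ, IntervalIntegrable (fun t : ℝ => ‖riemannZeta (1 / 2 + Complex.I * (t : ℂ))‖ ^ 12) volume a b :=
    fun a b => zeta_cont.intervalIntegrable a b
  set Z := fun t : ℝ => ‖riemannZeta (1 / 2 + Complex.I * (t : ℂ))‖ ^ 12 with hZ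
  have hnn : ∀ t : ℝ, 0 ≤ Z t := fun t => by simp only [hZ]; positivity
  set M := ∫ t in (0:ℝ)..(2 * Real.exp 10), Z t with hM
  have hM0 : 0 ≤ M := intervalIntegral.integral_nonneg (by positivity) (fun t _ => hnn t)
  have hl2 : 0 < Real.log 2 := Real.log_pos (by norm_num)
  set C := C1 + M / (4 * Real.log 2 ^ 17) with hC
  have hC0 : 0 < C := by positivity
  have key : ∀ n : ℕ, ∀ T : ℝ, 2 ≤ T → T ≤ 2 ^ n * (2 * Real.exp 10) → (∫ t in (0:ℝ)..T, Z t) ≤ C * T ^ 2 * Real.log T ^ 17 := by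
    have base : ∀ T : ℝ, 2 ≤ T → T ≤ 2 * Real.exp 10 → (∫ t in (0:ℝ)..T, Z t) ≤ C * T ^ 2 * Real.log T ^ 17 := by
      intro T hT hTn
      have h1 : ∫ t in (0:ℝ)..T, Z t ≤ M := by
        rw [hM, ← intervalIntegral.integral_add_adjacent_intervals (hint 0 T) (hint T (2 * Real.exp 10))]
        have := intervalIntegral.integral_nonneg (μ := volume) hTn (fun t _ => hnn t)
        linarith
      have h2 : Real.log 2 ≤ Real.log T := Real.log_le_log (by norm_num) hT
      have h3 : 2 ^ 2 * Real.log 2 ^ 17 ≤ T ^ 2 * Real.log T ^ 17 := by gcongr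
      calc _ ≤ M := h1
        _ = M / (4 * Real.log 2 ^ 17) * (2 ^ 2 * Real.log 2 ^ 17) := by field_simp; norm_num
        _ ≤ C * (T ^ 2 * Real.log T ^ 17) := by
          apply mul_le_mul _ h3 (by positivity) hC0.le
          rw [hC]; linarith
        _ = _ := by ring
    intro n
    induction n with
    | zero => intro T hT hTn; exact base T hT (by simpa using hTn)
    | succ n ih =>
      intro T hT hTn
      by_cases hb : T ≤ 2 * Real.exp 10
      · exact base T hT hb
      push Not at hb
      have he : 2 ≤ Real.exp 10 := by linarith [Real.add_one_le_exp 10]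
      have h1 := ih (T / 2) (by linarith) (by rw [pow_succ] at hTn; linarith)
      have h2 := hblock (T / 2) (by linarith)
      rw [show 2 * (T / 2) = T by ring] at h2
      rw [← intervalIntegral.integral_add_adjacent_intervals (hint 0 (T / 2)) (hint (T / 2) T)]
      have h3 : Real.log (T / 2) ≤ Real.log T := Real.log_le_log (by linarith) (by linarith)
      have h4 : 0 ≤ Real.log (T / 2) := Real.log_nonneg (by linarith)
      have h5 : C1 ≤ C := by
        have : 0 ≤ M / (4 * Real.log 2 ^ 17) := by positivity
        linarith
      have h6 : C * (T / 2) ^ 2 * Real.log (T / 2) ^ 17 ≤ C * (T / 2) ^ 2 * Real.log T ^ 17 := by gcongr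
      have h7 : C1 * (T / 2) ^ 2 * Real.log (T / 2) ^ 17 ≤ C * (T / 2) ^ 2 * Real.log T ^ 17 := by gcongr
      have h8 : 0 ≤ C * T ^ 2 * Real.log T ^ 17 := by
        have := h4.trans h3
        positivity
      calc _ ≤ C * (T / 2) ^ 2 * Real.log T ^ 17 + C * (T / 2) ^ 2 * Real.log T ^ 17 := add_le_add (h1.trans h6) (h2.trans h7)
        _ = C * T ^ 2 * Real.log T ^ 17 / 2 := by ring
        _ ≤ _ := by linarith
  refine ⟨C, hC0, fun T hT => ?_⟩
  obtain ⟨n, hn⟩ := pow_unbounded_of_one_lt T (one_lt_two)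
  refine key n T hT (hn.le.trans ?_)
  have he : 1 ≤ 2 * Real.exp 10 := by linarith [Real.add_one_le_exp 10]
  exact le_mul_of_one_le_right (by positivity) he

end HB12

open Real MeasureTheory

/-- Heath-Brown's twelfth moment bound: `∫_0^T |ζ(1/2+it)|^{12} dt ≪ T² (log T)^{17}`. -/
theorem twelfth_moment_bound :
    ∃ C : ℝ, 0 < C ∧ ∀ T : ℝ, 2 ≤ T →
      (∫ t in (0:ℝ)..T, ‖riemannZeta (1 / 2 + Complex.I * (t : ℂ))‖ ^ 12) ≤
        C * T ^ 2 * Real.log T ^ 17 := by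
  exact HB12.moment12
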